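/- (Cheap trick) There is an integer s₀ ≥ 1 with the following property. Let p/q be a rational number and A : 𝕋 → SL(2,ℝ) a smooth map homotopic to the identity such that 2 − δ := max_{x∈𝕋} |tr(A(x+(q−1)p/q)···A(x))| < 2. Then there exists η₀ > 0, depending only on ‖A‖_{C^{s₀}}, q and δ, such that for every 0 < η ≤ η₀ and every α ∈ D_{p/q}(η) satisfying ρ(α,A) ∈ DS_α \ {0}, there exists B ∈ C^∞(ℝ/2ℤ, SL(2,ℝ)) such that B(x+α)⁻¹ A(x) B(x) is a constant matrix in SO(2,ℝ). -/

import Mathlib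

open Matrix MeasureTheory
open scoped ENNReal

attribute [local instance] Matrix.normedAddCommGroup Matrix.normedSpace

/-- The rotation matrix `R_φ = [[cos φ, −sin φ], [sin φ, cos φ]] ∈ SO(2,ℝ)`. -/
noncomputable def Rot (φ : ℝ) : Matrix (Fin 2) (Fin 2) ℝ :=
  !![Real.cos φ, -Real.sin φ; Real.sin φ, Real.cos φ]

/-- A (1-periodic) map `A : 𝕋 → SL(2,ℝ)` is homotopic to the identity:  there is a
continuous homotopy, through 1-periodic maps with values in `SL(2,ℝ)`, from `A` to the
constant map `x ↦ Id`. -/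
def HomotopicToId (A : ℝ → Matrix (Fin 2) (Fin 2) ℝ) : Prop :=
  ∃ H : ℝ → ℝ → Matrix (Fin 2) (Fin 2) ℝ,
    Continuous (fun st : ℝ × ℝ => H st.1 st.2) ∧
    (∀ t x, (H t x).det = 1) ∧
    (∀ t x, H t (x + 1) = H t x) ∧
    (∀ x, H 0 x = A x) ∧ (∀ x, H 1 x = 1)

/-- The fibered product `A(x+(n−1)α) ⋯ A(x+α) A(x)` of the cocycle `(α, A)`. -/
noncomputable def fiberProd (α : ℝ) (A : ℝ → Matrix (Fin 2) (Fin 2) ℝ) (n : ℕ) (x : ℝ) :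
    Matrix (Fin 2) (Fin 2) ℝ :=
  ((List.range n).reverse.map fun k => A (x + (k : ℝ) * α)).prod

/-- `DC₁(γ, 3)`: the set of `α ∈ ℝ` with `|α − k/l| ≥ γ/l³` for all `k ∈ ℤ`, `l ∈ ℕ*`. -/
def DCone (γ : ℝ) : Set ℝ :=
  {α : ℝ | ∀ (k : ℤ) (l : ℕ), 0 < l → γ / (l : ℝ) ^ 3 ≤ |α - (k : ℝ) / (l : ℝ)|}

/-- `D_{p/q}(η) = (p/q − η, p/q + η) ∩ DC₁(η², 3)`. -/
def Dpq (p : ℤ) (q : ℕ) (η : ℝ) : Set ℝ :=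
  Set.Ioo ((p : ℝ) / (q : ℝ) - η) ((p : ℝ) / (q : ℝ) + η) ∩ DCone (η ^ 2)

/-- The unit vector of direction `2πy`. -/
noncomputable def dirVec (y : ℝ) : Fin 2 → ℝ :=
  ![Real.cos (2 * Real.pi * y), Real.sin (2 * Real.pi * y)]

/-- `F : ℝ → ℝ → ℝ` is a lift of the projective dynamics induced by the (1-periodic,
homotopic to the identity) map `A : 𝕋 → SL(2,ℝ)` on `𝕋 × 𝕊¹`. -/
def IsProjLift (A : ℝ → Matrix (Fin 2) (Fin 2) ℝ) (F : ℝ → ℝ → ℝ) : Prop :=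
  Continuous (fun xy : ℝ × ℝ => F xy.1 xy.2) ∧
  (∀ x y, F (x + 1) y = F x y) ∧
  (∀ x y, F x (y + 1) = F x y + 1) ∧
  (∀ x y, ∃ c : ℝ, 0 < c ∧ (A x).mulVec (dirVec y) = c • dirVec (F x y))

/-- Iterates of a lift of the projective cocycle `(α, A)`:  the second coordinate of
the `n`-th iterate of `(x,y) ↦ (x+α, F(x,y))`. -/
noncomputable def liftIter (α : ℝ) (F : ℝ → ℝ → ℝ) : ℕ → ℝ → ℝ → ℝ
  | 0, _, y => y
  | n + 1, x, y => F (x + (n : ℝ) * α) (liftIter α F n x y)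

/-- `ρ` is (a representative of) the fibered rotation number of the cocycle `(α, A)`,
for irrational `α`. -/
def IsFiberedRotNum (α : ℝ) (A : ℝ → Matrix (Fin 2) (Fin 2) ℝ) (ρ : ℝ) : Prop :=
  ∃ F : ℝ → ℝ → ℝ, IsProjLift A F ∧
    Filter.Tendsto (fun n : ℕ => liftIter α F n 0 0 / (n : ℝ)) Filter.atTop (nhds ρ)

/-- The fibered rotation number of the cocycle `(p/q, A)` at rational frequency,
computed from a lift `F` of the projective dynamics:
`ρ(p/q, A) = (1/q) ∫_𝕋 rot((f̃^q)_x) dx`. -/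
noncomputable def ratRot (p : ℤ) (q : ℕ) (F : ℝ → ℝ → ℝ) : ℝ :=
  ∫ x in (0:ℝ)..1,
    Filter.limsup
      (fun n : ℕ => liftIter ((p : ℝ) / (q : ℝ)) F (q * (n + 1)) x 0 / ((q : ℝ) * ((n : ℝ) + 1)))
      Filter.atTop

open scoped ComplexConjugate

namespace QPCocycle

/-- The character `t ↦ exp (2πit)`. -/
noncomputable def ex (t : ℝ) : ℂ := Complex.exp (2 * Real.pi * t * Complex.I)

lemma ex_add (s t : ℝ) : ex (s + t) = ex s * ex t := by
  rw [ex, ex, ex, ← Complex.exp_add]; push_cast; ring_nf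

lemma ex_zero : ex 0 = 1 := by simp [ex]

lemma ex_int (k : ℤ) : ex k = 1 := by
  rw [ex, Complex.exp_eq_one_iff]
  exact ⟨k, by push_cast; ring⟩

lemma norm_ex (t : ℝ) : ‖ex t‖ = 1 := by
  have := Complex.norm_exp_ofReal_mul_I (2 * Real.pi * t)
  rw [ex]; push_cast at this; exact this

lemma conj_ex (t : ℝ) : conj (ex t) = ex (-t) := by
  rw [ex, ex, ← Complex.exp_conj]
  have : conj (2 : ℂ) = 2 := Complex.conj_ofNat 2
  simp [Complex.conj_ofReal, this]

lemma ex_ne_zero (t : ℝ) : ex t ≠ 0 := Complex.exp_ne_zero _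

lemma ex_add_int (t : ℝ) (k : ℤ) : ex (t + k) = ex t := by rw [ex_add, ex_int, mul_one]

lemma continuous_ex : Continuous ex := by unfold ex; fun_prop

/-- The real matrix of the real-linear map `z ↦ a z + b z̄` of `ℂ = ℝ²`. -/
noncomputable def cmat (a b : ℂ) : Matrix (Fin 2) (Fin 2) ℝ :=
  !![a.re + b.re, -a.im + b.im; a.im + b.im, a.re - b.re]

lemma cmat_mul (a b c d : ℂ) :
    cmat a b * cmat c d = cmat (a * c + b * conj d) (a * d + b * conj c) := by
  ext i j
  fin_cases i <;> fin_cases j <;>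
    simp [cmat, Matrix.mul_apply, Fin.sum_univ_two] <;> ring

lemma cmat_one : cmat 1 0 = 1 := by
  ext i j
  fin_cases i <;> fin_cases j <;> simp [cmat]

lemma det_cmat (a b : ℂ) : (cmat a b).det = ‖a‖ ^ 2 - ‖b‖ ^ 2 := by
  rw [← Complex.normSq_eq_norm_sq, ← Complex.normSq_eq_norm_sq]
  simp [cmat, Matrix.det_fin_two, Complex.normSq_apply]; ring

lemma cmat_inj {a b c d : ℂ} (h : cmat a b = cmat c d) : a = c ∧ b = d := by
  have h00 := congrFun (congrFun h 0) 0
  have h01 := congrFun (congrFun h 0) 1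
  have h10 := congrFun (congrFun h 1) 0
  have h11 := congrFun (congrFun h 1) 1
  simp [cmat] at h00 h01 h10 h11
  refine ⟨Complex.ext ?_ ?_, Complex.ext ?_ ?_⟩ <;> linarith

/-- The coefficient `a` in the decomposition `cmat a b` of a real matrix. -/
noncomputable def ca (A : Matrix (Fin 2) (Fin 2) ℝ) : ℂ :=
  ⟨(A 0 0 + A 1 1) / 2, (A 1 0 - A 0 1) / 2⟩

/-- The coefficient `b` in the decomposition `cmat a b` of a real matrix. -/
noncomputable def cb (A : Matrix (Fin 2) (Fin 2) ℝ) : ℂ :=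
  ⟨(A 0 0 - A 1 1) / 2, (A 1 0 + A 0 1) / 2⟩

lemma cmat_ca_cb (A : Matrix (Fin 2) (Fin 2) ℝ) : cmat (ca A) (cb A) = A := by
  ext i j
  fin_cases i <;> fin_cases j <;> simp [cmat, ca, cb] <;> ring

lemma Rot_eq_cmat (φ : ℝ) : Rot φ = cmat (Complex.exp (φ * Complex.I)) 0 := by
  ext i j
  fin_cases i <;> fin_cases j <;>
    simp [cmat, Rot, Complex.exp_ofReal_mul_I_re, Complex.exp_ofReal_mul_I_im]

lemma contDiff_cmat {n : WithTop ℕ∞} {a b : ℝ → ℂ} (ha : ContDiff ℝ n a) (hb : ContDiff ℝ n b) :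
    ContDiff ℝ n (fun x => cmat (a x) (b x)) := by
  have har : ContDiff ℝ n fun x => (a x).re := Complex.reCLM.contDiff.comp ha
  have hai : ContDiff ℝ n fun x => (a x).im := Complex.imCLM.contDiff.comp ha
  have hbr : ContDiff ℝ n fun x => (b x).re := Complex.reCLM.contDiff.comp hb
  have hbi : ContDiff ℝ n fun x => (b x).im := Complex.imCLM.contDiff.comp hb
  refine contDiff_pi.2 fun i => contDiff_pi.2 fun j => ?_
  fin_cases i <;> fin_cases j <;> simp only [cmat, Fin.zero_eta, Fin.mk_one, Matrix.of_apply,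
    Matrix.cons_val', Matrix.cons_val_zero, Matrix.cons_val_one, Matrix.cons_val_fin_one,
    Matrix.empty_val', Fin.isValue]
  · exact har.add hbr
  · exact hai.neg.add hbi
  · exact hai.add hbi
  · exact har.sub hbr

/-- Submultiplicative symmetric weights on `ℤ`. -/
structure IsWeight (w : ℤ → ℝ≥0∞) : Prop where
  one_le : ∀ k, 1 ≤ w k
  neg : ∀ k, w (-k) = w k
  add_le : ∀ k l, w (k + l) ≤ w k * w l

lemma isWeight_one : IsWeight 1 := ⟨fun _ => le_rfl, fun _ => rfl, fun _ _ => by simp⟩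

/-- The weighted `ℓ¹` norm of a sequence of Fourier coefficients. -/
noncomputable def nrm (w : ℤ → ℝ≥0∞) (c : ℤ → ℂ) : ℝ≥0∞ := ∑' k, w k * ‖c k‖ₑ

variable {w w' : ℤ → ℝ≥0∞} {c d : ℤ → ℂ}

lemma nrm_zero : nrm w 0 = 0 := by simp [nrm]

lemma nrm_add_le : nrm w (c + d) ≤ nrm w c + nrm w d := by
  rw [nrm, nrm, nrm, ← ENNReal.tsum_add]
  refine ENNReal.tsum_le_tsum fun k => ?_
  rw [← mul_add]
  gcongr
  exact enorm_add_le _ _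

lemma nrm_neg : nrm w (-c) = nrm w c := by simp [nrm]

lemma nrm_le_mul {K : ℝ≥0∞} (h : ∀ k, w' k * ‖c k‖ₑ ≤ K * (w k * ‖d k‖ₑ)) :
    nrm w' c ≤ K * nrm w d := by
  rw [nrm, nrm, ← ENNReal.tsum_mul_left]
  exact ENNReal.tsum_le_tsum h

lemma nrm_mono (h : ∀ k, w' k * ‖c k‖ₑ ≤ w k * ‖d k‖ₑ) : nrm w' c ≤ nrm w d :=
  ENNReal.tsum_le_tsum h

lemma le_nrm (hw : IsWeight w) (k : ℤ) : ‖c k‖ₑ ≤ nrm w c := by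
  refine le_trans ?_ (ENNReal.le_tsum k)
  exact le_mul_of_one_le_left zero_le (hw.one_le k)

lemma nrm_one_le (hw : IsWeight w) : nrm 1 c ≤ nrm w c :=
  nrm_mono fun k => by gcongr; exact hw.one_le k

lemma summable_norm_of_nrm (h : nrm 1 c ≠ ∞) : Summable fun k => ‖c k‖ := by
  rw [← tsum_enorm_ne_top_iff_summable_norm]
  simpa [nrm] using h

/-- Convolution of sequences of Fourier coefficients. -/
noncomputable def conv (c d : ℤ → ℂ) : ℤ → ℂ := fun k => ∑' l, c l * d (k - l)

lemma nrm_conv_le (hw : IsWeight w) : nrm w (conv c d) ≤ nrm w c * nrm w d := by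
  calc nrm w (conv c d) ≤ ∑' k, ∑' l, (w l * ‖c l‖ₑ) * (w (k - l) * ‖d (k - l)‖ₑ) := by
        refine ENNReal.tsum_le_tsum fun k => ?_
        refine (mul_le_mul_right enorm_tsum_le_tsum_enorm (w k)).trans ?_
        rw [← ENNReal.tsum_mul_left]
        refine ENNReal.tsum_le_tsum fun l => ?_
        rw [enorm_mul]
        calc w k * (‖c l‖ₑ * ‖d (k - l)‖ₑ) ≤ (w l * w (k - l)) * (‖c l‖ₑ * ‖d (k - l)‖ₑ) := by
              gcongr
              simpa using hw.add_le l (k - l)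
          _ = _ := by ring
    _ = ∑' l, (w l * ‖c l‖ₑ) * ∑' k, (w (k - l) * ‖d (k - l)‖ₑ) := by
        rw [ENNReal.tsum_comm]
        simp_rw [ENNReal.tsum_mul_left]
    _ = ∑' l, (w l * ‖c l‖ₑ) * nrm w d := by
        congr 1; ext l; congr 1
        exact (Equiv.subRight l).tsum_eq (fun k => w k * ‖d k‖ₑ)
    _ = _ := by rw [ENNReal.tsum_mul_right]; rfl

/-- Fourier coefficients of the complex conjugate function. -/
noncomputable def cst (c : ℤ → ℂ) : ℤ → ℂ := fun k => conj (c (-k))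

lemma nrm_cst (hw : IsWeight w) : nrm w (cst c) = nrm w c := by
  rw [nrm, nrm, ← (Equiv.neg ℤ).tsum_eq]
  refine tsum_congr fun k => ?_
  simp [cst, hw.neg, ← ofReal_norm]

lemma summable_conv_term (hc : nrm 1 c ≠ ∞) (hd : nrm 1 d ≠ ∞) (k : ℤ) :
    Summable fun l => c l * d (k - l) := by
  obtain ⟨C, hC⟩ : ∃ C, ∀ l, ‖d l‖ ≤ C := by
    refine ⟨∑' l, ‖d l‖, fun l => ?_⟩
    exact (summable_norm_of_nrm hd).le_tsum l (fun _ _ => norm_nonneg _)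
  refine Summable.of_norm_bounded ((summable_norm_of_nrm hc).mul_right C) fun l => ?_
  rw [norm_mul]
  gcongr
  exact hC _

lemma conv_sub_left {c' : ℤ → ℂ} (hc : nrm 1 c ≠ ∞) (hc' : nrm 1 c' ≠ ∞) (hd : nrm 1 d ≠ ∞) :
    conv (c - c') d = conv c d - conv c' d := by
  ext k
  simp only [conv, Pi.sub_apply, sub_mul]
  exact (summable_conv_term hc hd k).tsum_sub (summable_conv_term hc' hd k)

lemma conv_sub_right {d' : ℤ → ℂ} (hc : nrm 1 c ≠ ∞) (hd : nrm 1 d ≠ ∞) (hd' : nrm 1 d' ≠ ∞) :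
    conv c (d - d') = conv c d - conv c d' := by
  ext k
  simp only [conv, Pi.sub_apply, mul_sub]
  exact (summable_conv_term hc hd k).tsum_sub (summable_conv_term hc hd' k)

/-- The sum of the Fourier series with coefficients `c`. -/
noncomputable def ev (c : ℤ → ℂ) (x : ℝ) : ℂ := ∑' k : ℤ, c k * ex (k * x)

lemma norm_term (c : ℤ → ℂ) (k : ℤ) (x : ℝ) : ‖c k * ex (k * x)‖ = ‖c k‖ := by
  rw [norm_mul, norm_ex, mul_one]

lemma summable_ev (hc : nrm 1 c ≠ ∞) (x : ℝ) : Summable fun k : ℤ => c k * ex (k * x) := by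
  refine Summable.of_norm ?_
  simpa only [norm_term] using summable_norm_of_nrm hc

lemma ev_add (hc : nrm 1 c ≠ ∞) (hd : nrm 1 d ≠ ∞) (x : ℝ) :
    ev (c + d) x = ev c x + ev d x := by
  simp only [ev, Pi.add_apply, add_mul]
  exact (summable_ev hc x).tsum_add (summable_ev hd x)

lemma ev_sub (hc : nrm 1 c ≠ ∞) (hd : nrm 1 d ≠ ∞) (x : ℝ) :
    ev (c - d) x = ev c x - ev d x := by
  simp only [ev, Pi.sub_apply, sub_mul]
  exact (summable_ev hc x).tsum_sub (summable_ev hd x)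

lemma ev_const_mul (a : ℂ) (x : ℝ) : ev (fun k => a * c k) x = a * ev c x := by
  simp only [ev, mul_assoc, tsum_mul_left]

lemma enorm_ev_le (x : ℝ) : ‖ev c x‖ₑ ≤ nrm 1 c := by
  refine enorm_tsum_le_tsum_enorm.trans (le_of_eq ?_)
  rw [nrm]
  refine tsum_congr fun k => ?_
  rw [← ofReal_norm, norm_term, ofReal_norm, Pi.one_apply, one_mul]

lemma ev_cst (c : ℤ → ℂ) (x : ℝ) : ev (cst c) x = conj (ev c x) := by
  rw [ev, ev, ← (Equiv.neg ℤ).tsum_eq, Complex.conj_tsum]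
  refine tsum_congr fun k => ?_
  simp [cst, conj_ex]

lemma ev_add_one (c : ℤ → ℂ) (x : ℝ) : ev c (x + 1) = ev c x := by
  refine tsum_congr fun k => ?_
  rw [mul_add, mul_one, ex_add_int]

lemma ev_shift (c : ℤ → ℂ) (α x : ℝ) : ev (fun k => ex (k * α) * c k) x = ev c (x + α) := by
  refine tsum_congr fun k => ?_
  rw [mul_add, ex_add]; ring

lemma ev_conv (hc : nrm 1 c ≠ ∞) (hd : nrm 1 d ≠ ∞) (x : ℝ) :
    ev (conv c d) x = ev c x * ev d x := by
  set f : ℤ → ℂ := fun k => c k * ex (k * x)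
  set g : ℤ → ℂ := fun k => d k * ex (k * x)
  have hf : Summable fun k => ‖f k‖ := by
    simpa only [f, norm_term] using summable_norm_of_nrm hc
  have hg : Summable fun k => ‖g k‖ := by
    simpa only [g, norm_term] using summable_norm_of_nrm hd
  let e : ℤ × ℤ ≃ ℤ × ℤ :=
    { toFun := fun p => (p.1, p.2 - p.1)
      invFun := fun p => (p.1, p.2 + p.1)
      left_inv := fun p => by simp
      right_inv := fun p => by simp }
  have hs : Summable fun p : ℤ × ℤ => f p.1 * g (p.2 - p.1) := by
    have := (summable_mul_of_summable_norm hf hg)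
    exact (e.summable_iff.2 this)
  have h1 : ev c x * ev d x = ∑' l, ∑' k, f l * g (k - l) := by
    rw [ev, ev, ← tsum_mul_right]
    refine tsum_congr fun l => ?_
    rw [tsum_mul_left]
    congr 1
    exact ((Equiv.subRight l).tsum_eq g).symm
  rw [h1, ← Summable.tsum_comm (f := fun l k => f l * g (k - l)) hs, ev]
  refine tsum_congr fun k => ?_
  rw [conv, ← tsum_mul_right]
  refine tsum_congr fun l => ?_
  simp only [f, g]
  have : ex (k * x) = ex (l * x) * ex ((k - l : ℤ) * x) := by
    rw [← ex_add]; congr 1; push_cast; ring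
  rw [this]; ring

/-- Pointwise sums of sequences of coefficients. -/
lemma nrm_tsum_le (f : ℕ → ℤ → ℂ) : nrm w (fun k => ∑' n, f n k) ≤ ∑' n, nrm w (f n) := by
  simp only [nrm]
  rw [ENNReal.tsum_comm]
  refine ENNReal.tsum_le_tsum fun k => ?_
  rw [ENNReal.tsum_mul_left]
  gcongr
  exact enorm_tsum_le_tsum_enorm

/-- Pairs of sequences of Fourier coefficients, encoding maps `𝕋 → M₂(ℝ)`. The ring structure is
the coordinatewise one, used for Fourier multipliers; products of matrices are `pmul`. -/
abbrev PS := (ℤ → ℂ) × (ℤ → ℂ)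

/-- The weighted norm of a pair. -/
noncomputable def nrm2 (w : ℤ → ℝ≥0∞) (P : PS) : ℝ≥0∞ := nrm w P.1 + nrm w P.2

/-- The coefficients of the product of two matrix valued maps. -/
noncomputable def pmul (P Q : PS) : PS :=
  (conv P.1 Q.1 + conv P.2 (cst Q.2), conv P.1 Q.2 + conv P.2 (cst Q.1))

/-- The matrix valued map with given coefficients. -/
noncomputable def evm (P : PS) (x : ℝ) : Matrix (Fin 2) (Fin 2) ℝ := cmat (ev P.1 x) (ev P.2 x)

/-- The multiplier of the translation by `α`. -/
noncomputable def shm (α : ℝ) : PS := (fun k => ex (k * α), fun k => ex (k * α))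

variable {w w' : ℤ → ℝ≥0∞} {P Q P' Q' : PS}

lemma cmat_add (a b c d : ℂ) : cmat a b + cmat c d = cmat (a + c) (b + d) := by
  ext i j
  fin_cases i <;> fin_cases j <;> simp [cmat] <;> ring

lemma nrm2_zero : nrm2 w 0 = 0 := by simp [nrm2, nrm_zero]

lemma nrm2_add_le : nrm2 w (P + Q) ≤ nrm2 w P + nrm2 w Q := by
  calc nrm2 w (P + Q) ≤ (nrm w P.1 + nrm w Q.1) + (nrm w P.2 + nrm w Q.2) :=
        add_le_add nrm_add_le nrm_add_le
    _ = _ := by rw [nrm2, nrm2]; ring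

lemma nrm2_neg : nrm2 w (-P) = nrm2 w P := by
  rw [nrm2, nrm2, Prod.fst_neg, Prod.snd_neg, nrm_neg, nrm_neg]

lemma nrm2_sub_le : nrm2 w (P - Q) ≤ nrm2 w P + nrm2 w Q := by
  rw [sub_eq_add_neg, ← nrm2_neg (P := Q)]; exact nrm2_add_le

lemma nrm2_pmul_le (hw : IsWeight w) : nrm2 w (pmul P Q) ≤ nrm2 w P * nrm2 w Q := by
  have h1 : nrm w (conv P.1 Q.1 + conv P.2 (cst Q.2)) ≤
      nrm w P.1 * nrm w Q.1 + nrm w P.2 * nrm w Q.2 := by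
    refine nrm_add_le.trans (add_le_add (nrm_conv_le hw) ?_)
    exact (nrm_conv_le hw).trans (by rw [nrm_cst hw])
  have h2 : nrm w (conv P.1 Q.2 + conv P.2 (cst Q.1)) ≤
      nrm w P.1 * nrm w Q.2 + nrm w P.2 * nrm w Q.1 := by
    refine nrm_add_le.trans (add_le_add (nrm_conv_le hw) ?_)
    exact (nrm_conv_le hw).trans (by rw [nrm_cst hw])
  calc nrm2 w (pmul P Q) ≤ _ := add_le_add h1 h2
    _ = _ := by rw [nrm2, nrm2]; ring

lemma nrm2_mul_le {m : PS} {K : ℝ≥0∞} (h1 : ∀ k, ‖m.1 k‖ₑ ≤ K) (h2 : ∀ k, ‖m.2 k‖ₑ ≤ K) :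
    nrm2 w (m * P) ≤ K * nrm2 w P := by
  rw [nrm2, nrm2, mul_add]
  refine add_le_add (nrm_le_mul fun k => ?_) (nrm_le_mul fun k => ?_)
  · rw [Prod.fst_mul, Pi.mul_apply, enorm_mul, mul_left_comm]
    gcongr; exact h1 k
  · rw [Prod.snd_mul, Pi.mul_apply, enorm_mul, mul_left_comm]
    gcongr; exact h2 k

lemma nrm2_shm_le (α : ℝ) : nrm2 w (shm α * P) ≤ nrm2 w P := by
  have h : ∀ k : ℤ, ‖ex (k * α)‖ₑ ≤ 1 := fun k => by rw [← ofReal_norm, norm_ex]; simp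
  simpa using nrm2_mul_le (w := w) (P := P) (m := shm α) h h

lemma nrm2_mono (hw : ∀ k, w' k ≤ w k) : nrm2 w' P ≤ nrm2 w P :=
  add_le_add (nrm_mono fun k => by gcongr; exact hw k) (nrm_mono fun k => by gcongr; exact hw k)

lemma nrm2_one_le (hw : IsWeight w) : nrm2 1 P ≤ nrm2 w P :=
  nrm2_mono hw.one_le

lemma fst_ne_top (h : nrm2 w P ≠ ∞) : nrm w P.1 ≠ ∞ := (ENNReal.add_ne_top.1 h).1

lemma snd_ne_top (h : nrm2 w P ≠ ∞) : nrm w P.2 ≠ ∞ := (ENNReal.add_ne_top.1 h).2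

lemma nrm2_sub_ne_top (hP : nrm2 w P ≠ ∞) (hQ : nrm2 w Q ≠ ∞) : nrm2 w (P - Q) ≠ ∞ :=
  ne_top_of_le_ne_top (ENNReal.add_ne_top.2 ⟨hP, hQ⟩) nrm2_sub_le

lemma nrm2_add_ne_top (hP : nrm2 w P ≠ ∞) (hQ : nrm2 w Q ≠ ∞) : nrm2 w (P + Q) ≠ ∞ :=
  ne_top_of_le_ne_top (ENNReal.add_ne_top.2 ⟨hP, hQ⟩) nrm2_add_le

lemma nrm2_pmul_ne_top (hw : IsWeight w) (hP : nrm2 w P ≠ ∞) (hQ : nrm2 w Q ≠ ∞) :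
    nrm2 w (pmul P Q) ≠ ∞ :=
  ne_top_of_le_ne_top (ENNReal.mul_ne_top hP hQ) (nrm2_pmul_le hw)

lemma cst_sub (c d : ℤ → ℂ) : cst (c - d) = cst c - cst d := by
  ext k; simp [cst]

lemma nrm_cst_ne_top {c : ℤ → ℂ} (h : nrm 1 c ≠ ∞) : nrm 1 (cst c) ≠ ∞ := by
  rwa [nrm_cst isWeight_one]

lemma pmul_sub_left (hP : nrm2 1 P ≠ ∞) (hP' : nrm2 1 P' ≠ ∞) (hQ : nrm2 1 Q ≠ ∞) :
    pmul (P - P') Q = pmul P Q - pmul P' Q := by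
  simp only [pmul, Prod.fst_sub, Prod.snd_sub, Prod.mk_sub_mk]
  rw [conv_sub_left (fst_ne_top hP) (fst_ne_top hP') (fst_ne_top hQ),
    conv_sub_left (fst_ne_top hP) (fst_ne_top hP') (snd_ne_top hQ),
    conv_sub_left (snd_ne_top hP) (snd_ne_top hP') (nrm_cst_ne_top (fst_ne_top hQ)),
    conv_sub_left (snd_ne_top hP) (snd_ne_top hP') (nrm_cst_ne_top (snd_ne_top hQ))]
  congr 1 <;> abel

lemma pmul_sub_right (hP : nrm2 1 P ≠ ∞) (hQ : nrm2 1 Q ≠ ∞) (hQ' : nrm2 1 Q' ≠ ∞) :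
    pmul P (Q - Q') = pmul P Q - pmul P Q' := by
  simp only [pmul, Prod.fst_sub, Prod.snd_sub, Prod.mk_sub_mk, cst_sub]
  rw [conv_sub_right (fst_ne_top hP) (fst_ne_top hQ) (fst_ne_top hQ'),
    conv_sub_right (fst_ne_top hP) (snd_ne_top hQ) (snd_ne_top hQ'),
    conv_sub_right (snd_ne_top hP) (nrm_cst_ne_top (fst_ne_top hQ))
      (nrm_cst_ne_top (fst_ne_top hQ')),
    conv_sub_right (snd_ne_top hP) (nrm_cst_ne_top (snd_ne_top hQ))
      (nrm_cst_ne_top (snd_ne_top hQ'))]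
  congr 1 <;> abel

lemma nrm_conv_ne_top {c d : ℤ → ℂ} (hc : nrm 1 c ≠ ∞) (hd : nrm 1 d ≠ ∞) :
    nrm 1 (conv c d) ≠ ∞ :=
  ne_top_of_le_ne_top (ENNReal.mul_ne_top hc hd) (nrm_conv_le isWeight_one)

lemma evm_pmul (hP : nrm2 1 P ≠ ∞) (hQ : nrm2 1 Q ≠ ∞) (x : ℝ) :
    evm (pmul P Q) x = evm P x * evm Q x := by
  have hp1 := fst_ne_top hP
  have hp2 := snd_ne_top hP
  have hq1 := fst_ne_top hQ
  have hq2 := snd_ne_top hQ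
  have hq1' := nrm_cst_ne_top hq1
  have hq2' := nrm_cst_ne_top hq2
  rw [evm, evm, evm, cmat_mul, pmul]
  simp only
  rw [ev_add (nrm_conv_ne_top hp1 hq1) (nrm_conv_ne_top hp2 hq2'),
    ev_add (nrm_conv_ne_top hp1 hq2) (nrm_conv_ne_top hp2 hq1'), ev_conv hp1 hq1,
    ev_conv hp1 hq2, ev_conv hp2 hq1', ev_conv hp2 hq2', ev_cst, ev_cst]

lemma evm_add (hP : nrm2 1 P ≠ ∞) (hQ : nrm2 1 Q ≠ ∞) (x : ℝ) :
    evm (P + Q) x = evm P x + evm Q x := by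
  rw [evm, evm, evm, cmat_add, Prod.fst_add, Prod.snd_add, ev_add (fst_ne_top hP) (fst_ne_top hQ),
    ev_add (snd_ne_top hP) (snd_ne_top hQ)]

lemma evm_sub (hP : nrm2 1 P ≠ ∞) (hQ : nrm2 1 Q ≠ ∞) (x : ℝ) :
    evm (P - Q) x = evm P x - evm Q x := by
  rw [eq_sub_iff_add_eq, ← evm_add (nrm2_sub_ne_top hP hQ) hQ, sub_add_cancel]

lemma evm_shm (α x : ℝ) : evm (shm α * P) x = evm P (x + α) := by
  rw [evm, evm, ← ev_shift, ← ev_shift]; rfl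

lemma nrm2_eq_zero (hw : IsWeight w) (h : nrm2 w P = 0) : P = 0 := by
  have h1 : nrm w P.1 = 0 := (add_eq_zero.1 h).1
  have h2 : nrm w P.2 = 0 := (add_eq_zero.1 h).2
  ext k
  · simpa using (le_nrm hw (c := P.1) k).trans h1.le
  · simpa using (le_nrm hw (c := P.2) k).trans h2.le

/-- The quadratic map whose fixed points solve the linearised-conjugacy equation exactly. -/
noncomputable def kamMap (s m p F G : PS) : PS :=
  F + pmul F (m * G) - pmul (s * (m * G)) (p * G)

section FixedPoint

variable {m p F : PS} {K ε : ℝ≥0∞} {α : ℝ}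

lemma nrm2_tsum_le (f : ℕ → PS) :
    nrm2 w (fun k => ∑' n, (f n).1 k, fun k => ∑' n, (f n).2 k) ≤ ∑' n, nrm2 w (f n) := by
  simp only [nrm2]
  rw [ENNReal.tsum_add]
  exact add_le_add (nrm_tsum_le fun n => (f n).1) (nrm_tsum_le fun n => (f n).2)

lemma kamMap_bound (hw : IsWeight w) (hF : nrm2 w F ≤ ε) (hm1 : ∀ k, ‖m.1 k‖ₑ ≤ K)
    (hm2 : ∀ k, ‖m.2 k‖ₑ ≤ K) (hp1 : ∀ k, ‖p.1 k‖ₑ ≤ 1) (hp2 : ∀ k, ‖p.2 k‖ₑ ≤ 1)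
    (hK : 16 * (K * ε) ≤ 1) {G : PS} (hG : nrm2 w G ≤ 2 * ε) :
    nrm2 w (kamMap (shm α) m p F G) ≤ 2 * ε := by
  have hmG : nrm2 w (m * G) ≤ K * (2 * ε) := (nrm2_mul_le hm1 hm2).trans (by gcongr)
  have hpG : nrm2 w (p * G) ≤ 1 * (2 * ε) := (nrm2_mul_le hp1 hp2).trans (by gcongr)
  calc nrm2 w (kamMap (shm α) m p F G)
      ≤ (ε + ε * (K * (2 * ε))) + (K * (2 * ε)) * (1 * (2 * ε)) := by
        refine nrm2_sub_le.trans (add_le_add (nrm2_add_le.trans (add_le_add hF ?_)) ?_)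
        · exact (nrm2_pmul_le hw).trans (mul_le_mul' hF hmG)
        · exact (nrm2_pmul_le hw).trans (mul_le_mul' ((nrm2_shm_le α).trans hmG) hpG)
    _ = ε + 6 * (K * ε) * ε := by ring
    _ ≤ ε + 16 * (K * ε) * ε := by gcongr; norm_num
    _ ≤ ε + 1 * ε := by gcongr
    _ = 2 * ε := by ring

lemma kamMap_lip (hw : IsWeight w) (hε : ε ≠ ∞) (hKt : K ≠ ∞) (hF : nrm2 w F ≤ ε)
    (hm1 : ∀ k, ‖m.1 k‖ₑ ≤ K)
    (hm2 : ∀ k, ‖m.2 k‖ₑ ≤ K) (hp1 : ∀ k, ‖p.1 k‖ₑ ≤ 1) (hp2 : ∀ k, ‖p.2 k‖ₑ ≤ 1)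
    (hK : 16 * (K * ε) ≤ 1) {G G' : PS} (hG : nrm2 w G ≤ 2 * ε) (hG' : nrm2 w G' ≤ 2 * ε) :
    nrm2 w (kamMap (shm α) m p F G - kamMap (shm α) m p F G') ≤ 2⁻¹ * nrm2 w (G - G') := by
  have top : ∀ {a : ℝ≥0∞}, a ≤ 2 * ε → a ≠ ∞ := fun h =>
    ne_top_of_le_ne_top (ENNReal.mul_ne_top (by simp) hε) h
  have hFf : nrm2 1 F ≠ ∞ := ne_top_of_le_ne_top hε ((nrm2_one_le hw).trans hF)
  have fin1 : ∀ {H : PS}, nrm2 w H ≤ 2 * ε → nrm2 1 H ≠ ∞ := fun h =>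
    top ((nrm2_one_le hw).trans h)
  have hmf : ∀ {H : PS}, nrm2 w H ≤ 2 * ε → nrm2 1 (m * H) ≠ ∞ := fun h =>
    ne_top_of_le_ne_top (ENNReal.mul_ne_top hKt (fin1 h)) (nrm2_mul_le hm1 hm2)
  have hsf : ∀ {H : PS}, nrm2 w H ≤ 2 * ε → nrm2 1 (shm α * (m * H)) ≠ ∞ := fun h =>
    ne_top_of_le_ne_top (hmf h) (nrm2_shm_le α)
  have hpf : ∀ {H : PS}, nrm2 w H ≤ 2 * ε → nrm2 1 (p * H) ≠ ∞ := fun h =>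
    ne_top_of_le_ne_top (ENNReal.mul_ne_top (by simp) (fin1 h)) (nrm2_mul_le hp1 hp2)
  have key : kamMap (shm α) m p F G - kamMap (shm α) m p F G' =
      pmul F (m * (G - G')) - pmul (shm α * (m * (G - G'))) (p * G)
        - pmul (shm α * (m * G')) (p * (G - G')) := by
    rw [mul_sub, mul_sub, mul_sub, pmul_sub_right hFf (hmf hG) (hmf hG'),
      pmul_sub_left (hsf hG) (hsf hG') (hpf hG), pmul_sub_right (hsf hG') (hpf hG) (hpf hG'),
      kamMap, kamMap]
    abel
  rw [key]
  set D := nrm2 w (G - G')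
  have hmD : nrm2 w (m * (G - G')) ≤ K * D := nrm2_mul_le hm1 hm2
  have hpD : nrm2 w (p * (G - G')) ≤ 1 * D := nrm2_mul_le hp1 hp2
  have hmG : nrm2 w (m * G') ≤ K * (2 * ε) := (nrm2_mul_le hm1 hm2).trans (by gcongr)
  have hpG : nrm2 w (p * G) ≤ 1 * (2 * ε) := (nrm2_mul_le hp1 hp2).trans (by gcongr)
  have h2 : (2 : ℝ≥0∞)⁻¹ * 2 = 1 := ENNReal.inv_mul_cancel (by simp) (by simp)
  calc _ ≤ ε * (K * D) + (K * D) * (1 * (2 * ε)) + (K * (2 * ε)) * (1 * D) := by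
        refine nrm2_sub_le.trans (add_le_add (nrm2_sub_le.trans (add_le_add ?_ ?_)) ?_)
        · exact (nrm2_pmul_le hw).trans (mul_le_mul' hF hmD)
        · exact (nrm2_pmul_le hw).trans (mul_le_mul' ((nrm2_shm_le α).trans hmD) hpG)
        · exact (nrm2_pmul_le hw).trans (mul_le_mul' ((nrm2_shm_le α).trans hmG) hpD)
    _ = 5 * (K * ε) * D := by ring
    _ ≤ 8 * (K * ε) * D := by gcongr; norm_num
    _ = 2⁻¹ * 2 * (8 * (K * ε) * D) := by rw [h2, one_mul]
    _ = 2⁻¹ * (16 * (K * ε) * D) := by ring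
    _ ≤ 2⁻¹ * (1 * D) := by gcongr
    _ = _ := by rw [one_mul]

lemma tsum_inv_two_pow : ∑' n : ℕ, (2⁻¹ : ℝ≥0∞) ^ n = 2 := by
  rw [ENNReal.tsum_geometric, ENNReal.one_sub_inv_two, inv_inv]

/-- Sequences of pairs with geometrically small increments converge. -/
lemma exists_limit {g : ℕ → PS} {C : ℝ≥0∞} (hw : IsWeight w) (hC : C ≠ ∞) (h0 : g 0 = 0)
    (hgd : ∀ j, nrm2 w (g (j + 1) - g j) ≤ C * 2⁻¹ ^ j) :
    ∃ G, ∀ j, nrm2 w (G - g j) ≤ (2 * C) * 2⁻¹ ^ j := by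
  obtain ⟨f, hf⟩ : ∃ f : ℕ → PS, ∀ j, f j = g (j + 1) - g j := ⟨_, fun _ => rfl⟩
  simp_rw [← hf] at hgd
  have hfs : ∑' n, nrm2 w (f n) ≠ ∞ := by
    refine ne_top_of_le_ne_top ?_ (ENNReal.tsum_le_tsum hgd)
    rw [ENNReal.tsum_mul_left, tsum_inv_two_pow]
    exact ENNReal.mul_ne_top hC (by simp)
  have hs1 : ∀ k, Summable fun n => (f n).1 k := fun k => by
    refine Summable.of_norm (tsum_enorm_ne_top_iff_summable_norm.1 ?_)
    exact ne_top_of_le_ne_top hfs (ENNReal.tsum_le_tsum fun n =>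
      (le_nrm hw k).trans le_self_add)
  have hs2 : ∀ k, Summable fun n => (f n).2 k := fun k => by
    refine Summable.of_norm (tsum_enorm_ne_top_iff_summable_norm.1 ?_)
    exact ne_top_of_le_ne_top hfs (ENNReal.tsum_le_tsum fun n =>
      (le_nrm hw k).trans le_add_self)
  refine ⟨(fun k => ∑' n, (f n).1 k, fun k => ∑' n, (f n).2 k), fun j => ?_⟩
  have hsum : g j = ∑ i ∈ Finset.range j, f i := by
    simp_rw [hf]
    rw [Finset.sum_range_sub, h0, sub_zero]
  have : (fun k => ∑' n, (f n).1 k, fun k => ∑' n, (f n).2 k) - g j =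
      ((fun k => ∑' n, (f (n + j)).1 k, fun k => ∑' n, (f (n + j)).2 k) : PS) := by
    rw [hsum]
    refine Prod.ext (funext fun k => ?_) (funext fun k => ?_)
    · have := (hs1 k).sum_add_tsum_nat_add j
      simp only [Prod.fst_sub, Pi.sub_apply, Prod.fst_sum, Finset.sum_apply]
      rw [← this]; ring
    · have := (hs2 k).sum_add_tsum_nat_add j
      simp only [Prod.snd_sub, Pi.sub_apply, Prod.snd_sum, Finset.sum_apply]
      rw [← this]; ring
  rw [this]
  refine (nrm2_tsum_le (fun n => f (n + j))).trans ?_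
  refine (ENNReal.tsum_le_tsum fun n => hgd (n + j)).trans (le_of_eq ?_)
  simp_rw [pow_add]
  rw [ENNReal.tsum_mul_left, ENNReal.tsum_mul_right, tsum_inv_two_pow]; ring

lemma tendsto_mul_inv_two_pow {C : ℝ≥0∞} (hC : C ≠ ∞) :
    Filter.Tendsto (fun j : ℕ => C * (2⁻¹ : ℝ≥0∞) ^ j) Filter.atTop (nhds 0) := by
  have := ENNReal.Tendsto.const_mul (a := C) (ENNReal.tendsto_pow_atTop_nhds_zero_of_lt_one
    (r := 2⁻¹) (by norm_num)) (Or.inr hC)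
  rwa [mul_zero] at this

lemma exists_fixed {T : PS → PS} {C : ℝ≥0∞} (hw : IsWeight w) (hC : C ≠ ∞)
    (hb : ∀ G, nrm2 w G ≤ C → nrm2 w (T G) ≤ C)
    (hl : ∀ G G', nrm2 w G ≤ C → nrm2 w G' ≤ C →
      nrm2 w (T G - T G') ≤ 2⁻¹ * nrm2 w (G - G')) :
    ∃ G, nrm2 w G ≤ C ∧ G = T G := by
  obtain ⟨g, h0, hgs⟩ : ∃ g : ℕ → PS, g 0 = 0 ∧ ∀ j, g (j + 1) = T (g j) :=
    ⟨fun j => T^[j] 0, rfl, fun j => Function.iterate_succ_apply' T j 0⟩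
  have hgb : ∀ j, nrm2 w (g j) ≤ C := by
    intro j
    induction j with
    | zero => rw [h0, nrm2_zero]; exact zero_le
    | succ j ih => rw [hgs]; exact hb _ ih
  have hgd : ∀ j, nrm2 w (g (j + 1) - g j) ≤ C * 2⁻¹ ^ j := by
    intro j
    induction j with
    | zero => simpa [h0] using hgb 1
    | succ j ih =>
      rw [hgs (j + 1), hgs j]
      refine (hl _ _ (hb _ (hgb _)) (hgb _)).trans ?_
      rw [← hgs j]
      refine (mul_le_mul' le_rfl ih).trans (le_of_eq ?_)
      rw [pow_succ]; ring
  obtain ⟨G, hGg⟩ := exists_limit hw hC h0 hgd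
  have hGb : nrm2 w G ≤ C := by
    have hlim := (tendsto_const_nhds (x := C)).add (tendsto_mul_inv_two_pow (C := 2 * C)
      (ENNReal.mul_ne_top (by simp) hC))
    rw [add_zero] at hlim
    refine ge_of_tendsto' hlim fun j => ?_
    have : G = g j + (G - g j) := by abel
    rw [this]
    exact nrm2_add_le.trans (add_le_add (hgb j) (hGg j))
  refine ⟨G, hGb, ?_⟩
  have hz : nrm2 w (G - T G) ≤ 0 := by
    refine ge_of_tendsto' (tendsto_mul_inv_two_pow (C := 4 * C)
      (ENNReal.mul_ne_top (by simp) hC)) fun j => ?_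
    have : G - T G = (G - g (j + 1)) - (T G - T (g j)) := by rw [hgs]; abel
    rw [this]
    have half : (2⁻¹ : ℝ≥0∞) ≤ 1 := by norm_num
    calc _ ≤ (2 * C) * 2⁻¹ ^ (j + 1) + 2⁻¹ * ((2 * C) * 2⁻¹ ^ j) :=
          nrm2_sub_le.trans (add_le_add (hGg _)
            ((hl _ _ hGb (hgb j)).trans (by gcongr; exact hGg j)))
      _ = 2⁻¹ * ((4 * C) * 2⁻¹ ^ j) := by rw [pow_succ]; ring
      _ ≤ 1 * ((4 * C) * 2⁻¹ ^ j) := by gcongr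
      _ = _ := one_mul _
  exact sub_eq_zero.1 (nrm2_eq_zero hw (le_antisymm hz zero_le))

theorem exists_kamMap_fixed (hw : IsWeight w) (hε : ε ≠ ∞) (hKt : K ≠ ∞) (hF : nrm2 w F ≤ ε)
    (hm1 : ∀ k, ‖m.1 k‖ₑ ≤ K)
    (hm2 : ∀ k, ‖m.2 k‖ₑ ≤ K) (hp1 : ∀ k, ‖p.1 k‖ₑ ≤ 1) (hp2 : ∀ k, ‖p.2 k‖ₑ ≤ 1)
    (hK : 16 * (K * ε) ≤ 1) :
    ∃ G, nrm2 w G ≤ 2 * ε ∧ G = kamMap (shm α) m p F G :=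
  exists_fixed hw (ENNReal.mul_ne_top (by simp) hε)
    (fun _ hG => kamMap_bound hw hF hm1 hm2 hp1 hp2 hK hG)
    (fun _ _ hG hG' => kamMap_lip hw hε hKt hF hm1 hm2 hp1 hp2 hK hG hG')

end FixedPoint

section Apriori

lemma IsWeight.truncate (hw : IsWeight w) {L : ℝ≥0∞} (hL : 1 ≤ L) :
    IsWeight fun k => min (w k) L where
  one_le k := le_min (hw.one_le k) hL
  neg k := by rw [hw.neg]
  add_le k l := by
    rcases le_total (w k) L with hk | hk <;> rcases le_total (w l) L with hl | hl
    · rw [min_eq_left hk, min_eq_left hl]; exact (min_le_left _ _).trans (hw.add_le k l)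
    · rw [min_eq_right hl]
      exact (min_le_right _ _).trans (le_mul_of_one_le_left zero_le (le_min (hw.one_le k) hL))
    · rw [min_eq_right hk]
      exact (min_le_right _ _).trans (le_mul_of_one_le_right zero_le (le_min (hw.one_le l) hL))
    · rw [min_eq_right hk]
      exact (min_le_right _ _).trans (le_mul_of_one_le_right zero_le (le_min (hw.one_le l) hL))

lemma nrm2_le_of_truncate {C : ℝ≥0∞} (hfin : ∀ k, w k ≠ ∞)
    (h : ∀ L : ℝ≥0∞, 1 ≤ L → L ≠ ∞ → nrm2 (fun k => min (w k) L) P ≤ C) : nrm2 w P ≤ C := by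
  rw [nrm2, nrm, nrm, ← ENNReal.tsum_add, ENNReal.tsum_eq_iSup_sum]
  refine iSup_le fun s => ?_
  set L := 1 + ∑ k ∈ s, w k
  have hL : L ≠ ∞ := ENNReal.add_ne_top.2 ⟨by simp, ENNReal.sum_ne_top.2 fun k _ => hfin k⟩
  refine le_trans ?_ (h L le_self_add hL)
  rw [nrm2, nrm, nrm, ← ENNReal.tsum_add]
  refine le_trans (Finset.sum_le_sum fun k hk => ?_) (ENNReal.sum_le_tsum s)
  rw [min_eq_left]
  exact (Finset.single_le_sum (f := w) (fun _ _ => zero_le) hk).trans le_add_self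

/-- Solutions of the fixed point equation inherit all the regularity of the data. -/
lemma nrm2_le_of_fixed {X E F G Xs : PS} (hw : IsWeight w) (hfin : ∀ k, w k ≠ ∞)
    (hG : nrm2 1 G ≠ ∞) (heq : G = F + pmul F X - pmul Xs E)
    (hE : ∀ v : ℤ → ℝ≥0∞, nrm2 v E ≤ nrm2 v G) (hXs : ∀ v : ℤ → ℝ≥0∞, nrm2 v Xs ≤ nrm2 v X)
    (hX : 2 * nrm2 w X ≤ 1) : nrm2 w G ≤ 3 * nrm2 w F := by
  refine nrm2_le_of_truncate hfin fun L hL1 hL => ?_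
  set v : ℤ → ℝ≥0∞ := fun k => min (w k) L
  have hv : IsWeight v := hw.truncate hL1
  have hvw : ∀ k, v k ≤ w k := fun k => min_le_left _ _
  have hgf : nrm2 v G ≠ ∞ := by
    refine ne_top_of_le_ne_top (ENNReal.mul_ne_top hL hG) ?_
    rw [nrm2, nrm2, mul_add]
    refine add_le_add (nrm_le_mul fun k => ?_) (nrm_le_mul fun k => ?_) <;>
    · rw [Pi.one_apply, one_mul]; gcongr; exact min_le_right _ _
  have hXv : 2 * nrm2 v X ≤ 1 := le_trans (by gcongr; exact nrm2_mono hvw) hX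
  have h1 : nrm2 v G ≤ nrm2 v F + nrm2 v F * nrm2 v X + nrm2 v X * nrm2 v G := by
    conv_lhs => rw [heq]
    refine nrm2_sub_le.trans (add_le_add (nrm2_add_le.trans (add_le_add le_rfl ?_)) ?_)
    · exact nrm2_pmul_le hv
    · exact (nrm2_pmul_le hv).trans (mul_le_mul' (hXs v) (hE v))
  have h2 : nrm2 v G + nrm2 v G ≤ 3 * nrm2 v F + nrm2 v G := by
    calc nrm2 v G + nrm2 v G = 2 * nrm2 v G := by ring
      _ ≤ 2 * (nrm2 v F + nrm2 v F * nrm2 v X + nrm2 v X * nrm2 v G) := by gcongr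
      _ = 2 * nrm2 v F + nrm2 v F * (2 * nrm2 v X) + (2 * nrm2 v X) * nrm2 v G := by ring
      _ ≤ 2 * nrm2 v F + nrm2 v F * 1 + 1 * nrm2 v G := by gcongr
      _ = _ := by ring
  refine ((ENNReal.add_le_add_iff_right hgf).1 h2).trans ?_
  gcongr
  exact nrm2_mono hvw

end Apriori

/-- The weight `(1 + |k|/N)^S`. -/
noncomputable def wt (N : ℝ) (S : ℕ) (k : ℤ) : ℝ≥0∞ := ENNReal.ofReal ((1 + |(k : ℝ)| / N) ^ S)

lemma wt_ne_top (N : ℝ) (S : ℕ) (k : ℤ) : wt N S k ≠ ∞ := ENNReal.ofReal_ne_top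

lemma isWeight_wt {N : ℝ} (hN : 0 < N) (S : ℕ) : IsWeight (wt N S) where
  one_le k := by
    rw [wt, ENNReal.one_le_ofReal]
    exact one_le_pow₀ (by have : 0 ≤ |(k : ℝ)| / N := by positivity
                          linarith)
  neg k := by simp [wt]
  add_le k l := by
    rw [wt, wt, wt, ← ENNReal.ofReal_mul (by positivity), ← mul_pow]
    refine ENNReal.ofReal_le_ofReal (pow_le_pow_left₀ (by positivity) ?_ S)
    have h1 : |((k + l : ℤ) : ℝ)| / N ≤ |(k : ℝ)| / N + |(l : ℝ)| / N := by
      rw [← add_div]; gcongr; push_cast; exact abs_add_le _ _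
    have h2 : 0 ≤ |(k : ℝ)| / N * (|(l : ℝ)| / N) := by positivity
    nlinarith

lemma wt_anti {N N' : ℝ} (hN : 0 < N) (h : N ≤ N') (S : ℕ) (k : ℤ) : wt N' S k ≤ wt N S k := by
  have hN' : 0 < N' := hN.trans_le h
  refine ENNReal.ofReal_le_ofReal ?_
  gcongr

/-- The multiplier of `Y ↦ Y(· + α) Λ - Λ Y` with `Λ = cmat lam 0`. -/
noncomputable def divisor (α : ℝ) (lam : ℂ) : PS :=
  (fun k => lam * ex (k * α) - lam, fun k => conj lam * ex (k * α) - lam)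

open Classical in
/-- The indicator of the complement of a pair of sets of frequencies. -/
noncomputable def keep (s₁ s₂ : Set ℤ) : PS :=
  (fun k => if k ∈ s₁ then 0 else 1, fun k => if k ∈ s₂ then 0 else 1)

lemma nrm_const_mul_ne_top {c : ℤ → ℂ} (a : ℂ) (h : nrm 1 c ≠ ∞) :
    nrm 1 (fun k => a * c k) ≠ ∞ := by
  refine ne_top_of_le_ne_top (ENNReal.mul_ne_top (a := ‖a‖ₑ) (by simp) h) (nrm_le_mul fun k => ?_)
  simp [enorm_mul]

lemma evm_divisor {X : PS} (hX : nrm2 1 X ≠ ∞) (α : ℝ) (lam : ℂ) (x : ℝ) :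
    evm (divisor α lam * X) x = evm X (x + α) * cmat lam 0 - cmat lam 0 * evm X x := by
  have hs : nrm2 1 (shm α * X) ≠ ∞ := ne_top_of_le_ne_top hX (nrm2_shm_le α)
  have h1 : (divisor α lam * X).1 =
      (fun k => lam * (shm α * X).1 k) - (fun k => lam * X.1 k) := by
    ext k; simp [divisor, shm]; ring
  have h2 : (divisor α lam * X).2 =
      (fun k => conj lam * (shm α * X).2 k) - (fun k => lam * X.2 k) := by
    ext k; simp [divisor, shm]; ring
  rw [eq_sub_iff_add_eq, ← evm_shm, evm, h1, h2,
    ev_sub (nrm_const_mul_ne_top _ (fst_ne_top hs)) (nrm_const_mul_ne_top _ (fst_ne_top hX)),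
    ev_sub (nrm_const_mul_ne_top _ (snd_ne_top hs)) (nrm_const_mul_ne_top _ (snd_ne_top hX)),
    ev_const_mul, ev_const_mul, ev_const_mul, ev_const_mul, evm, evm, cmat_mul, cmat_mul, cmat_add]
  congr 1 <;> simp <;> ring

lemma keep_fst_le (s₁ s₂ : Set ℤ) (k : ℤ) : ‖(keep s₁ s₂).1 k‖ₑ ≤ 1 := by
  simp only [keep]; split_ifs <;> simp

lemma keep_snd_le (s₁ s₂ : Set ℤ) (k : ℤ) : ‖(keep s₁ s₂).2 k‖ₑ ≤ 1 := by
  simp only [keep]; split_ifs <;> simp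

lemma nrm2_keep_le {w : ℤ → ℝ≥0∞} (s₁ s₂ : Set ℤ) (P : PS) : nrm2 w (keep s₁ s₂ * P) ≤ nrm2 w P := by
  simpa using nrm2_mul_le (w := w) (P := P) (keep_fst_le s₁ s₂) (keep_snd_le s₁ s₂)

/-- Elimination of the Fourier modes with non-small divisors. -/
theorem exists_elimination {w : ℤ → ℝ≥0∞} (hw : IsWeight w) {α : ℝ} {lam : ℂ} {F : PS}
    {K ε : ℝ≥0∞} (hε : ε ≠ ∞) (hKt : K ≠ ∞) (hF : nrm2 w F ≤ ε) (hK : 16 * (K * ε) ≤ 1)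
    (s₁ s₂ : Set ℤ) (hs₁ : ∀ k ∈ s₁, ‖((divisor α lam).1 k)⁻¹‖ₑ ≤ K ∧ (divisor α lam).1 k ≠ 0)
    (hs₂ : ∀ k ∈ s₂, ‖((divisor α lam).2 k)⁻¹‖ₑ ≤ K ∧ (divisor α lam).2 k ≠ 0) :
    ∃ X E : PS, (∀ k, k ∉ s₁ → X.1 k = 0) ∧ (∀ k, k ∉ s₂ → X.2 k = 0) ∧
      (∀ k ∈ s₁, E.1 k = 0) ∧ (∀ k ∈ s₂, E.2 k = 0) ∧
      nrm2 w X ≤ K * (2 * ε) ∧ nrm2 w E ≤ 2 * ε ∧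
      (∀ x, (cmat lam 0 + evm F x) * (1 + evm X x) =
        (1 + evm X (x + α)) * (cmat lam 0 + evm E x)) ∧
      ∀ v : ℤ → ℝ≥0∞, IsWeight v → (∀ k, v k ≠ ∞) → 2 * nrm2 v X ≤ 1 →
        nrm2 v X ≤ 3 * (K * nrm2 v F) ∧ nrm2 v E ≤ 3 * nrm2 v F ∧
        nrm2 v (E - keep s₁ s₂ * F) ≤ 12 * (K * nrm2 v F) * nrm2 v F := by
  classical
  obtain ⟨m, hm⟩ : ∃ m : PS, m = (fun k => if k ∈ s₁ then ((divisor α lam).1 k)⁻¹ else 0,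
    fun k => if k ∈ s₂ then ((divisor α lam).2 k)⁻¹ else 0) := ⟨_, rfl⟩
  have hm1 : ∀ k, ‖m.1 k‖ₑ ≤ K := fun k => by
    rw [hm]; dsimp only
    split_ifs with h
    · exact (hs₁ k h).1
    · simp
  have hm2 : ∀ k, ‖m.2 k‖ₑ ≤ K := fun k => by
    rw [hm]; dsimp only
    split_ifs with h
    · exact (hs₂ k h).1
    · simp
  obtain ⟨G, hG, hfix⟩ := exists_kamMap_fixed (α := α) hw hε hKt hF hm1 hm2
    (keep_fst_le s₁ s₂) (keep_snd_le s₁ s₂) hK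
  have hmv : ∀ v : ℤ → ℝ≥0∞, nrm2 v (m * G) ≤ K * nrm2 v G := fun v => nrm2_mul_le hm1 hm2
  have hGt : nrm2 w G ≠ ∞ := ne_top_of_le_ne_top (ENNReal.mul_ne_top (by simp) hε) hG
  have hG1 : nrm2 1 G ≠ ∞ := ne_top_of_le_ne_top hGt (nrm2_one_le hw)
  have hX1 : nrm2 1 (m * G) ≠ ∞ := ne_top_of_le_ne_top (ENNReal.mul_ne_top hKt hG1) (hmv 1)
  have hE1 : nrm2 1 (keep s₁ s₂ * G) ≠ ∞ := ne_top_of_le_ne_top hG1 (nrm2_keep_le _ _ _)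
  have hF1 : nrm2 1 F ≠ ∞ := ne_top_of_le_ne_top hε ((nrm2_one_le hw).trans hF)
  have hS1 : nrm2 1 (shm α * (m * G)) ≠ ∞ := ne_top_of_le_ne_top hX1 (nrm2_shm_le α)
  have hsplit : G = keep s₁ s₂ * G + divisor α lam * (m * G) := by
    rw [hm]
    refine Prod.ext (funext fun k => ?_) (funext fun k => ?_)
    · by_cases h : k ∈ s₁
      · simp [keep, h, mul_inv_cancel_left₀ (hs₁ k h).2]
      · simp [keep, h]
    · by_cases h : k ∈ s₂
      · simp [keep, h, mul_inv_cancel_left₀ (hs₂ k h).2]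
      · simp [keep, h]
  have hD1 : nrm2 1 (divisor α lam * (m * G)) ≠ ∞ := by
    have : divisor α lam * (m * G) = G - keep s₁ s₂ * G := by
      rw [eq_sub_iff_add_eq, add_comm]; exact hsplit.symm
    rw [this]; exact nrm2_sub_ne_top hG1 hE1
  refine ⟨m * G, keep s₁ s₂ * G, fun k hk => ?_, fun k hk => ?_, fun k hk => ?_, fun k hk => ?_,
    (hmv w).trans (by gcongr), (nrm2_keep_le _ _ _).trans hG, fun x => ?_,
    fun v hv hvf hvX => ?_⟩
  · simp [hm, hk]
  · simp [hm, hk]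
  · simp [keep, hk]
  · simp [keep, hk]
  · have h1 : evm G x = evm (keep s₁ s₂ * G) x +
        (evm (m * G) (x + α) * cmat lam 0 - cmat lam 0 * evm (m * G) x) := by
      rw [← evm_divisor hX1, ← evm_add hE1 hD1, ← hsplit]
    have h2 : evm G x = evm F x + evm F x * evm (m * G) x -
        evm (m * G) (x + α) * evm (keep s₁ s₂ * G) x := by
      conv_lhs => rw [hfix]
      rw [kamMap, evm_sub (nrm2_add_ne_top hF1 (nrm2_pmul_ne_top isWeight_one hF1 hX1))
        (nrm2_pmul_ne_top isWeight_one hS1 hE1),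
        evm_add hF1 (nrm2_pmul_ne_top isWeight_one hF1 hX1), evm_pmul hF1 hX1,
        evm_pmul hS1 hE1, evm_shm]
    have h3 := h1.symm.trans h2
    generalize evm (m * G) (x + α) = Xp at *
    generalize evm (m * G) x = X0 at *
    generalize evm (keep s₁ s₂ * G) x = E0 at *
    generalize evm F x = F0 at *
    generalize cmat lam 0 = L at *
    have h4 : F0 + F0 * X0 = E0 + (Xp * L - L * X0) + Xp * E0 := by
      rw [h3]; abel
    calc (L + F0) * (1 + X0) = L + L * X0 + (F0 + F0 * X0) := by noncomm_ring
      _ = (1 + Xp) * (L + E0) := by rw [h4]; noncomm_ring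
  · have hGv : nrm2 v G ≤ 3 * nrm2 v F :=
      nrm2_le_of_fixed hv hvf hG1 hfix (fun u => nrm2_keep_le _ _ _) (fun u => nrm2_shm_le α) hvX
    have hXv : nrm2 v (m * G) ≤ 3 * (K * nrm2 v F) :=
      (hmv v).trans ((mul_le_mul' le_rfl hGv).trans (le_of_eq (by ring)))
    have hEv : nrm2 v (keep s₁ s₂ * G) ≤ 3 * nrm2 v F := (nrm2_keep_le _ _ _).trans hGv
    refine ⟨hXv, hEv, ?_⟩
    rw [← mul_sub]
    refine (nrm2_keep_le _ _ _).trans ?_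
    have : G - F = pmul F (m * G) - pmul (shm α * (m * G)) (keep s₁ s₂ * G) := by
      conv_lhs => rw [hfix]
      rw [kamMap]; abel
    rw [this]
    calc _ ≤ nrm2 v F * (3 * (K * nrm2 v F)) + (3 * (K * nrm2 v F)) * (3 * nrm2 v F) := by
          refine nrm2_sub_le.trans (add_le_add ?_ ?_)
          · exact (nrm2_pmul_le hv).trans (mul_le_mul' le_rfl hXv)
          · exact (nrm2_pmul_le hv).trans (mul_le_mul' ((nrm2_shm_le α).trans hXv) hEv)
      _ = _ := by ring

lemma ex_re (y : ℝ) : (ex y).re = Real.cos (2 * Real.pi * y) := by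
  have := Complex.exp_ofReal_mul_I_re (2 * Real.pi * y)
  rw [ex]; push_cast at this; exact this

lemma ex_im (y : ℝ) : (ex y).im = Real.sin (2 * Real.pi * y) := by
  have := Complex.exp_ofReal_mul_I_im (2 * Real.pi * y)
  rw [ex]; push_cast at this; exact this

/-- A complex number seen as a vector of `ℝ²`. -/
def cvec (z : ℂ) : Fin 2 → ℝ := ![z.re, z.im]

lemma cvec_inj {z z' : ℂ} : cvec z = cvec z' ↔ z = z' := by
  refine ⟨fun h => Complex.ext ?_ ?_, fun h => by rw [h]⟩
  · simpa [cvec] using congrFun h 0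
  · simpa [cvec] using congrFun h 1

lemma dirVec_eq (y : ℝ) : dirVec y = cvec (ex y) := by
  rw [dirVec, cvec, ex_re, ex_im]

lemma cmat_mulVec (a b z : ℂ) : cmat a b *ᵥ cvec z = cvec (a * z + b * conj z) := by
  ext i
  fin_cases i <;> simp [cmat, cvec, Matrix.mulVec, dotProduct, Fin.sum_univ_two] <;> ring

lemma smul_cvec (c : ℝ) (z : ℂ) : c • cvec z = cvec (c * z) := by
  ext i; fin_cases i <;> simp [cvec]

/-- `A` acts on directions as `y ↦ y'`. -/
def ActsAs (A : Matrix (Fin 2) (Fin 2) ℝ) (y y' : ℝ) : Prop :=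
  ∃ c : ℝ, 0 < c ∧ A *ᵥ dirVec y = c • dirVec y'

lemma actsAs_cmat {a b : ℂ} {y y' : ℝ} :
    ActsAs (cmat a b) y y' ↔ ∃ c : ℝ, 0 < c ∧ a * ex y + b * conj (ex y) = c * ex y' := by
  simp only [ActsAs, dirVec_eq, cmat_mulVec, smul_cvec, cvec_inj]

lemma ActsAs.mul {A B : Matrix (Fin 2) (Fin 2) ℝ} {y y' y'' : ℝ} (hA : ActsAs A y' y'')
    (hB : ActsAs B y y') : ActsAs (A * B) y y'' := by
  obtain ⟨c, hc, h⟩ := hA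
  obtain ⟨d, hd, h'⟩ := hB
  exact ⟨d * c, mul_pos hd hc, by rw [← mulVec_mulVec, h', mulVec_smul, h, smul_smul]⟩

lemma ex_eq_one {t : ℝ} (h : ex t = 1) : ∃ l : ℤ, t = l := by
  rw [ex, Complex.exp_eq_one_iff] at h
  obtain ⟨n, hn⟩ := h
  refine ⟨n, ?_⟩
  have h2 : (2 * Real.pi * Complex.I : ℂ) ≠ 0 := by simp [Real.pi_ne_zero]
  have : (t : ℂ) = (n : ℂ) := by
    apply mul_right_cancel₀ h2
    rw [← hn]; ring
  exact_mod_cast this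

lemma ex_sub (s t : ℝ) : ex (s - t) = ex s / ex t := by
  rw [eq_div_iff (ex_ne_zero t), ← ex_add, sub_add_cancel]

lemma dir_unique {c d y y' : ℝ} (hc : 0 < c) (hd : 0 < d)
    (h : c • dirVec y = d • dirVec y') : ∃ l : ℤ, y - y' = l := by
  simp only [dirVec_eq, smul_cvec, cvec_inj] at h
  have hn := congrArg norm h
  rw [norm_mul, norm_mul, norm_ex, norm_ex, Complex.norm_real, Complex.norm_real, mul_one, mul_one,
    Real.norm_of_nonneg hc.le, Real.norm_of_nonneg hd.le] at hn
  subst hn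
  have hc' : (c : ℂ) ≠ 0 := by exact_mod_cast hc.ne'
  have := mul_left_cancel₀ hc' h
  apply ex_eq_one
  rw [ex_sub, this, div_self (ex_ne_zero _)]

lemma ActsAs.unique {A : Matrix (Fin 2) (Fin 2) ℝ} {y y' y'' : ℝ} (h : ActsAs A y y')
    (h' : ActsAs A y y'') : ∃ l : ℤ, y' - y'' = l := by
  obtain ⟨c, hc, h⟩ := h
  obtain ⟨d, hd, h'⟩ := h'
  exact dir_unique hc hd (h.symm.trans h')

/-- Continuous functions with integer values are constant. -/
lemma exists_int_const {Y : Type*} [TopologicalSpace Y] [PreconnectedSpace Y] [Nonempty Y]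
    {f : Y → ℝ} (hf : Continuous f) (hi : ∀ p, ∃ l : ℤ, f p = l) : ∃ l : ℤ, ∀ p, f p = l := by
  choose g hg using hi
  have hgc : Continuous g := by
    have hemb : Topology.IsEmbedding ((↑) : ℤ → ℝ) := Int.isClosedEmbedding_coe_real.isEmbedding
    rw [hemb.continuous_iff]
    exact hf.congr hg
  obtain ⟨p0⟩ := ‹Nonempty Y›
  refine ⟨g p0, fun p => ?_⟩
  rw [hg p, PreconnectedSpace.constant ‹_› hgc (x := p) (y := p0)]

lemma liftIter_succ (α : ℝ) (F : ℝ → ℝ → ℝ) (n : ℕ) (x y : ℝ) :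
    liftIter α F (n + 1) x y = F (x + n * α) (liftIter α F n x y) := rfl

section Lift

variable {A : ℝ → Matrix (Fin 2) (Fin 2) ℝ} {F : ℝ → ℝ → ℝ} {α ρ : ℝ}

lemma _root_.IsProjLift.add_int (hF : IsProjLift A F) (x y : ℝ) (l : ℤ) : F x (y + l) = F x y + l := by
  have hper : Function.Periodic (fun t => F x t - t) 1 := fun t => by
    simp only [hF.2.2.1]; ring
  have := hper.int_mul l y
  simp only [mul_one] at this
  linarith

lemma _root_.IsProjLift.strictMono (hF : IsProjLift A F) (hA : ∀ x, (A x).det = 1) (x : ℝ) :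
    StrictMono (F x) := by
  have hc : Continuous (F x) := hF.1.comp (Continuous.prodMk_right x)
  have hinj : Function.Injective (F x) := by
    intro y y' h
    obtain ⟨c, hc, h1⟩ := hF.2.2.2 x y
    obtain ⟨d, hd, h2⟩ := hF.2.2.2 x y'
    have h3 : d • dirVec y = c • dirVec y' := by
      have hinv : (A x)⁻¹ * A x = 1 := Matrix.nonsing_inv_mul _ (by simp [hA])
      have : A x *ᵥ (d • dirVec y) = A x *ᵥ (c • dirVec y') := by
        rw [mulVec_smul, mulVec_smul, h1, h2, h, smul_smul, smul_smul, mul_comm]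
      have := congrArg ((A x)⁻¹ *ᵥ ·) this
      simpa only [mulVec_mulVec, hinv, one_mulVec] using this
    obtain ⟨l, hl⟩ := dir_unique hd hc h3
    have h4 : F x y = F x y' + l := by
      rw [← hF.add_int, ← hl]; congr 1; ring
    have h5 : (l : ℝ) = 0 := by linarith
    linarith
  rcases hc.strictMono_of_inj hinj with h | h
  · exact h
  · exfalso
    have := h (show (0 : ℝ) < 0 + 1 by norm_num)
    rw [hF.2.2.1] at this
    linarith

lemma _root_.IsProjLift.liftIter_mono (hF : IsProjLift A F) (hA : ∀ x, (A x).det = 1) (n : ℕ)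
    (x : ℝ) : Monotone (liftIter α F n x) := by
  induction n with
  | zero => exact monotone_id
  | succ n ih => exact fun y y' h => (hF.strictMono hA _).monotone (ih h)

lemma _root_.IsProjLift.liftIter_add_int (hF : IsProjLift A F) (n : ℕ) (x y : ℝ) (l : ℤ) :
    liftIter α F n x (y + l) = liftIter α F n x y + l := by
  induction n with
  | zero => rfl
  | succ n ih => rw [liftIter_succ, liftIter_succ, ih, hF.add_int]

lemma _root_.IsProjLift.abs_liftIter_sub_le (hF : IsProjLift A F) (hA : ∀ x, (A x).det = 1) (n : ℕ)
    (x y : ℝ) : |liftIter α F n x y - liftIter α F n x 0| ≤ |y| + 1 := by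
  have h1 := hF.liftIter_mono (α := α) hA n x (Int.floor_le y)
  have h2 := hF.liftIter_mono (α := α) hA n x (Int.lt_floor_add_one y).le
  have e1 := hF.liftIter_add_int (α := α) n x 0 ⌊y⌋
  have e2 := hF.liftIter_add_int (α := α) n x 0 (⌊y⌋ + 1)
  push_cast at e2
  rw [zero_add] at e1 e2
  rw [e1] at h1
  rw [e2] at h2
  have h3 := Int.floor_le y
  have h4 := Int.lt_floor_add_one y
  have h5 := le_abs_self y
  have h6 := neg_abs_le y
  rw [abs_le]; constructor <;> linarith

/-- `m/2` is the degree of a lift of the action of `Q` on directions. -/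
def HasDeg (Q : ℝ → Matrix (Fin 2) (Fin 2) ℝ) (m : ℤ) : Prop :=
  ∃ G : ℝ → ℝ → ℝ, Continuous (fun p : ℝ × ℝ => G p.1 p.2) ∧ (∀ x y, ActsAs (Q x) y (G x y)) ∧
    ∃ C, ∀ x y, |G x y - y - m * x / 2| ≤ C

lemma HasDeg.mul {Q R : ℝ → Matrix (Fin 2) (Fin 2) ℝ} {m n : ℤ} (hQ : HasDeg Q m)
    (hR : HasDeg R n) : HasDeg (fun x => Q x * R x) (m + n) := by
  obtain ⟨G, hG, hGa, C, hC⟩ := hQ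
  obtain ⟨H, hH, hHa, D, hD⟩ := hR
  refine ⟨fun x y => G x (H x y), hG.comp (continuous_fst.prodMk hH),
    fun x y => (hGa x (H x y)).mul (hHa x y), C + D, fun x y => ?_⟩
  have h1 := hC x (H x y)
  have h2 := hD x y
  push_cast
  rw [abs_le] at *
  constructor <;> linarith [h1.1, h1.2, h2.1, h2.2]

lemma hasDeg_cmat {a b : ℝ → ℂ} (ha : Continuous a) (hb : Continuous b)
    (hab : ∀ x, ‖b x‖ < (a x).re) : HasDeg (fun x => cmat (a x) (b x)) 0 := by
  have hre : ∀ x y, 0 < (a x + b x * ex (-(2 * y))).re := fun x y => by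
    have h1 : ‖b x * ex (-(2 * y))‖ = ‖b x‖ := by rw [norm_mul, norm_ex, mul_one]
    have h2 := Complex.abs_re_le_norm (b x * ex (-(2 * y)))
    rw [h1] at h2
    have := neg_abs_le (b x * ex (-(2 * y))).re
    rw [Complex.add_re]; linarith [hab x]
  have hcont : Continuous fun p : ℝ × ℝ => a p.1 + b p.1 * ex (-(2 * p.2)) := by
    have := continuous_ex
    fun_prop
  refine ⟨fun x y => y + Complex.arg (a x + b x * ex (-(2 * y))) / (2 * Real.pi), ?_, ?_, 1, ?_⟩
  · have : Continuous fun p : ℝ × ℝ => Complex.arg (a p.1 + b p.1 * ex (-(2 * p.2))) := by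
      rw [continuous_iff_continuousAt]
      intro p
      exact ContinuousAt.comp (g := Complex.arg)
        (f := fun p : ℝ × ℝ => a p.1 + b p.1 * ex (-(2 * p.2)))
        (Complex.continuousAt_arg (Or.inl (hre p.1 p.2))) hcont.continuousAt
    fun_prop
  · intro x y
    rw [actsAs_cmat]
    have hne : a x + b x * ex (-(2 * y)) ≠ 0 := fun h => by
      have := hre x y; rw [h] at this; simp at this
    refine ⟨‖a x + b x * ex (-(2 * y))‖, norm_pos_iff.2 hne, ?_⟩
    have h1 : ex (Complex.arg (a x + b x * ex (-(2 * y))) / (2 * Real.pi)) =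
        Complex.exp (Complex.arg (a x + b x * ex (-(2 * y))) * Complex.I) := by
      rw [ex]; congr 1; push_cast
      have : (Real.pi : ℂ) ≠ 0 := by exact_mod_cast Real.pi_ne_zero
      field_simp
    rw [ex_add, h1, mul_left_comm, Complex.norm_mul_exp_arg_mul_I, conj_ex]
    have : ex (-y) = ex y * ex (-(2 * y)) := by rw [← ex_add]; congr 1; ring
    rw [this]; ring
  · intro x y
    have := Complex.abs_arg_le_pi (a x + b x * ex (-(2 * y)))
    have hp := Real.pi_pos
    simp only [Int.cast_zero, zero_mul, zero_div, sub_zero, add_sub_cancel_left]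
    rw [abs_div, abs_of_pos (by positivity : 0 < 2 * Real.pi), div_le_one (by positivity)]
    linarith

lemma hasDeg_ex {s : ℝ → ℝ} (hs : Continuous s) {m : ℤ} {C : ℝ}
    (hC : ∀ x, |s x - m * x / 2| ≤ C) : HasDeg (fun x => cmat (ex (s x)) 0) m := by
  refine ⟨fun x y => y + s x, by fun_prop, fun x y => ?_, C, fun x y => ?_⟩
  · rw [actsAs_cmat]
    exact ⟨1, one_pos, by rw [ex_add]; simp [mul_comm]⟩
  · convert hC x using 2; ring

/-- Transport of the fibered rotation number by a conjugacy. -/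
lemma tendsto_liftIter_conj (hA : ∀ x, (A x).det = 1) (hρ : IsFiberedRotNum α A ρ)
    {B D : ℝ → Matrix (Fin 2) (Fin 2) ℝ} {m : ℤ} (hB : HasDeg B m)
    (hAB : ∀ x, A x * B x = B (x + α) * D x) {H : ℝ → ℝ → ℝ}
    (hH : Continuous fun p : ℝ × ℝ => H p.1 p.2) (hHa : ∀ x y, ActsAs (D x) y (H x y)) :
    ∃ l : ℤ, ∀ y, Filter.Tendsto (fun n : ℕ => liftIter α H n 0 y / (n : ℝ)) Filter.atTop
      (nhds (ρ - m * α / 2 - l)) := by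
  obtain ⟨F, hF, hlim⟩ := hρ
  obtain ⟨G, hG, hGa, C, hC⟩ := hB
  obtain ⟨l, hl⟩ := exists_int_const (Y := ℝ × ℝ)
    (f := fun p => F p.1 (G p.1 p.2) - G (p.1 + α) (H p.1 p.2))
    ((hF.1.comp (continuous_fst.prodMk hG)).sub
      (hG.comp ((continuous_fst.add continuous_const).prodMk hH))) fun p => by
      refine ActsAs.unique (A := A p.1 * B p.1) (y := p.2) ?_ ?_
      · exact ActsAs.mul (hF.2.2.2 _ _) (hGa _ _)
      · rw [hAB]; exact (hGa _ _).mul (hHa _ _)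
  refine ⟨l, fun y => ?_⟩
  have hit : ∀ n : ℕ, liftIter α F n 0 (G 0 y) = G (n * α) (liftIter α H n 0 y) + n * l := by
    intro n
    induction n with
    | zero => simp [liftIter]
    | succ n ih =>
      rw [liftIter_succ, liftIter_succ, ih]
      have h1 : (n : ℝ) * l = ((n * l : ℤ) : ℝ) := by push_cast; ring
      rw [h1, hF.add_int, zero_add]
      have h2 := hl (n * α, liftIter α H n 0 y)
      simp only at h2
      rw [sub_eq_iff_eq_add] at h2
      rw [h2]
      have h3 : ((n + 1 : ℕ) : ℝ) * α = n * α + α := by push_cast; ring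
      rw [h3]; push_cast; ring
  set c := |G 0 y| + 1 + C
  have hb : ∀ n : ℕ, |liftIter α H n 0 y - (liftIter α F n 0 0 - n * (m * α / 2) - n * l)| ≤ c := by
    intro n
    have h1 := hF.abs_liftIter_sub_le (α := α) hA n 0 (G 0 y)
    have h2 := hC (n * α) (liftIter α H n 0 y)
    rw [hit n] at h1
    rw [abs_le] at *
    constructor <;> linarith [h1.1, h1.2, h2.1, h2.2]
  have hz : Filter.Tendsto (fun n : ℕ => (liftIter α H n 0 y -
      (liftIter α F n 0 0 - n * (m * α / 2) - n * l)) / (n : ℝ)) Filter.atTop (nhds 0) := by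
    refine squeeze_zero_norm (fun n => ?_) (tendsto_const_div_atTop_nhds_zero_nat c)
    rw [norm_div, Real.norm_eq_abs, Real.norm_of_nonneg (Nat.cast_nonneg n)]
    gcongr
    exact hb n
  have hsum := (hz.add hlim).sub_const (m * α / 2 + l)
  rw [zero_add, ← sub_sub] at hsum
  refine hsum.congr' ?_
  filter_upwards [Filter.eventually_gt_atTop 0] with n hn
  have : (n : ℝ) ≠ 0 := by exact_mod_cast hn.ne'
  field_simp
  ring

/-- A conjugate cocycle close to a rotation determines the rotation number approximately. -/
lemma exists_abs_rot_sub_le (hA : ∀ x, (A x).det = 1) (hρ : IsFiberedRotNum α A ρ)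
    {B D : ℝ → Matrix (Fin 2) (Fin 2) ℝ} {m : ℤ} (hB : HasDeg B m)
    (hAB : ∀ x, A x * B x = B (x + α) * D x) {H : ℝ → ℝ → ℝ}
    (hH : Continuous fun p : ℝ × ℝ => H p.1 p.2) (hHa : ∀ x y, ActsAs (D x) y (H x y))
    {θ c : ℝ} (hc : ∀ x y, |H x y - y - θ| ≤ c) :
    ∃ l : ℤ, |ρ - m * α / 2 - l - θ| ≤ c := by
  obtain ⟨l, hl⟩ := tendsto_liftIter_conj hA hρ hB hAB hH hHa
  refine ⟨l, ?_⟩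
  have hb : ∀ n : ℕ, |liftIter α H n 0 0 - n * θ| ≤ n * c := by
    intro n
    induction n with
    | zero => simp [liftIter]
    | succ n ih =>
      rw [liftIter_succ]
      have := hc (0 + n * α) (liftIter α H n 0 0)
      push_cast
      rw [abs_le] at *
      constructor <;> linarith [this.1, this.2, ih.1, ih.2]
  refine le_of_tendsto ((hl 0).sub_const θ).abs ?_
  filter_upwards [Filter.eventually_gt_atTop 0] with n hn
  have hn' : (0 : ℝ) < n := by exact_mod_cast hn
  have : liftIter α H n 0 0 / n - θ = (liftIter α H n 0 0 - n * θ) / n := by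
    field_simp
  rw [this, abs_div, abs_of_pos hn', div_le_iff₀ hn', mul_comm c]
  exact hb n

lemma exists_half_int_of_cos_nonneg {t : ℝ} (h : 0 ≤ Real.cos (4 * Real.pi * t)) :
    ∃ j : ℤ, |t - j / 2| ≤ 1 / 8 := by
  refine ⟨round (2 * t), ?_⟩
  set j := round (2 * t)
  have h1 : |2 * t - j| ≤ 1 / 2 := abs_sub_round _
  have h2 : Real.cos (2 * Real.pi * |2 * t - j|) = Real.cos (4 * Real.pi * t) := by
    rw [← Real.cos_abs, abs_mul, abs_abs, abs_of_pos (by positivity : 0 < 2 * Real.pi)]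
    have : 2 * Real.pi * |2 * t - j| = |4 * Real.pi * t - j * (2 * Real.pi)| := by
      rw [← abs_of_pos (by positivity : 0 < 2 * Real.pi), ← abs_mul,
        abs_of_pos (by positivity : 0 < 2 * Real.pi)]
      congr 1; ring
    rw [this, Real.cos_abs, Real.cos_sub_int_mul_two_pi]
  by_contra hcon
  push Not at hcon
  have h3 : |t - j / 2| = |2 * t - j| / 2 := by
    rw [show t - j / 2 = (2 * t - j) / 2 by ring, abs_div, abs_of_pos (two_pos (α := ℝ))]
  rw [h3] at hcon
  have hp := Real.pi_pos
  have : Real.cos (2 * Real.pi * |2 * t - j|) < 0 := by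
    apply Real.cos_neg_of_pi_div_two_lt_of_lt <;> nlinarith
  linarith [h2 ▸ this]

/-- A conjugate cocycle preserving a quadrant has half-integer rotation number. -/
lemma exists_rot_eq_of_cone (hA : ∀ x, (A x).det = 1) (hρ : IsFiberedRotNum α A ρ)
    {B D : ℝ → Matrix (Fin 2) (Fin 2) ℝ} {m : ℤ} (hB : HasDeg B m)
    (hAB : ∀ x, A x * B x = B (x + α) * D x) {H : ℝ → ℝ → ℝ}
    (hH : Continuous fun p : ℝ × ℝ => H p.1 p.2) (hHa : ∀ x y, ActsAs (D x) y (H x y))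
    {ω : ℝ} (hcone : ∀ x y, 0 ≤ Real.cos (4 * Real.pi * (y - ω)) →
      0 ≤ Real.cos (4 * Real.pi * (H x y - ω)))
    {j : ℤ} (hj : ∀ x y, |H x y - y - j / 2| < 1 / 4) :
    ∃ l : ℤ, 2 * ρ - m * α - l = 0 := by
  obtain ⟨l, hl⟩ := tendsto_liftIter_conj hA hρ hB hAB hH hHa
  have hb : ∀ n : ℕ, |liftIter α H n 0 ω - ω - n * (j / 2 : ℝ)| ≤ 1 / 8 ∧
      0 ≤ Real.cos (4 * Real.pi * (liftIter α H n 0 ω - ω)) := by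
    intro n
    induction n with
    | zero => simp [liftIter]
    | succ n ih =>
      rw [liftIter_succ]
      set z := liftIter α H n 0 ω
      have hc := hcone (0 + n * α) z ih.2
      refine ⟨?_, hc⟩
      obtain ⟨i, hi⟩ := exists_half_int_of_cos_nonneg hc
      have h1 := hj (0 + n * α) z
      have h2 := ih.1
      have h3 : |((i - (n + 1) * j : ℤ) : ℝ)| < 1 := by
        push_cast
        rw [abs_le] at hi h2
        rw [abs_lt] at *
        constructor <;> linarith [h1.1, h1.2, h2.1, h2.2, hi.1, hi.2]
      have h4 : i - (n + 1) * j = 0 := by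
        rw [← Int.abs_lt_one_iff]
        exact_mod_cast h3
      have h5 : (i : ℝ) = (n + 1) * j := by
        have : i = (n + 1) * j := by linarith
        exact_mod_cast this
      rw [h5] at hi
      convert hi using 2
      push_cast; ring
  have hlim : Filter.Tendsto (fun n : ℕ => liftIter α H n 0 ω / (n : ℝ)) Filter.atTop
      (nhds (j / 2)) := by
    have hz : Filter.Tendsto (fun n : ℕ => (liftIter α H n 0 ω - n * (j / 2 : ℝ)) / (n : ℝ))
        Filter.atTop (nhds 0) := by
      refine squeeze_zero_norm (fun n => ?_) (tendsto_const_div_atTop_nhds_zero_nat (1 / 8 + |ω|))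
      rw [norm_div, Real.norm_eq_abs, Real.norm_of_nonneg (Nat.cast_nonneg n)]
      gcongr
      have := (hb n).1
      have h5 := le_abs_self ω
      have h6 := neg_abs_le ω
      rw [abs_le] at *
      constructor <;> linarith [this.1, this.2]
    have := hz.add_const (j / 2 : ℝ)
    rw [zero_add] at this
    refine this.congr' ?_
    filter_upwards [Filter.eventually_gt_atTop 0] with n hn
    have : (n : ℝ) ≠ 0 := by exact_mod_cast hn.ne'
    field_simp
    ring
  have := tendsto_nhds_unique (hl ω) hlim
  exact ⟨2 * l + j, by push_cast; linarith⟩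

end Lift

section Smooth

/-- Sequences decaying faster than any power. -/
def Rapid (c : ℤ → ℂ) : Prop := ∀ r : ℕ, nrm (wt 1 r) c ≠ ∞

/-- Fourier coefficients of the derivative. -/
noncomputable def dseq (c : ℤ → ℂ) : ℤ → ℂ := fun k => (2 * Real.pi * k * Complex.I) * c k

lemma Rapid.one {c : ℤ → ℂ} (h : Rapid c) : nrm 1 c ≠ ∞ := by
  have h0 := h 0
  have : wt 1 0 = 1 := by ext k; simp [wt]
  rwa [this] at h0

lemma nrm_dseq_le (c : ℤ → ℂ) (r : ℕ) :
    nrm (wt 1 r) (dseq c) ≤ ENNReal.ofReal (2 * Real.pi) * nrm (wt 1 (r + 1)) c := by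
  refine nrm_le_mul fun k => ?_
  have h1 : ‖dseq c k‖ₑ ≤ ENNReal.ofReal (2 * Real.pi) * ENNReal.ofReal (1 + |(k : ℝ)| / 1) * ‖c k‖ₑ := by
    rw [← ofReal_norm, ← ofReal_norm, ← ENNReal.ofReal_mul (by positivity),
      ← ENNReal.ofReal_mul (by positivity)]
    refine ENNReal.ofReal_le_ofReal ?_
    have : ‖dseq c k‖ = 2 * Real.pi * |(k : ℝ)| * ‖c k‖ := by
      simp [dseq, abs_of_pos Real.pi_pos]
    rw [this, div_one]
    have := Real.pi_pos
    gcongr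
    linarith
  calc wt 1 r k * ‖dseq c k‖ₑ ≤ wt 1 r k *
        (ENNReal.ofReal (2 * Real.pi) * ENNReal.ofReal (1 + |(k : ℝ)| / 1) * ‖c k‖ₑ) := by gcongr
    _ = ENNReal.ofReal (2 * Real.pi) * ((wt 1 r k * ENNReal.ofReal (1 + |(k : ℝ)| / 1)) * ‖c k‖ₑ) := by
        ring
    _ = _ := by
        rw [wt, wt, ← ENNReal.ofReal_mul (by positivity), pow_succ]

lemma Rapid.dseq {c : ℤ → ℂ} (h : Rapid c) : Rapid (dseq c) := fun r =>
  ne_top_of_le_ne_top (ENNReal.mul_ne_top ENNReal.ofReal_ne_top (h (r + 1))) (nrm_dseq_le c r)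

lemma hasDerivAt_ex_mul (a : ℂ) (k : ℤ) (x : ℝ) :
    HasDerivAt (fun x : ℝ => a * ex (k * x)) (2 * Real.pi * k * Complex.I * a * ex (k * x)) x := by
  have h1 : HasDerivAt (fun x : ℝ => (2 * Real.pi * ((k * x : ℝ) : ℂ) * Complex.I))
      (2 * Real.pi * k * Complex.I) x := by
    have : HasDerivAt (fun x : ℝ => ((k * x : ℝ) : ℂ)) (k : ℂ) x := by
      have := ((hasDerivAt_id x).const_mul (k : ℝ)).ofReal_comp
      simpa using this
    have := (this.const_mul (2 * Real.pi : ℂ)).mul_const Complex.I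
    exact this
  have := (h1.cexp).const_mul a
  refine this.congr_deriv ?_
  simp only [ex]; push_cast; ring

lemma Rapid.hasDerivAt_ev {c : ℤ → ℂ} (h : Rapid c) (x : ℝ) :
    HasDerivAt (ev c) (ev (QPCocycle.dseq c) x) x := by
  refine hasDerivAt_tsum (u := fun k => ‖QPCocycle.dseq c k‖) (summable_norm_of_nrm h.dseq.one)
    (g := fun (k : ℤ) (x : ℝ) => c k * ex (k * x))
    (g' := fun (k : ℤ) (x : ℝ) => QPCocycle.dseq c k * ex (k * x))
    (fun k y => hasDerivAt_ex_mul (c k) k y) (fun k y => (norm_term _ _ _).le)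
    (y₀ := 0) (summable_ev h.one 0) x

lemma Rapid.contDiff_ev {c : ℤ → ℂ} (h : Rapid c) : ContDiff ℝ (⊤ : ℕ∞) (ev c) := by
  rw [contDiff_infty]
  intro n
  induction n generalizing c with
  | zero =>
    exact contDiff_zero.2 (continuous_iff_continuousAt.2 fun x => (h.hasDerivAt_ev x).continuousAt)
  | succ n ih =>
    push_cast
    rw [contDiff_succ_iff_deriv]
    refine ⟨fun x => (h.hasDerivAt_ev x).differentiableAt, by simp, ?_⟩
    rw [show deriv (ev c) = ev (QPCocycle.dseq c) from funext fun x => (h.hasDerivAt_ev x).deriv]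
    exact ih h.dseq

lemma Rapid.enorm_iteratedDeriv_le {c : ℤ → ℂ} (h : Rapid c) (l : ℕ) (x : ℝ) :
    ‖iteratedDeriv l (ev c) x‖ₑ ≤ ENNReal.ofReal (2 * Real.pi) ^ l * nrm (wt 1 l) c := by
  suffices H : ∀ (l : ℕ) {c : ℤ → ℂ}, Rapid c → ∀ r, ‖iteratedDeriv l (ev c) x‖ₑ ≤
      ENNReal.ofReal (2 * Real.pi) ^ l * nrm (wt 1 (r + l)) c by
    simpa using H l h 0
  intro l
  induction l with
  | zero =>
    intro c h r
    simpa using (enorm_ev_le x).trans (nrm_one_le (isWeight_wt one_pos r))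
  | succ l ih =>
    intro c h r
    rw [iteratedDeriv_succ',
      show deriv (ev c) = ev (QPCocycle.dseq c) from funext fun x => (h.hasDerivAt_ev x).deriv]
    refine (ih h.dseq r).trans ?_
    rw [pow_succ, mul_assoc, ← add_assoc]
    gcongr
    exact nrm_dseq_le _ _

end Smooth

section NearRotation

lemma abs_arg_one_add_le {h : ℂ} (hh : ‖h‖ ≤ 1 / 2) : |Complex.arg (1 + h)| ≤ 3 / 2 * ‖h‖ := by
  rw [← Complex.log_im]
  exact (Complex.abs_im_le_norm _).trans (Complex.norm_log_one_add_half_le_self hh)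

/-- A lift of a perturbation of a constant conformal matrix. -/
lemma exists_lift_near {a b : ℝ → ℂ} (ha : Continuous a) (hb : Continuous b) {r θ c : ℝ}
    (hr : 0 < r) (hc : c ≤ r / 2) (hab : ∀ x, ‖a x‖ + ‖b x‖ ≤ c) :
    ∃ H : ℝ → ℝ → ℝ, Continuous (fun p : ℝ × ℝ => H p.1 p.2) ∧
      (∀ x y, ActsAs (cmat (r * ex θ + a x) (b x)) y (H x y)) ∧
      ∀ x y, |H x y - y - θ| ≤ c / r := by
  set h : ℝ → ℝ → ℂ := fun x y => (a x + b x * ex (-(2 * y))) / (r * ex θ)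
  have hr' : (r : ℂ) * ex θ ≠ 0 := mul_ne_zero (by exact_mod_cast hr.ne') (ex_ne_zero _)
  have hn : ∀ x y, ‖h x y‖ ≤ c / r := fun x y => by
    have h1 : ‖(r : ℂ) * ex θ‖ = r := by
      rw [norm_mul, norm_ex, mul_one, Complex.norm_real, Real.norm_of_nonneg hr.le]
    rw [norm_div, h1]
    gcongr
    refine (norm_add_le _ _).trans ?_
    rw [norm_mul, norm_ex, mul_one]; exact hab x
  have hn2 : ∀ x y, ‖h x y‖ ≤ 1 / 2 := fun x y => (hn x y).trans (by
    rw [div_le_iff₀ hr]; linarith)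
  have hre : ∀ x y, 0 < (1 + h x y).re := fun x y => by
    have := (abs_le.1 ((Complex.abs_re_le_norm (h x y)).trans (hn2 x y))).1
    simp only [Complex.add_re, Complex.one_re]; linarith
  have hcont : Continuous fun p : ℝ × ℝ => 1 + h p.1 p.2 := by
    have := continuous_ex
    fun_prop
  have hp := Real.pi_pos
  refine ⟨fun x y => y + θ + Complex.arg (1 + h x y) / (2 * Real.pi), ?_, fun x y => ?_,
    fun x y => ?_⟩
  · have : Continuous fun p : ℝ × ℝ => Complex.arg (1 + h p.1 p.2) := by
      rw [continuous_iff_continuousAt]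
      intro p
      exact ContinuousAt.comp (g := Complex.arg) (f := fun p : ℝ × ℝ => 1 + h p.1 p.2)
        (Complex.continuousAt_arg (Or.inl (hre p.1 p.2))) hcont.continuousAt
    fun_prop
  · rw [actsAs_cmat]
    have hne : 1 + h x y ≠ 0 := fun h0 => by
      have := hre x y; rw [h0] at this; simp at this
    refine ⟨r * ‖1 + h x y‖, mul_pos hr (norm_pos_iff.2 hne), ?_⟩
    have h1 : ex (Complex.arg (1 + h x y) / (2 * Real.pi)) =
        Complex.exp (Complex.arg (1 + h x y) * Complex.I) := by
      rw [ex]; congr 1; push_cast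
      have : (Real.pi : ℂ) ≠ 0 := by exact_mod_cast Real.pi_ne_zero
      field_simp
    have h2 := Complex.norm_mul_exp_arg_mul_I (1 + h x y)
    have h3 : r * ex θ + (a x + b x * ex (-(2 * y))) = r * ex θ * (1 + h x y) := by
      simp only [h]; rw [mul_add, mul_one, mul_div_cancel₀ _ hr']
    rw [ex_add, ex_add, h1, conj_ex]
    have h4 : ex (-y) = ex y * ex (-(2 * y)) := by rw [← ex_add]; congr 1; ring
    push_cast
    calc _ = ex y * (r * ex θ + (a x + b x * ex (-(2 * y)))) := by rw [h4]; ring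
      _ = r * ex θ * ex y * (‖1 + h x y‖ * Complex.exp (Complex.arg (1 + h x y) * Complex.I)) := by
          rw [h3, h2]; ring
      _ = _ := by ring
  · have h1 := abs_arg_one_add_le (hn2 x y)
    have h2 : y + θ + Complex.arg (1 + h x y) / (2 * Real.pi) - y - θ =
        Complex.arg (1 + h x y) / (2 * Real.pi) := by ring
    rw [h2, abs_div, abs_of_pos (by positivity : 0 < 2 * Real.pi), div_le_iff₀ (by positivity)]
    have := hn x y
    have h3 := norm_nonneg (h x y)
    have := Real.pi_gt_three
    nlinarith

lemma exists_eq_norm_mul_ex (z : ℂ) : ∃ θ : ℝ, z = ‖z‖ * ex θ := by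
  refine ⟨Complex.arg z / (2 * Real.pi), ?_⟩
  conv_lhs => rw [← Complex.norm_mul_exp_arg_mul_I z]
  rw [ex]; congr 2; push_cast
  have : (Real.pi : ℂ) ≠ 0 := by exact_mod_cast Real.pi_ne_zero
  field_simp

end NearRotation

section Det

/-- The modulus of an approximately conjugate constant conformal matrix is close to one. -/
lemma norm_bounds_of_conj {A B : ℝ → Matrix (Fin 2) (Fin 2) ℝ} {α : ℝ}
    (hA : ∀ x, (A x).det = 1) (hBc : Continuous B) (hBp : ∀ x, B (x + 2) = B x)
    (hBd : ∀ x, 0 < (B x).det) {lam : ℂ} {a b : ℝ → ℂ} {c : ℝ}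
    (hab : ∀ x, ‖a x‖ + ‖b x‖ ≤ c)
    (hAB : ∀ x, A x * B x = B (x + α) * cmat (lam + a x) (b x)) :
    1 - c ≤ ‖lam‖ ∧ ‖lam‖ ≤ 1 + 2 * c := by
  have hdet : ∀ x, (B x).det = (B (x + α)).det * (‖lam + a x‖ ^ 2 - ‖b x‖ ^ 2) := fun x => by
    have := congrArg Matrix.det (hAB x)
    rwa [det_mul, det_mul, hA, one_mul, det_cmat] at this
  have hcont : Continuous fun x => (B x).det := hBc.matrix_det
  have hper : Function.Periodic (fun x => (B x).det) 2 := fun x => by simp only [hBp]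
  have hext : ∀ x, ∃ y ∈ Set.Icc (0 : ℝ) 2, (B x).det = (B y).det := fun x => by
    obtain ⟨y, hy, h⟩ := hper.exists_mem_Ico₀ two_pos x
    exact ⟨y, Set.Ico_subset_Icc_self hy, h⟩
  obtain ⟨x₁, -, h₁⟩ := isCompact_Icc.exists_isMaxOn (Set.nonempty_Icc.2 zero_le_two)
    hcont.continuousOn
  obtain ⟨x₂, -, h₂⟩ := isCompact_Icc.exists_isMinOn (Set.nonempty_Icc.2 zero_le_two)
    hcont.continuousOn
  have hmax : ∀ x, (B x).det ≤ (B x₁).det := fun x => by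
    obtain ⟨y, hy, h⟩ := hext x
    rw [h]; exact h₁ hy
  have hmin : ∀ x, (B x₂).det ≤ (B x).det := fun x => by
    obtain ⟨y, hy, h⟩ := hext x
    rw [h]; exact h₂ hy
  have e1 : 1 ≤ ‖lam + a x₁‖ ^ 2 - ‖b x₁‖ ^ 2 := by
    by_contra hcon
    push Not at hcon
    have h1 := hdet x₁
    have h2 := hmax (x₁ + α)
    have h3 := hBd (x₁ + α)
    nlinarith
  have e2 : ‖lam + a x₂‖ ^ 2 - ‖b x₂‖ ^ 2 ≤ 1 := by
    by_contra hcon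
    push Not at hcon
    have h1 := hdet x₂
    have h2 := hmin (x₂ + α)
    have h3 := hBd (x₂ + α)
    nlinarith
  have n1 := norm_nonneg (a x₁)
  have n2 := norm_nonneg (b x₁)
  have n3 := norm_nonneg (a x₂)
  have n4 := norm_nonneg (b x₂)
  have n5 := norm_nonneg (lam + a x₂)
  constructor
  · have h1 : 1 ≤ ‖lam + a x₁‖ := by
      have : 1 ≤ ‖lam + a x₁‖ ^ 2 := by nlinarith
      exact (one_le_sq_iff₀ (norm_nonneg _)).1 this
    have := norm_add_le lam (a x₁)
    linarith [hab x₁]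
  · have h1 : ‖lam + a x₂‖ ≤ 1 + ‖b x₂‖ := by
      refine le_of_sq_le_sq ?_ (by linarith)
      nlinarith
    have h2 : ‖lam‖ ≤ ‖lam + a x₂‖ + ‖a x₂‖ := by
      have := norm_sub_le (lam + a x₂) (a x₂)
      rwa [add_sub_cancel_right] at this
    linarith [hab x₂]

end Det

section Weights

variable {P : PS}

/-- Comparison of the norms of a pair without low frequencies. -/
lemma nrm2_le_of_high {w w' : ℤ → ℝ≥0∞} {M : ℝ} {C : ℝ≥0∞}
    (h1 : ∀ k : ℤ, |(k : ℝ)| ≤ M → P.1 k = 0) (h2 : ∀ k : ℤ, |(k : ℝ)| ≤ M → P.2 k = 0)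
    (hw : ∀ k : ℤ, M < |(k : ℝ)| → w' k ≤ C * w k) : nrm2 w' P ≤ C * nrm2 w P := by
  rw [nrm2, nrm2, mul_add]
  refine add_le_add (nrm_le_mul fun k => ?_) (nrm_le_mul fun k => ?_) <;>
    rw [← mul_assoc] <;> rcases le_or_gt |(k : ℝ)| M with h | h
  · simp [h1 k h]
  · gcongr; exact hw k h
  · simp [h2 k h]
  · gcongr; exact hw k h

/-- Comparison of the norms of a pair without high frequencies. -/
lemma nrm2_le_of_low {w w' : ℤ → ℝ≥0∞} {M : ℝ} {C : ℝ≥0∞}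
    (h1 : ∀ k : ℤ, M < |(k : ℝ)| → P.1 k = 0) (h2 : ∀ k : ℤ, M < |(k : ℝ)| → P.2 k = 0)
    (hw : ∀ k : ℤ, |(k : ℝ)| ≤ M → w' k ≤ C * w k) : nrm2 w' P ≤ C * nrm2 w P := by
  rw [nrm2, nrm2, mul_add]
  refine add_le_add (nrm_le_mul fun k => ?_) (nrm_le_mul fun k => ?_) <;>
    rw [← mul_assoc] <;> rcases le_or_gt |(k : ℝ)| M with h | h
  · gcongr; exact hw k h
  · simp [h1 k h]
  · gcongr; exact hw k h
  · simp [h2 k h]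

lemma wt_le_of_abs_le {N M : ℝ} (hN : 0 < N) (S : ℕ) {k : ℤ} (hk : |(k : ℝ)| ≤ M) :
    wt N S k ≤ ENNReal.ofReal ((1 + M / N) ^ S) := by
  refine ENNReal.ofReal_le_ofReal ?_
  gcongr

lemma wt_le_of_lt_abs {N N' M : ℝ} (hN : 0 < N) (hN' : 0 < N') (hM : 0 < M) (S : ℕ) {k : ℤ}
    (hk : M < |(k : ℝ)|) :
    wt N' S k ≤ ENNReal.ofReal ((N / M + N / N') ^ S) * wt N S k := by
  rw [wt, wt, ← ENNReal.ofReal_mul (by positivity), ← mul_pow]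
  refine ENNReal.ofReal_le_ofReal ?_
  gcongr
  have h1 : 1 ≤ |(k : ℝ)| / M := (one_le_div hM).2 hk.le
  have h2 : (N / M + N / N') * (1 + |(k : ℝ)| / N) =
      |(k : ℝ)| / M + |(k : ℝ)| / N' + N / M + N / N' := by field_simp; ring
  have h3 : 0 < N / M := by positivity
  have h4 : 0 < N / N' := by positivity
  linarith

lemma one_le_mul_wt {N M : ℝ} (hN : 0 < N) (hM : 0 < M) (S : ℕ) {k : ℤ}
    (hk : M < |(k : ℝ)|) : 1 ≤ ENNReal.ofReal ((N / M) ^ S) * wt N S k := by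
  rw [wt, ← ENNReal.ofReal_mul (by positivity), ← mul_pow, ← ENNReal.ofReal_one]
  refine ENNReal.ofReal_le_ofReal (one_le_pow₀ ?_)
  have h1 : 1 ≤ |(k : ℝ)| / M := (one_le_div hM).2 hk.le
  have h2 : (N / M) * (1 + |(k : ℝ)| / N) = |(k : ℝ)| / M + N / M := by field_simp; ring
  have h3 : 0 < N / M := by positivity
  linarith

lemma wt_one_le {N : ℝ} (hN : 1 ≤ N) (S : ℕ) (k : ℤ) :
    wt 1 S k ≤ ENNReal.ofReal (N ^ S) * wt N S k := by
  have hN' : 0 < N := by linarith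
  rw [wt, wt, ← ENNReal.ofReal_mul (by positivity), ← mul_pow]
  refine ENNReal.ofReal_le_ofReal ?_
  gcongr
  have h2 : N * (1 + |(k : ℝ)| / N) = N + |(k : ℝ)| := by field_simp
  rw [h2, div_one]; linarith

lemma wt_zero (N : ℝ) : wt N 0 = 1 := by ext k; simp [wt]

end Weights

section SmallDivisors

lemma four_mul_le_norm_ex_sub_one {t c : ℝ} (h : ∀ l : ℤ, c ≤ |t - l|) : 4 * c ≤ ‖ex t - 1‖ := by
  set s := t - round t
  have hs : |s| ≤ 1 / 2 := abs_sub_round t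
  have hex : ex t = ex s := by
    have : t = s + (round t : ℤ) := by simp [s]
    conv_lhs => rw [this]
    rw [ex_add_int]
  have h1 : ‖ex s - 1‖ = 2 * |Real.sin (Real.pi * s)| := by
    have := Complex.norm_exp_I_mul_ofReal_sub_one (2 * Real.pi * s)
    rw [ex]
    have h2 : Complex.I * ((2 * Real.pi * s : ℝ) : ℂ) = 2 * Real.pi * s * Complex.I := by
      push_cast; ring
    rw [h2] at this
    rw [this, norm_mul, Real.norm_eq_abs, Real.norm_eq_abs]
    norm_num
    congr 2; ring
  have h2 : 2 * |s| ≤ |Real.sin (Real.pi * s)| := by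
    have h3 : |Real.sin (Real.pi * s)| = |Real.sin (Real.pi * |s|)| := by
      rcases abs_cases s with ⟨h, _⟩ | ⟨h, _⟩ <;> rw [h]
      rw [mul_neg, Real.sin_neg, abs_neg]
    rw [h3]
    have hp := Real.pi_pos
    have := Real.mul_le_sin (x := Real.pi * |s|) (by positivity) (by nlinarith)
    refine le_trans (le_of_eq ?_) (this.trans (le_abs_self _))
    field_simp
  rw [hex, h1]
  have := h (round t)
  change c ≤ |s| at this
  linarith

lemma norm_ex_sub_one_ge_of_mem_DCone {α η : ℝ} (h : α ∈ DCone (η ^ 2)) (k : ℤ) (hk : k ≠ 0) :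
    4 * η ^ 2 / (k : ℝ) ^ 2 ≤ ‖ex (k * α) - 1‖ := by
  have hpos : ∀ m : ℕ, 0 < m → 4 * η ^ 2 / (m : ℝ) ^ 2 ≤ ‖ex (m * α) - 1‖ := by
    intro m hm
    have hm' : (0 : ℝ) < m := by exact_mod_cast hm
    have := four_mul_le_norm_ex_sub_one (t := m * α) (c := η ^ 2 / (m : ℝ) ^ 2) fun l => by
      have h1 := h l m hm
      have h2 : |(m : ℝ) * α - l| = m * |α - l / m| := by
        rw [← abs_of_pos hm', ← abs_mul, abs_of_pos hm']; congr 1; field_simp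
      rw [h2]
      calc η ^ 2 / (m : ℝ) ^ 2 = m * (η ^ 2 / (m : ℝ) ^ 3) := by field_simp
        _ ≤ _ := by gcongr
    calc _ = 4 * (η ^ 2 / (m : ℝ) ^ 2) := by ring
      _ ≤ _ := this
  obtain ⟨m, rfl | rfl⟩ := k.eq_nat_or_neg
  · have := hpos m (by omega)
    simpa using this
  · have := hpos m (by omega)
    have h2 : ‖ex (((-(m : ℤ) : ℤ) : ℝ) * α) - 1‖ = ‖ex (m * α) - 1‖ := by
      have : ex (((-(m : ℤ) : ℤ) : ℝ) * α) - 1 = conj (ex (m * α) - 1) := by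
        rw [map_sub, conj_ex, map_one]; push_cast; ring_nf
      rw [this, Complex.norm_conj]
    rw [h2]; simpa using this

end SmallDivisors

section ConstantNormalForm

/-- An almost elliptic constant matrix is conjugate, with controlled conjugacy, to a matrix which
is almost conformal. -/
lemma exists_conj_constant {y τ : ℝ} {β : ℂ} (hτ : 0 < τ) (hτ1 : τ ≤ 1 / 4) (hy : |y| ≤ 1)
    (hd : -τ ^ 2 ≤ y ^ 2 - ‖β‖ ^ 2) :
    ∃ u : ℂ, ‖u‖ < 1 ∧ (1 - ‖u‖ ^ 2)⁻¹ ≤ 2 / τ ∧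
      ‖β + 2 * Complex.I * y * u - conj β * u ^ 2‖ ≤ 5 * τ * (1 - ‖u‖ ^ 2) := by
  obtain ⟨s, hs, hsy⟩ : ∃ s : ℝ, s ^ 2 = 1 ∧ s * y = |y| := by
    rcases abs_cases y with ⟨h, _⟩ | ⟨h, _⟩
    · exact ⟨1, by norm_num, by rw [h, one_mul]⟩
    · exact ⟨-1, by norm_num, by rw [h]; ring⟩
  set Y := |y|
  have hY0 : 0 ≤ Y := abs_nonneg y
  have hY2 : y ^ 2 = Y ^ 2 := (sq_abs y).symm
  set b := ‖β‖
  have hb0 : 0 ≤ b := norm_nonneg β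
  obtain ⟨θ, hθ, hcase⟩ : ∃ θ : ℝ, 2 * τ ≤ θ ∧
      (θ ^ 2 = Y ^ 2 - b ^ 2 ∨ (θ = 2 * τ ∧ Y ^ 2 - b ^ 2 ≤ θ ^ 2)) := by
    rcases le_total ((2 * τ) ^ 2) (Y ^ 2 - b ^ 2) with h | h
    · exact ⟨√(Y ^ 2 - b ^ 2), Real.le_sqrt_of_sq_le h,
        Or.inl (Real.sq_sqrt (le_trans (by positivity) h))⟩
    · exact ⟨2 * τ, le_rfl, Or.inr ⟨rfl, h⟩⟩
  have hθ0 : 0 < θ := by linarith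
  set T := Y + θ
  have hT : 0 < T := by positivity
  set t : ℝ := s * T
  have ht2 : t ^ 2 = T ^ 2 := by simp only [t]; rw [mul_pow, hs, one_mul]
  have ht : t ≠ 0 := fun h => by rw [h] at ht2; nlinarith
  have hyt : y * t = Y * T := by simp only [t]; rw [← hsy]; ring
  have htC : (t : ℂ) ≠ 0 := by exact_mod_cast ht
  have hnu : ‖Complex.I * β / t‖ ^ 2 = b ^ 2 / T ^ 2 := by
    rw [norm_div, norm_mul, Complex.norm_I, one_mul, div_pow, Complex.norm_real, Real.norm_eq_abs,
      sq_abs, ht2]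
  have hgap : T ^ 2 - b ^ 2 = (Y ^ 2 - b ^ 2) + 2 * Y * θ + θ ^ 2 := by simp only [T]; ring
  rw [hY2] at hd
  have hgap0 : 0 < T ^ 2 - b ^ 2 := by rw [hgap]; nlinarith [mul_nonneg hY0 hθ0.le]
  have hfac : 1 - b ^ 2 / T ^ 2 = (T ^ 2 - b ^ 2) / T ^ 2 := by field_simp
  have hz : β + 2 * Complex.I * y * (Complex.I * β / t) - conj β * (Complex.I * β / t) ^ 2 =
      ((θ ^ 2 - (Y ^ 2 - b ^ 2)) / T ^ 2 : ℝ) * β := by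
    have h1 : (b ^ 2 : ℂ) = β * conj β := by
      rw [Complex.mul_conj, Complex.normSq_eq_norm_sq]; push_cast; rfl
    have h2 : ((t ^ 2 - 2 * (y * t) + b ^ 2 : ℝ) : ℂ) = ((θ ^ 2 - (Y ^ 2 - b ^ 2) : ℝ) : ℂ) := by
      congr 1; rw [ht2, hyt]; simp only [T]; ring
    have h3 : β + 2 * Complex.I * y * (Complex.I * β / t) - conj β * (Complex.I * β / t) ^ 2 =
        ((t ^ 2 - 2 * (y * t) + b ^ 2 : ℝ) : ℂ) / ((t ^ 2 : ℝ) : ℂ) * β := by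
      push_cast
      rw [h1]
      field_simp
      ring_nf
      rw [Complex.I_sq]; ring
    rw [h3, h2, ht2]; push_cast; ring
  refine ⟨Complex.I * β / t, ?_, ?_, ?_⟩
  · have : ‖Complex.I * β / t‖ ^ 2 < 1 ^ 2 := by
      rw [hnu, one_pow, div_lt_one (by positivity)]; linarith
    exact lt_of_pow_lt_pow_left₀ 2 zero_le_one this
  · rw [hnu, hfac, inv_div, div_le_div_iff₀ hgap0 hτ, hgap]
    rcases hcase with h | ⟨h, h'⟩
    · have e1 : Y ^ 2 - b ^ 2 + 2 * Y * θ + θ ^ 2 = 2 * θ * T := by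
        rw [← h]; simp only [T]; ring
      have hθY : θ ≤ Y := by
        refine le_of_sq_le_sq ?_ hY0
        nlinarith [sq_nonneg b]
      rw [e1]
      have : T ≤ 2 := by simp only [T]; linarith
      have e2 : T * τ ≤ 2 * θ * 2 := by nlinarith
      nlinarith
    · simp only [T]; rw [h]
      nlinarith [mul_nonneg hY0 hτ.le, mul_nonneg hY0 (mul_nonneg hτ.le hτ.le), mul_pos hτ hτ,
        mul_nonneg (mul_nonneg hY0 hτ.le) (sub_nonneg.2 hy), mul_pos hτ (mul_pos hτ hτ)]
  · rw [hz, hnu, hfac, norm_mul, Complex.norm_real, Real.norm_eq_abs, abs_div,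
      abs_of_pos (by positivity : 0 < T ^ 2), ← mul_div_assoc, div_mul_eq_mul_div]
    refine div_le_div_of_nonneg_right ?_ (by positivity)
    change _ * b ≤ _
    rcases hcase with h | ⟨h, h'⟩
    · rw [h]; simp; positivity
    · rw [abs_of_nonneg (by linarith), hgap]
      have hbY : b ≤ Y + τ := by
        refine le_of_sq_le_sq ?_ (by linarith)
        nlinarith
      have e1 : θ ^ 2 - (Y ^ 2 - b ^ 2) ≤ 5 * τ ^ 2 := by rw [h]; linarith
      calc _ ≤ 5 * τ ^ 2 * (Y + τ) := by gcongr
        _ = 5 * τ * (τ * Y + τ ^ 2) := by ring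
        _ ≤ _ := by
            refine mul_le_mul_of_nonneg_left ?_ (by positivity)
            rw [h]; nlinarith [mul_nonneg hY0 hτ.le]

end ConstantNormalForm

section Hyperbolic

lemma ex_half : ex (1 / 2) = -1 := by
  rw [ex, ← Complex.exp_pi_mul_I]; congr 1; push_cast; ring

/-- A hyperbolic constant matrix and its small perturbations preserve a cone. -/
lemma re_sq_nonneg_of_re_sq_nonneg {x y b g : ℝ} {ζ e : ℂ} (hx : 2 * g ≤ x) (hb : |y| + 2 * g ≤ b)
    (hζ : ‖ζ‖ = 1) (he : ‖e‖ ≤ g) (h : 0 ≤ (ζ ^ 2).re) :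
    0 ≤ ((x * ζ + Complex.I * y * ζ + b * conj ζ + e) ^ 2).re := by
  have hg : 0 ≤ g := (norm_nonneg e).trans he
  have h1 := (abs_le.1 ((Complex.abs_re_le_norm e).trans he))
  have h2 := (abs_le.1 ((Complex.abs_im_le_norm e).trans he))
  have hn : ζ.re ^ 2 + ζ.im ^ 2 = 1 := by
    have := Complex.sq_norm ζ
    rw [hζ, Complex.normSq_apply] at this; linarith
  have hr : (ζ ^ 2).re = (ζ.re - ζ.im) * (ζ.re + ζ.im) := by
    rw [sq, Complex.mul_re]; ring
  rw [hr] at h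
  have hy := abs_le.1 (le_refl |y|)
  set p := ζ.re
  set q := ζ.im
  have hgoal : ((x * ζ + Complex.I * y * ζ + b * conj ζ + e) ^ 2).re =
      (x * (p - q) + (b - y) * (p + q) + (e.re - e.im)) *
        (x * (p + q) + (b + y) * (p - q) + (e.re + e.im)) := by
    rw [sq, Complex.mul_re]
    simp only [Complex.add_re, Complex.mul_re, Complex.I_re, Complex.I_im, Complex.add_im,
      Complex.mul_im, Complex.ofReal_re, Complex.ofReal_im, Complex.conj_re, Complex.conj_im]
    simp only [p, q]; ring
  rw [hgoal]
  have hsum : (p - q) ^ 2 + (p + q) ^ 2 = 2 := by linarith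
  generalize p - q = r at *
  generalize p + q = l at *
  have hone : 1 ≤ |r| + |l| := by
    have := abs_nonneg r
    have := abs_nonneg l
    have e1 := sq_abs r
    have e2 := sq_abs l
    nlinarith
  rcases mul_nonneg_iff.1 h with ⟨hr0, hl0⟩ | ⟨hr0, hl0⟩
  · rw [abs_of_nonneg hr0, abs_of_nonneg hl0] at hone
    apply mul_nonneg <;> nlinarith
  · rw [abs_of_nonpos hr0, abs_of_nonpos hl0] at hone
    apply mul_nonneg_of_nonpos_of_nonpos <;> nlinarith

lemma cos_four_pi_nonneg_iff {c y ω : ℝ} (hc : 0 < c) :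
    0 ≤ Real.cos (4 * Real.pi * (y - ω)) ↔ 0 ≤ ((c * ex y * ex (-ω)) ^ 2).re := by
  have h : (c * ex y * ex (-ω)) ^ 2 = ((c ^ 2 : ℝ) : ℂ) * ex (2 * (y - ω)) := by
    have : ex (2 * (y - ω)) = (ex y * ex (-ω)) ^ 2 := by
      rw [← ex_add, sq, ← ex_add]; congr 1; ring
    rw [this]; push_cast; ring
  rw [h, Complex.re_ofReal_mul, ex_re, mul_nonneg_iff_of_pos_left (by positivity)]
  have : 2 * Real.pi * (2 * (y - ω)) = 4 * Real.pi * (y - ω) := by ring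
  rw [this]

/-- Under a non-resonance condition on the rotation number, the constant part cannot be
hyperbolic relatively to the size of the perturbation. -/
lemma not_hyperbolic {A B : ℝ → Matrix (Fin 2) (Fin 2) ℝ} {α ρ : ℝ} {m : ℤ}
    (hA : ∀ x, (A x).det = 1) (hρ : IsFiberedRotNum α A ρ)
    (hNR : ∀ k l : ℤ, 2 * ρ - k * α - l ≠ 0) (hB : HasDeg B m) {x₀ y₀ g : ℝ} {β : ℂ}
    {a b : ℝ → ℂ} (ha : Continuous a) (hb : Continuous b) (hab : ∀ x, ‖a x‖ + ‖b x‖ ≤ g)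
    (hAB : ∀ x, A x * B x = B (x + α) * cmat (x₀ + Complex.I * y₀ + a x) (β + b x))
    (hx : 1 / 4 ≤ |x₀|) (hsmall : |y₀| + ‖β‖ + g ≤ 1 / 100) (hβ : |y₀| + 2 * g ≤ ‖β‖) : False := by
  have hg : 0 ≤ g := le_trans (by positivity) (hab 0)
  have hy0 := abs_nonneg y₀
  have hβ0 := norm_nonneg β
  obtain ⟨s, j, hs, hsx, hj⟩ : ∃ (s : ℝ) (j : ℤ), s ^ 2 = 1 ∧ x₀ = s * |x₀| ∧ (s : ℂ) = ex (j / 2) := by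
    rcases abs_cases x₀ with ⟨h, _⟩ | ⟨h, _⟩
    · exact ⟨1, 0, by norm_num, by rw [h, one_mul], by simp [ex_zero]⟩
    · exact ⟨-1, 1, by norm_num, by rw [h]; ring, by push_cast; rw [ex_half]⟩
  have hss : (s : ℂ) * s = 1 := by
    have : s * s = 1 := by rw [← sq]; exact hs
    exact_mod_cast this
  obtain ⟨H, hHc, hHa, hHn⟩ := exists_lift_near (r := |x₀|) (θ := j / 2) (c := 1 / 100)
    (a := fun x => Complex.I * y₀ + a x) (b := fun x => β + b x)
    (by fun_prop) (by fun_prop) (by linarith) (by linarith) (fun x => by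
      have h1 := norm_add_le (Complex.I * y₀) (a x)
      have h2 := norm_add_le β (b x)
      rw [norm_mul, Complex.norm_I, one_mul, Complex.norm_real, Real.norm_eq_abs] at h1
      have := hab x
      linarith)
  have hD : ∀ x, cmat (|x₀| * ex (j / 2) + (Complex.I * y₀ + a x)) (β + b x) =
      cmat (x₀ + Complex.I * y₀ + a x) (β + b x) := fun x => by
    congr 1
    rw [← hj, add_assoc]
    congr 1
    rw [mul_comm]; exact_mod_cast hsx.symm
  simp only [hD] at hHa
  obtain ⟨ω, hω⟩ := exists_eq_norm_mul_ex (s * β)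
  have hnsb : ‖(s : ℂ) * β‖ = ‖β‖ := by
    have h1 : ‖(s : ℂ)‖ = 1 := by rw [hj, norm_ex]
    rw [norm_mul, h1, one_mul]
  rw [hnsb] at hω
  have hβω : β = s * (‖β‖ * ex ω) := by
    rw [← hω, ← mul_assoc, hss, one_mul]
  refine (exists_rot_eq_of_cone hA hρ hB hAB hHc hHa (ω := ω / 2) (j := j) ?_ ?_).elim
    fun l hl => hNR m l hl
  · intro x y h
    obtain ⟨c, hc, hcv⟩ := actsAs_cmat.1 (hHa x y)
    rw [cos_four_pi_nonneg_iff one_pos] at h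
    rw [cos_four_pi_nonneg_iff hc, ← hcv]
    set ζ := ex y * ex (-(ω / 2))
    have h' : 0 ≤ (ζ ^ 2).re := by simpa [ζ] using h
    have hn : ‖ζ‖ = 1 := by simp [ζ, norm_ex]
    set e := s * ((a x * ex y + b x * conj (ex y)) * ex (-(ω / 2)))
    have he : ‖e‖ ≤ g := by
      have h1 : ‖(s : ℂ)‖ = 1 := by rw [hj, norm_ex]
      simp only [e]
      rw [norm_mul, h1, one_mul, norm_mul, norm_ex, mul_one]
      refine (norm_add_le _ _).trans ?_
      rw [norm_mul, norm_mul, Complex.norm_conj, norm_ex, mul_one, mul_one]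
      exact hab x
    have hys : |s * y₀| = |y₀| := by
      have h1 : |s| = 1 := by
        have := sq_abs s
        rw [hs] at this
        exact (pow_eq_one_iff_of_nonneg (abs_nonneg s) two_ne_zero).1 this
      rw [abs_mul, h1, one_mul]
    have key := re_sq_nonneg_of_re_sq_nonneg (x := |x₀|) (y := s * y₀) (b := ‖β‖) (g := g)
      (ζ := ζ) (e := e) (by linarith) (by rw [hys]; exact hβ) hn he h'
    have hx0 : (x₀ : ℂ) = s * (|x₀| : ℝ) := by exact_mod_cast hsx
    have hcz : conj ζ = ex ω * (conj (ex y) * ex (-(ω / 2))) := by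
      simp only [ζ]
      rw [map_mul, conj_ex, conj_ex, neg_neg, ← ex_add, ← ex_add, ← ex_add]
      congr 1; ring
    have heq : ((x₀ + Complex.I * y₀ + a x) * ex y + (β + b x) * conj (ex y)) * ex (-(ω / 2)) =
        s * ((|x₀| : ℝ) * ζ + Complex.I * ((s * y₀ : ℝ) : ℂ) * ζ + ‖β‖ * conj ζ + e) := by
      rw [hcz]
      nth_rewrite 1 [hβω]
      simp only [e, ζ]
      rw [hx0]
      push_cast
      linear_combination (-Complex.I * y₀ * ex y * ex (-(ω / 2)) -
        (a x * ex y + b x * conj (ex y)) * ex (-(ω / 2))) * hss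
    rw [heq, mul_pow, sq (s : ℂ), hss, one_mul]
    exact key
  · intro x y
    refine (hHn x y).trans_lt ?_
    rw [div_lt_iff₀ (by linarith)]
    linarith

end Hyperbolic

lemma contDiff_matrix_mul {k : WithTop ℕ∞} {A B : ℝ → Matrix (Fin 2) (Fin 2) ℝ}
    (hA : ContDiff ℝ k A) (hB : ContDiff ℝ k B) : ContDiff ℝ k (fun x => A x * B x) := by
  have h : ∀ {C : ℝ → Matrix (Fin 2) (Fin 2) ℝ}, ContDiff ℝ k C → ∀ i j,
      ContDiff ℝ k fun x => C x i j := fun hC i j => contDiff_pi.1 (contDiff_pi.1 hC i) j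
  refine contDiff_pi.2 fun i => contDiff_pi.2 fun j => ?_
  simp only [Matrix.mul_apply, Fin.sum_univ_two]
  exact ((h hA i 0).mul (h hB 0 j)).add ((h hA i 1).mul (h hB 1 j))

/-- All the polynomially weighted norms of a pair are finite. -/
def Rapid2 (P : PS) : Prop := ∀ r : ℕ, nrm2 (wt 1 r) P ≠ ∞

lemma Rapid2.fst {P : PS} (h : Rapid2 P) : Rapid P.1 := fun r => fst_ne_top (h r)

lemma Rapid2.snd {P : PS} (h : Rapid2 P) : Rapid P.2 := fun r => snd_ne_top (h r)

lemma Rapid2.one {P : PS} (h : Rapid2 P) : nrm2 1 P ≠ ∞ := by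
  have := h 0
  rwa [wt_zero] at this

lemma Rapid2.contDiff_evm {P : PS} (h : Rapid2 P) : ContDiff ℝ (⊤ : ℕ∞) (evm P) :=
  contDiff_cmat h.fst.contDiff_ev h.snd.contDiff_ev

lemma Rapid2.continuous_fst {P : PS} (h : Rapid2 P) : Continuous (ev P.1) :=
  h.fst.contDiff_ev.continuous

lemma Rapid2.continuous_snd {P : PS} (h : Rapid2 P) : Continuous (ev P.2) :=
  h.snd.contDiff_ev.continuous

lemma rapid2_of_low {P : PS} {M : ℝ} (hP : nrm2 1 P ≠ ∞)
    (h1 : ∀ k : ℤ, M < |(k : ℝ)| → P.1 k = 0) (h2 : ∀ k : ℤ, M < |(k : ℝ)| → P.2 k = 0) :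
    Rapid2 P := fun r => by
  refine ne_top_of_le_ne_top (ENNReal.mul_ne_top ENNReal.ofReal_ne_top hP)
    (nrm2_le_of_low (C := ENNReal.ofReal ((1 + M / 1) ^ r)) h1 h2 fun k hk => ?_)
  rw [Pi.one_apply, mul_one]
  exact wt_le_of_abs_le one_pos r hk

lemma norm_ev_add_norm_ev_le {P : PS} {c : ℝ} (hc : 0 ≤ c) (h : nrm2 1 P ≤ ENNReal.ofReal c)
    (x : ℝ) : ‖ev P.1 x‖ + ‖ev P.2 x‖ ≤ c := by
  have h1 := (add_le_add (enorm_ev_le (c := P.1) x) (enorm_ev_le (c := P.2) x)).trans h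
  rw [← ofReal_norm, ← ofReal_norm, ← ENNReal.ofReal_add (norm_nonneg _) (norm_nonneg _)] at h1
  exact (ENNReal.ofReal_le_ofReal_iff hc).1 h1

lemma evm_add_one (P : PS) (x : ℝ) : evm P (x + 1) = evm P x := by
  rw [evm, evm, ev_add_one, ev_add_one]

lemma one_add_evm (P : PS) (x : ℝ) : 1 + evm P x = cmat (1 + ev P.1 x) (ev P.2 x) := by
  rw [← cmat_one, evm, cmat_add, zero_add]

lemma cmat_add_evm (lam : ℂ) (P : PS) (x : ℝ) :
    cmat lam 0 + evm P x = cmat (lam + ev P.1 x) (ev P.2 x) := by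
  rw [evm, cmat_add, zero_add]

lemma norm_lt_re_one_add {a b : ℂ} (h : ‖a‖ + ‖b‖ ≤ 1 / 2) : ‖b‖ < (1 + a).re := by
  have := (abs_le.1 (Complex.abs_re_le_norm a)).1
  rw [Complex.add_re, Complex.one_re]
  linarith

lemma det_one_add_evm_pos {P : PS} (h : nrm2 1 P ≤ ENNReal.ofReal (1 / 2)) (x : ℝ) :
    0 < (1 + evm P x).det := by
  have h1 := norm_lt_re_one_add (norm_ev_add_norm_ev_le (by norm_num) h x)
  rw [one_add_evm, det_cmat]
  have h2 := Complex.re_le_norm (1 + ev P.1 x)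
  have h3 := norm_nonneg (ev P.2 x)
  nlinarith

lemma hasDeg_one_add_evm {P : PS} (hP : Rapid2 P) (h : nrm2 1 P ≤ ENNReal.ofReal (1 / 2)) :
    HasDeg (fun x => 1 + evm P x) 0 := by
  simp only [one_add_evm]
  exact hasDeg_cmat (continuous_const.add hP.continuous_fst) hP.continuous_snd
    fun x => norm_lt_re_one_add (norm_ev_add_norm_ev_le (by norm_num) h x)

/-- A conjugacy of the cocycle `(α, A)` to a perturbation of a constant conformal matrix, at the
scale `n`. -/
structure Good (α : ℝ) (A : ℝ → Matrix (Fin 2) (Fin 2) ℝ) (n : ℝ)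
    (B : ℝ → Matrix (Fin 2) (Fin 2) ℝ) (lam : ℂ) (F : PS) (m : ℤ) : Prop where
  smooth : ContDiff ℝ (⊤ : ℕ∞) B
  per : ∀ x, B (x + 2) = B x
  det : ∀ x, 0 < (B x).det
  deg : HasDeg B m
  deg_le : |(m : ℝ)| ≤ n ^ 5
  rapid : Rapid2 F
  small : nrm2 (wt (n ^ 4) 100) F ≤ ENNReal.ofReal (n ^ 40)⁻¹
  eqn : ∀ x, A x * B x = B (x + α) * (cmat lam 0 + evm F x)

section Steps

variable {α n : ℝ} {A B : ℝ → Matrix (Fin 2) (Fin 2) ℝ} {lam : ℂ} {F : PS} {m : ℤ}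

lemma Good.nrm2_one_le (g : Good α A n B lam F m) (hn : 2 ^ 20 ≤ n) :
    nrm2 1 F ≤ ENNReal.ofReal (n ^ 40)⁻¹ :=
  (QPCocycle.nrm2_one_le (isWeight_wt (by positivity) _)).trans g.small

lemma inv_pow_le_of_scale (hn : 2 ^ 20 ≤ n) {k : ℕ} (hk : 1 ≤ k) : (n ^ k)⁻¹ ≤ 1 / 2 ^ 20 := by
  rw [one_div]
  refine inv_anti₀ (by positivity) (hn.trans ?_)
  exact le_self_pow₀ (by linarith) (by omega)

lemma Good.norm_lam (g : Good α A n B lam F m) (hA : ∀ x, (A x).det = 1) (hn : 2 ^ 20 ≤ n) :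
    1 / 2 ≤ ‖lam‖ ∧ ‖lam‖ ≤ 2 := by
  have h1 := inv_pow_le_of_scale hn (k := 40) (by norm_num)
  obtain ⟨h2, h3⟩ := norm_bounds_of_conj hA g.smooth.continuous g.per g.det
    (fun x => norm_ev_add_norm_ev_le (by positivity) (g.nrm2_one_le hn) x)
    (fun x => by rw [g.eqn, cmat_add_evm])
  constructor <;> norm_num at h1 ⊢ <;> linarith

/-- The frequencies of the conformal part which are eliminated. -/
def lowModes (n : ℝ) : Set ℤ := {k | k ≠ 0 ∧ |(k : ℝ)| ≤ n ^ 5}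

lemma enorm_inv_le {z : ℂ} {c : ℝ} (hc : 0 < c) (h : c⁻¹ ≤ ‖z‖) :
    ‖z⁻¹‖ₑ ≤ ENNReal.ofReal c ∧ z ≠ 0 := by
  have hz : 0 < ‖z‖ := lt_of_lt_of_le (by positivity) h
  refine ⟨?_, norm_pos_iff.1 hz⟩
  rw [← ofReal_norm, norm_inv]
  exact ENNReal.ofReal_le_ofReal (inv_le_of_inv_le₀ hc h)

lemma norm_ex_sub_one_ge {η : ℝ} (hn : 2 ^ 20 ≤ n) (hη : 1 ≤ n * η)
    (hα : ∀ k : ℤ, k ≠ 0 → 4 * η ^ 2 / (k : ℝ) ^ 2 ≤ ‖ex (k * α) - 1‖) {k : ℤ} (hk : k ≠ 0)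
    (hkn : |(k : ℝ)| ≤ 2 * n ^ 5) : (n ^ 12)⁻¹ ≤ ‖ex (k * α) - 1‖ := by
  have hn0 : 0 < n := by linarith
  refine le_trans ?_ (hα k hk)
  have hk0 : 0 < (k : ℝ) ^ 2 := by have : (k : ℝ) ≠ 0 := by exact_mod_cast hk
                                   positivity
  have hk2 : (k : ℝ) ^ 2 ≤ (2 * n ^ 5) ^ 2 := by rw [← sq_abs]; gcongr
  rw [inv_eq_one_div, div_le_div_iff₀ (by positivity) hk0]
  have h1 : 1 ≤ (n * η) ^ 2 := one_le_pow₀ hη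
  calc 1 * (k : ℝ) ^ 2 ≤ (2 * n ^ 5) ^ 2 := by linarith
    _ = 4 * n ^ 10 * 1 := by ring
    _ ≤ 4 * n ^ 10 * (n * η) ^ 2 := by gcongr
    _ = _ := by ring

lemma Good.exists_elim {η : ℝ} (g : Good α A n B lam F m) (hA : ∀ x, (A x).det = 1)
    (hn : 2 ^ 20 ≤ n) (hη : 1 ≤ n * η)
    (hα : ∀ k : ℤ, k ≠ 0 → 4 * η ^ 2 / (k : ℝ) ^ 2 ≤ ‖ex (k * α) - 1‖) (s : Set ℤ)
    (hs : ∀ k ∈ s, |(k : ℝ)| ≤ n ^ 5 ∧ (n ^ 16)⁻¹ ≤ ‖conj lam * ex (k * α) - lam‖) :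
    ∃ X E : PS, (∀ k : ℤ, n ^ 5 < |(k : ℝ)| → X.1 k = 0) ∧ (∀ k : ℤ, n ^ 5 < |(k : ℝ)| → X.2 k = 0) ∧
      (∀ k ∈ lowModes n, E.1 k = 0) ∧ (∀ k ∈ s, E.2 k = 0) ∧
      nrm2 1 X ≤ 3 * (ENNReal.ofReal (n ^ 16) * nrm2 1 F) ∧ nrm2 1 X ≤ ENNReal.ofReal (n ^ 20)⁻¹ ∧
      nrm2 (wt (n ^ 4) 100) E ≤ 2 * ENNReal.ofReal (n ^ 40)⁻¹ ∧ Rapid2 X ∧ Rapid2 E ∧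
      (ContDiff ℝ (⊤ : ℕ∞) (fun x => B x * (1 + evm X x)) ∧
        (∀ x, B (x + 2) * (1 + evm X (x + 2)) = B x * (1 + evm X x)) ∧
        (∀ x, 0 < (B x * (1 + evm X x)).det) ∧ HasDeg (fun x => B x * (1 + evm X x)) m ∧
        ∀ x, A x * (B x * (1 + evm X x)) =
          (B (x + α) * (1 + evm X (x + α))) * (cmat lam 0 + evm E x)) ∧
      (∀ r : ℕ, 2 * (2 ^ r * nrm2 1 X) ≤ 1 →
        nrm2 (wt (n ^ 6) r) E ≤ 3 * nrm2 (wt (n ^ 4) r) F) ∧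
      nrm2 1 (E - keep (lowModes n) s * F) ≤
        12 * (ENNReal.ofReal (n ^ 16) * nrm2 1 F) * nrm2 1 F := by
  have hn0 : 0 < n := by linarith
  have hn1 : 1 ≤ n := by linarith
  obtain ⟨hl1, hl2⟩ := g.norm_lam hA hn
  have hdiv1 : ∀ k ∈ lowModes n, ‖((divisor α lam).1 k)⁻¹‖ₑ ≤ ENNReal.ofReal (n ^ 16) ∧
      (divisor α lam).1 k ≠ 0 := fun k hk => by
    refine enorm_inv_le (by positivity) ?_
    have h1 := norm_ex_sub_one_ge hn hη hα hk.1 (hk.2.trans (by linarith [pow_pos hn0 5]))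
    have h2 : (divisor α lam).1 k = lam * (ex (k * α) - 1) := by simp [divisor, mul_sub]
    rw [h2, norm_mul]
    calc (n ^ 16)⁻¹ = (n ^ 4)⁻¹ * (n ^ 12)⁻¹ := by rw [← mul_inv, ← pow_add]
      _ ≤ 1 / 2 * (n ^ 12)⁻¹ := by
          gcongr
          exact (inv_pow_le_of_scale hn (k := 4) (by norm_num)).trans (by norm_num)
      _ ≤ _ := by gcongr
  have hdiv2 : ∀ k ∈ s, ‖((divisor α lam).2 k)⁻¹‖ₑ ≤ ENNReal.ofReal (n ^ 16) ∧
      (divisor α lam).2 k ≠ 0 := fun k hk => enorm_inv_le (by positivity) (hs k hk).2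
  have hX24 : n ^ 16 * (2 * (n ^ 40)⁻¹) ≤ (n ^ 20)⁻¹ := by
    have : n ^ 16 * (2 * (n ^ 40)⁻¹) = 2 * (n ^ 4)⁻¹ * (n ^ 20)⁻¹ := by field_simp
    rw [this]
    have := inv_pow_le_of_scale hn (k := 4) (by norm_num)
    have h0 : 0 < (n ^ 20)⁻¹ := by positivity
    nlinarith
  have h20 := inv_pow_le_of_scale hn (k := 20) (by norm_num)
  obtain ⟨X, E, hX1, hX2, hE1, hE2, hXn, hEn, heq, hap⟩ :=
    exists_elimination (w := wt (n ^ 4) 100) (isWeight_wt (by positivity) _)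
    (K := ENNReal.ofReal (n ^ 16)) (ε := ENNReal.ofReal (n ^ 40)⁻¹) ENNReal.ofReal_ne_top
    ENNReal.ofReal_ne_top g.small (by
      rw [← ENNReal.ofReal_mul (by positivity), ← ENNReal.ofReal_ofNat,
        ← ENNReal.ofReal_mul (by positivity), ← ENNReal.ofReal_one]
      refine ENNReal.ofReal_le_ofReal ?_
      linarith) (lowModes n) s hdiv1 hdiv2
  have hX1' : ∀ k : ℤ, n ^ 5 < |(k : ℝ)| → X.1 k = 0 := fun k hk =>
    hX1 k fun h => absurd h.2 (not_le.2 hk)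
  have hX2' : ∀ k : ℤ, n ^ 5 < |(k : ℝ)| → X.2 k = 0 := fun k hk =>
    hX2 k fun h => absurd (hs k h).1 (not_le.2 hk)
  have hXs : nrm2 1 X ≤ ENNReal.ofReal (n ^ 20)⁻¹ := by
    refine (QPCocycle.nrm2_one_le (isWeight_wt (by positivity) _)).trans (hXn.trans ?_)
    rw [← ENNReal.ofReal_ofNat, ← ENNReal.ofReal_mul (by positivity),
      ← ENNReal.ofReal_mul (by positivity)]
    exact ENNReal.ofReal_le_ofReal hX24
  have hXhalf : nrm2 1 X ≤ ENNReal.ofReal (1 / 2) :=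
    hXs.trans (ENNReal.ofReal_le_ofReal (by norm_num at h20 ⊢; linarith))
  have hXr : Rapid2 X := rapid2_of_low (ne_top_of_le_ne_top ENNReal.ofReal_ne_top hXs) hX1' hX2'
  have hap1 := hap 1 isWeight_one (by simp) (by
    refine (mul_le_mul_right hXhalf 2).trans ?_
    rw [← ENNReal.ofReal_ofNat, ← ENNReal.ofReal_mul (by positivity)]
    norm_num)
  have hlow : ∀ (N : ℝ), 0 < N → ∀ r : ℕ,
      nrm2 (wt N r) X ≤ ENNReal.ofReal ((1 + n ^ 5 / N) ^ r) * nrm2 1 X := fun N hN r =>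
    nrm2_le_of_low hX1' hX2' fun k hk => by
      rw [Pi.one_apply, mul_one]; exact wt_le_of_abs_le hN r hk
  refine ⟨X, E, hX1', hX2', hE1, hE2, hap1.1, hXs, hEn, hXr, fun r => ?_, ⟨?_, fun x => ?_,
    fun x => ?_, ?_, fun x => ?_⟩, fun r hr => ?_, hap1.2.2⟩
  · set N : ℝ := n ^ 5 * (r + 1)
    have hN1 : 1 ≤ N := by
      have : 1 ≤ n ^ 5 := one_le_pow₀ hn1
      have hr : (0 : ℝ) ≤ r := by positivity
      simp only [N]; nlinarith
    have hN0 : 0 < N := by linarith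
    have h1 : (1 + n ^ 5 / N) ^ r ≤ 4 := by
      have e1 : n ^ 5 / N = 1 / (r + 1 : ℝ) := by simp only [N]; field_simp
      rw [e1]
      have e2 : (1 + 1 / (r + 1 : ℝ)) ^ r ≤ Real.exp (1 / (r + 1 : ℝ)) ^ r := by
        gcongr
        rw [add_comm]; exact Real.add_one_le_exp _
      refine e2.trans ?_
      rw [← Real.exp_nat_mul]
      refine (Real.exp_le_exp.2 (?_ : (r : ℝ) * (1 / (r + 1)) ≤ 1)).trans
        (Real.exp_one_lt_d9.le.trans (by norm_num))
      rw [mul_one_div, div_le_one (by positivity)]; linarith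
    have h2 : 2 * nrm2 (wt N r) X ≤ 1 := by
      calc 2 * nrm2 (wt N r) X ≤ 2 * (ENNReal.ofReal 4 * ENNReal.ofReal (n ^ 20)⁻¹) := by
            gcongr
            refine (hlow N hN0 r).trans ?_
            gcongr
        _ ≤ 1 := by
            rw [← ENNReal.ofReal_mul (by positivity), ← ENNReal.ofReal_ofNat,
              ← ENNReal.ofReal_mul (by positivity), ← ENNReal.ofReal_one]
            refine ENNReal.ofReal_le_ofReal ?_
            norm_num at h20 ⊢; linarith
    have h3 := (hap (wt N r) (isWeight_wt hN0 r) (wt_ne_top N r) h2).2.1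
    have h4 : nrm2 (wt N r) F ≠ ∞ :=
      ne_top_of_le_ne_top (g.rapid r) (nrm2_mono fun k => wt_anti one_pos hN1 r k)
    have h5 : nrm2 (wt 1 r) E ≤ ENNReal.ofReal (N ^ r) * nrm2 (wt N r) E := by
      rw [nrm2, nrm2, mul_add]
      refine add_le_add (nrm_le_mul fun k => ?_) (nrm_le_mul fun k => ?_) <;>
      · rw [← mul_assoc]; gcongr; exact wt_one_le hN1 r k
    refine ne_top_of_le_ne_top (ENNReal.mul_ne_top ENNReal.ofReal_ne_top ?_) h5
    exact ne_top_of_le_ne_top (ENNReal.mul_ne_top (by norm_num) h4) h3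
  · simp only [one_add_evm]
    refine contDiff_matrix_mul g.smooth ?_
    exact contDiff_cmat (contDiff_const.add hXr.fst.contDiff_ev) hXr.snd.contDiff_ev
  · have : x + 2 = x + 1 + 1 := by ring
    rw [g.per, this, evm_add_one, evm_add_one]
  · rw [det_mul]
    exact mul_pos (g.det x) (det_one_add_evm_pos hXhalf x)
  · have := g.deg.mul (hasDeg_one_add_evm hXr hXhalf)
    rwa [add_zero] at this
  · rw [← mul_assoc, g.eqn, mul_assoc, heq, mul_assoc]
  · have h1 : nrm2 (wt (n ^ 6) r) X ≤ 2 ^ r * nrm2 1 X := by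
      refine (hlow (n ^ 6) (by positivity) r).trans ?_
      gcongr
      rw [← ENNReal.ofReal_ofNat, ← ENNReal.ofReal_pow (by positivity)]
      refine ENNReal.ofReal_le_ofReal ?_
      gcongr
      have : n ^ 5 / n ^ 6 ≤ 1 := by
        rw [div_le_one (by positivity)]
        exact pow_le_pow_right₀ hn1 (by norm_num)
      linarith
    have h2 := (hap (wt (n ^ 6) r) (isWeight_wt (by positivity) r) (wt_ne_top _ r)
      ((mul_le_mul_right h1 2).trans hr)).2.1
    refine h2.trans ?_
    gcongr
    exact nrm2_mono fun k => wt_anti (by positivity) (pow_le_pow_right₀ hn1 (by norm_num)) r k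

end Steps

section Single

lemma ev_single (k : ℤ) (a : ℂ) (x : ℝ) : ev (Pi.single k a) x = a * ex (k * x) := by
  rw [ev, tsum_eq_single k]
  · simp
  · intro l hl; simp [hl]

lemma nrm_single (w : ℤ → ℝ≥0∞) (k : ℤ) (a : ℂ) : nrm w (Pi.single k a) = w k * ‖a‖ₑ := by
  rw [nrm, tsum_eq_single k]
  · simp
  · intro l hl; simp [hl]

/-- The coefficients of a constant matrix. -/
noncomputable def cpair (a b : ℂ) : PS := (Pi.single 0 a, Pi.single 0 b)

lemma evm_cpair (a b : ℂ) (x : ℝ) : evm (cpair a b) x = cmat a b := by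
  simp [evm, cpair, ev_single, ex_zero]

lemma nrm2_cpair (N : ℝ) (S : ℕ) (a b : ℂ) :
    nrm2 (wt N S) (cpair a b) = ENNReal.ofReal (‖a‖ + ‖b‖) := by
  rw [nrm2, cpair, nrm_single, nrm_single, ENNReal.ofReal_add (norm_nonneg _) (norm_nonneg _)]
  simp [wt]

lemma rapid2_cpair (a b : ℂ) : Rapid2 (cpair a b) := fun r => by
  rw [nrm2_cpair]; exact ENNReal.ofReal_ne_top

lemma Rapid2.pmul {P Q : PS} (hP : Rapid2 P) (hQ : Rapid2 Q) : Rapid2 (pmul P Q) := fun r =>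
  nrm2_pmul_ne_top (isWeight_wt one_pos r) (hP r) (hQ r)

lemma Rapid2.add {P Q : PS} (hP : Rapid2 P) (hQ : Rapid2 Q) : Rapid2 (P + Q) := fun r =>
  nrm2_add_ne_top (hP r) (hQ r)

lemma Rapid2.keep {P : PS} (hP : Rapid2 P) (s t : Set ℤ) : Rapid2 (keep s t * P) := fun r =>
  ne_top_of_le_ne_top (hP r) (nrm2_keep_le s t P)

lemma nrm_shift_le {w : ℤ → ℝ≥0∞} (hw : IsWeight w) (c : ℤ → ℂ) (k : ℤ) :
    nrm w (fun l => c (l + k)) ≤ w k * nrm w c := by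
  rw [nrm, nrm, ← (Equiv.addRight k).tsum_eq (fun l => w l * ‖c l‖ₑ), ← ENNReal.tsum_mul_left]
  refine ENNReal.tsum_le_tsum fun l => ?_
  simp only [Equiv.coe_addRight]
  rw [← mul_assoc]
  gcongr
  have := hw.add_le (-k) (l + k)
  rwa [hw.neg, neg_add_cancel_comm_assoc] at this

lemma ev_shift_index (c : ℤ → ℂ) (k : ℤ) (x : ℝ) :
    ev (fun l => c (l + k)) x = ex (-(k * x)) * ev c x := by
  rw [ev, ev, ← (Equiv.addRight k).tsum_eq (fun l : ℤ => c l * ex (l * x)), ← tsum_mul_left]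
  refine tsum_congr fun l => ?_
  simp only [Equiv.coe_addRight]
  rw [mul_left_comm, ← ex_add]
  congr 2; push_cast; ring

lemma nrm_const_mul (w : ℤ → ℝ≥0∞) (a : ℂ) (c : ℤ → ℂ) :
    nrm w (fun k => a * c k) = ‖a‖ₑ * nrm w c := by
  simp only [nrm, enorm_mul, mul_left_comm _ ‖a‖ₑ, ENNReal.tsum_mul_left]

end Single

/-- The frequencies below the cut-off of the scale `n`. -/
def allLow (n : ℝ) : Set ℤ := {k | |(k : ℝ)| ≤ n ^ 5}

section Steps

variable {α n n' η : ℝ} {A B : ℝ → Matrix (Fin 2) (Fin 2) ℝ} {lam : ℂ} {F : PS} {m : ℤ}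

lemma tail_bound (hn : 2 ^ 20 ≤ n) :
    (4 / n) ^ 100 * (2 * (n ^ 40)⁻¹) ≤ ((n ^ 60)⁻¹ / 20) ^ 2 / 16 := by
  have hn0 : 0 < n := by linarith
  have h1 : (2 ^ 20 : ℝ) ^ 20 ≤ n ^ 20 := by gcongr
  have h2 : (4 : ℝ) ^ 100 * 2 * 6400 ≤ n ^ 20 := le_trans (by norm_num) h1
  have e1 : (4 / n) ^ 100 * (2 * (n ^ 40)⁻¹) = (4 ^ 100 * 2) / (n ^ 20 * n ^ 120) := by
    rw [div_pow]; field_simp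
  have e2 : ((n ^ 60)⁻¹ / 20) ^ 2 / 16 = 1 / (6400 * n ^ 120) := by field_simp; norm_num
  rw [e1, e2, div_le_div_iff₀ (by positivity) (by positivity)]
  calc 4 ^ 100 * 2 * (6400 * n ^ 120) = (4 ^ 100 * 2 * 6400) * n ^ 120 := by ring
    _ ≤ n ^ 20 * n ^ 120 := by gcongr
    _ = _ := by ring

/-- The high frequencies are small at the next scale. -/
lemma nrm2_high_le {P : PS} (hn : 2 ^ 20 ≤ n) (h1 : ∀ k : ℤ, |(k : ℝ)| ≤ n ^ 5 → P.1 k = 0)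
    (h2 : ∀ k : ℤ, |(k : ℝ)| ≤ n ^ 5 → P.2 k = 0)
    (hP : nrm2 (wt (n ^ 4) 100) P ≤ 2 * ENNReal.ofReal (n ^ 40)⁻¹) :
    2 ^ 100 * nrm2 (wt (n ^ 6) 100) P ≤ ENNReal.ofReal (((n ^ 60)⁻¹ / 20) ^ 2 / 16) := by
  have hn0 : 0 < n := by linarith
  have h3 : nrm2 (wt (n ^ 6) 100) P ≤ ENNReal.ofReal ((2 / n) ^ 100) * nrm2 (wt (n ^ 4) 100) P := by
    refine nrm2_le_of_high h1 h2 fun k hk => ?_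
    refine (wt_le_of_lt_abs (N := n ^ 4) (N' := n ^ 6) (M := n ^ 5) (by positivity) (by positivity)
      (by positivity) 100 hk).trans ?_
    gcongr
    have e1 : n ^ 4 / n ^ 5 = 1 / n := by field_simp
    have e2 : n ^ 4 / n ^ 6 ≤ 1 / n := by
      rw [div_le_div_iff₀ (by positivity) hn0]
      calc n ^ 4 * n = n ^ 5 := by ring
        _ ≤ n ^ 6 := pow_le_pow_right₀ (by linarith) (by norm_num)
        _ = _ := by ring
    have e3 : 2 / n = 1 / n + 1 / n := by ring
    rw [e3, e1]; linarith
  calc 2 ^ 100 * nrm2 (wt (n ^ 6) 100) P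
      ≤ 2 ^ 100 * (ENNReal.ofReal ((2 / n) ^ 100) * (2 * ENNReal.ofReal (n ^ 40)⁻¹)) := by
        gcongr; exact h3.trans (by gcongr)
    _ = ENNReal.ofReal ((4 / n) ^ 100 * (2 * (n ^ 40)⁻¹)) := by
        have e : (4 / n) ^ 100 * (2 * (n ^ 40)⁻¹) = 2 ^ 100 * ((2 / n) ^ 100 * (2 * (n ^ 40)⁻¹)) := by
          rw [← mul_assoc (2 ^ 100), ← mul_pow]; congr 2; ring
        have e2 : ENNReal.ofReal ((2 : ℝ) ^ 100) = 2 ^ 100 := by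
          rw [ENNReal.ofReal_pow (by norm_num), ENNReal.ofReal_ofNat]
        rw [e, ENNReal.ofReal_mul (by positivity), ENNReal.ofReal_mul (by positivity),
          ENNReal.ofReal_mul (by positivity), e2, ENNReal.ofReal_ofNat]
    _ ≤ _ := ENNReal.ofReal_le_ofReal (tail_bound hn)

lemma scale_pow (hn' : n' ^ 2 = n ^ 3) : n' ^ 4 = n ^ 6 ∧ n' ^ 40 = n ^ 60 := by
  constructor
  · calc n' ^ 4 = (n' ^ 2) ^ 2 := by ring
      _ = _ := by rw [hn']; ring
  · calc n' ^ 40 = (n' ^ 2) ^ 20 := by ring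
      _ = _ := by rw [hn']; ring

lemma two_mul_le_scale (hn : 2 ^ 20 ≤ n) (h0 : 0 < n') (hn' : n' ^ 2 = n ^ 3) : 2 * n ≤ n' := by
  refine le_of_sq_le_sq ?_ h0.le
  rw [hn']
  have h1 : 0 < n := by linarith
  have : 0 < n ^ 2 := by positivity
  nlinarith

lemma two_mul_pow_le_scale (hn : 2 ^ 20 ≤ n) (h0 : 0 < n') (hn' : n' ^ 2 = n ^ 3) :
    2 * n ^ 5 ≤ n' ^ 5 := by
  have hn0 : 0 < n := by linarith
  have h := two_mul_le_scale hn h0 hn'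
  calc 2 * n ^ 5 ≤ (2 * n) ^ 5 := by rw [mul_pow]; nlinarith [pow_pos hn0 5]
    _ ≤ _ := by gcongr

lemma keep_allLow_mul_fst (P : PS) {k : ℤ} (hk : |(k : ℝ)| ≤ n ^ 5) :
    (keep (allLow n) (allLow n) * P).1 k = 0 := by
  have : k ∈ allLow n := hk
  simp [keep, this]

lemma keep_allLow_mul_snd (P : PS) {k : ℤ} (hk : |(k : ℝ)| ≤ n ^ 5) :
    (keep (allLow n) (allLow n) * P).2 k = 0 := by
  have : k ∈ allLow n := hk
  simp [keep, this]

/-- One step of the iteration in the absence of resonances. -/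
lemma Good.exists_nonres (g : Good α A n B lam F m) (hA : ∀ x, (A x).det = 1)
    (hn : 2 ^ 20 ≤ n) (hη : 1 ≤ n * η) (h0 : 0 < n') (hn' : n' ^ 2 = n ^ 3)
    (hα : ∀ k : ℤ, k ≠ 0 → 4 * η ^ 2 / (k : ℝ) ^ 2 ≤ ‖ex (k * α) - 1‖)
    (hs : ∀ k : ℤ, |(k : ℝ)| ≤ n ^ 5 → (n ^ 16)⁻¹ ≤ ‖conj lam * ex (k * α) - lam‖) :
    ∃ (X : PS) (lam' : ℂ) (F' : PS), Good α A n' (fun x => B x * (1 + evm X x)) lam' F' m ∧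
      (∀ k : ℤ, n ^ 5 < |(k : ℝ)| → X.1 k = 0) ∧ (∀ k : ℤ, n ^ 5 < |(k : ℝ)| → X.2 k = 0) ∧
      nrm2 1 X ≤ 3 * (ENNReal.ofReal (n ^ 16) * nrm2 1 F) ∧ nrm2 1 X ≤ ENNReal.ofReal (n ^ 20)⁻¹ ∧
      ‖lam' - lam‖ ≤ 2 * (n ^ 40)⁻¹ ∧
      nrm2 1 F' ≤ nrm2 1 (keep (allLow n) (allLow n) * F) +
        12 * (ENNReal.ofReal (n ^ 16) * nrm2 1 F) * nrm2 1 F ∧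
      ∀ r : ℕ, 2 * (2 ^ r * nrm2 1 X) ≤ 1 →
        nrm2 (wt (n' ^ 4) r) F' ≤ 3 * nrm2 (wt (n ^ 4) r) F := by
  classical
  have hn0 : 0 < n := by linarith
  obtain ⟨X, E, hX1, hX2, hE1, hE2, hXF, hXs, hEn, -, hEr, ⟨c1, c2, c3, c4, c5⟩, hap, hrem⟩ :=
    g.exists_elim hA hn hη hα (allLow n) fun k hk => ⟨hk, hs k hk⟩
  obtain ⟨hp4, hp40⟩ := scale_pow hn'
  set F' := keep (allLow n) (allLow n) * E
  have hF'1 : ∀ k : ℤ, |(k : ℝ)| ≤ n ^ 5 → F'.1 k = 0 := fun k hk => keep_allLow_mul_fst E hk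
  have hF'2 : ∀ k : ℤ, |(k : ℝ)| ≤ n ^ 5 → F'.2 k = 0 := fun k hk => keep_allLow_mul_snd E hk
  have hsplit : E = cpair (E.1 0) 0 + F' := by
    refine Prod.ext (funext fun k => ?_) (funext fun k => ?_)
    · by_cases hk : k ∈ allLow n
      · by_cases hk0 : k = 0
        · subst hk0; simp [cpair, F', keep, hk]
        · simp [cpair, F', keep, hk, hk0, hE1 k ⟨hk0, hk⟩]
      · have hk0 : k ≠ 0 := fun h => hk (by rw [h]; simp [allLow]; positivity)
        simp [cpair, F', keep, hk, hk0]
    · by_cases hk : k ∈ allLow n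
      · simp [cpair, F', keep, hk, hE2 k hk]
      · simp [cpair, F', keep, hk]
  have hE0 : ‖E.1 0‖ ≤ 2 * (n ^ 40)⁻¹ := by
    have h1 : ‖E.1 0‖ₑ ≤ ENNReal.ofReal (2 * (n ^ 40)⁻¹) := by
      refine (le_nrm (isWeight_wt (N := n ^ 4) (by positivity) 100) 0).trans
        (le_trans le_self_add (hEn.trans (le_of_eq ?_)))
      rw [ENNReal.ofReal_mul (by positivity), ENNReal.ofReal_ofNat]
    rw [← ofReal_norm] at h1
    exact (ENNReal.ofReal_le_ofReal_iff (by positivity)).1 h1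
  refine ⟨X, lam + E.1 0, F', ⟨c1, c2, c3, c4, ?_, hEr.keep _ _, ?_, fun x => ?_⟩, hX1, hX2, hXF, hXs,
    by rwa [add_sub_cancel_left], ?_, fun r hr => ?_⟩
  · have := two_mul_pow_le_scale hn h0 hn'
    have := pow_pos hn0 5
    linarith [g.deg_le]
  · rw [hp4, hp40]
    have h1 := nrm2_high_le hn hF'1 hF'2 ((nrm2_keep_le _ _ _).trans hEn)
    refine le_trans ?_ (h1.trans (ENNReal.ofReal_le_ofReal ?_))
    · exact le_mul_of_one_le_left zero_le (one_le_pow₀ (by norm_num))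
    · have h2 := inv_pow_le_of_scale hn (k := 60) (by norm_num)
      have h3 : 0 < (n ^ 60)⁻¹ := by positivity
      norm_num at h2 ⊢
      nlinarith
  · rw [c5]
    congr 1
    conv_lhs => rw [hsplit]
    rw [evm_add (rapid2_cpair _ _).one (hEr.keep _ _).one, evm_cpair, ← add_assoc, cmat_add,
      add_zero]
  · have hk : F' = keep (allLow n) (allLow n) * F +
        keep (allLow n) (allLow n) * (E - keep (lowModes n) (allLow n) * F) := by
      rw [mul_sub, ← mul_assoc]
      have : keep (allLow n) (allLow n) * keep (lowModes n) (allLow n) =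
          keep (allLow n) (allLow n) := by
        refine Prod.ext (funext fun k => ?_) (funext fun k => ?_)
        · by_cases hk : k ∈ allLow n
          · simp [keep, hk]
          · have : k ∉ lowModes n := fun h => hk h.2
            simp [keep, this]
        · simp [keep]
      rw [this]; simp [F']
    rw [hk]
    exact nrm2_add_le.trans (add_le_add le_rfl ((nrm2_keep_le _ _ _).trans hrem))
  · rw [hp4]
    exact (nrm2_keep_le _ _ _).trans (hap r hr)

end Steps

section Resonant

variable {α n n' η : ℝ} {A B : ℝ → Matrix (Fin 2) (Fin 2) ℝ} {lam : ℂ} {F : PS} {m : ℤ}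

lemma abs_im_le_of_resonance {z : ℂ} {k : ℤ} {c : ℝ} (h : ‖conj z * ex (k * α) - z‖ ≤ c) :
    |(ex (-(k * α / 2)) * z).im| ≤ c / 2 := by
  have e1 : ex (-(k * α / 2)) * (conj z * ex (k * α) - z) =
      conj (ex (-(k * α / 2)) * z) - ex (-(k * α / 2)) * z := by
    rw [map_mul, conj_ex, mul_sub, mul_left_comm, ← ex_add, mul_comm (conj z)]
    congr 3; ring
  have e2 : ‖ex (-(k * α / 2)) * (conj z * ex (k * α) - z)‖ =
      2 * |(ex (-(k * α / 2)) * z).im| := by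
    rw [e1, norm_sub_rev, Complex.sub_conj, norm_mul, Complex.norm_I, Complex.norm_real, mul_one,
      Real.norm_eq_abs, abs_mul, abs_two]
  rw [norm_mul, norm_ex, one_mul] at e2
  linarith

lemma norm_le_of_nrm2_le {w : ℤ → ℝ≥0∞} (hw : IsWeight w) {P : PS} {c : ℝ} (hc : 0 ≤ c)
    (h : nrm2 w P ≤ ENNReal.ofReal c) (k : ℤ) : ‖P.1 k‖ ≤ c ∧ ‖P.2 k‖ ≤ c := by
  constructor
  · have h1 : ‖P.1 k‖ₑ ≤ ENNReal.ofReal c := (le_nrm hw k).trans (le_self_add.trans h)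
    rw [← ofReal_norm] at h1
    exact (ENNReal.ofReal_le_ofReal_iff hc).1 h1
  · have h1 : ‖P.2 k‖ₑ ≤ ENNReal.ofReal c := (le_nrm hw k).trans (le_add_self.trans h)
    rw [← ofReal_norm] at h1
    exact (ENNReal.ofReal_le_ofReal_iff hc).1 h1

/-- Elimination of all but one Fourier mode, followed by a rotation which moves the remaining mode
to the frequency zero. -/
lemma Good.exists_rotated (g : Good α A n B lam F m) (hA : ∀ x, (A x).det = 1)
    (hn : 2 ^ 20 ≤ n) (hη : 1 ≤ n * η)
    (hα : ∀ k : ℤ, k ≠ 0 → 4 * η ^ 2 / (k : ℝ) ^ 2 ≤ ‖ex (k * α) - 1‖)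
    {k : ℤ} (hk : |(k : ℝ)| ≤ n ^ 5) (hs : ‖conj lam * ex (k * α) - lam‖ < (n ^ 16)⁻¹) :
    ∃ (B' : ℝ → Matrix (Fin 2) (Fin 2) ℝ) (μ β : ℂ) (G : PS),
      ContDiff ℝ (⊤ : ℕ∞) B' ∧ (∀ x, B' (x + 2) = B' x) ∧ (∀ x, 0 < (B' x).det) ∧
      HasDeg B' (m + k) ∧ Rapid2 G ∧
      nrm2 (wt (n ^ 6) 100) G ≤ ENNReal.ofReal (((n ^ 60)⁻¹ / 20) ^ 2 / 16) ∧
      (∀ x, A x * B' x = B' (x + α) * cmat (μ + ev G.1 x) (β + ev G.2 x)) ∧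
      |μ.im| ≤ 1 / 1000 ∧ ‖β‖ ≤ 1 / 1000 ∧ 1 / 4 ≤ |μ.re| := by
  classical
  have hn0 : 0 < n := by linarith
  obtain ⟨hl1, hl2⟩ := g.norm_lam hA hn
  have hres : ∀ k' ∈ allLow n \ {k}, |(k' : ℝ)| ≤ n ^ 5 ∧
      (n ^ 16)⁻¹ ≤ ‖conj lam * ex (k' * α) - lam‖ := fun k' hk' => by
    refine ⟨hk'.1, ?_⟩
    by_contra! hlt
    have h0 : k' - k ≠ 0 := sub_ne_zero.2 hk'.2
    have h1 := norm_ex_sub_one_ge hn hη hα h0 (by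
      push_cast
      have := abs_sub (k' : ℝ) k
      have h2 : |(k' : ℝ)| ≤ n ^ 5 := hk'.1
      linarith)
    have e : conj lam * ex (k' * α) - conj lam * ex (k * α) =
        conj lam * ex (k * α) * (ex ((k' - k : ℤ) * α) - 1) := by
      rw [mul_sub, mul_assoc, ← ex_add]
      push_cast; ring_nf
    have h3 : ‖conj lam * ex (k' * α) - conj lam * ex (k * α)‖ < 2 * (n ^ 16)⁻¹ := by
      have : conj lam * ex (k' * α) - conj lam * ex (k * α) =
        (conj lam * ex (k' * α) - lam) - (conj lam * ex (k * α) - lam) := by ring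
      rw [this]
      linarith [norm_sub_le (conj lam * ex (k' * α) - lam) (conj lam * ex (k * α) - lam)]
    rw [e, norm_mul, norm_mul, norm_ex, RCLike.norm_conj, mul_one] at h3
    have h4 : 1 / 2 * (n ^ 12)⁻¹ ≤ ‖lam‖ * ‖ex ((k' - k : ℤ) * α) - 1‖ := by gcongr
    have h5 : (n ^ 16)⁻¹ = (n ^ 4)⁻¹ * (n ^ 12)⁻¹ := by rw [← mul_inv, ← pow_add]
    have h6 := inv_pow_le_of_scale hn (k := 4) (by norm_num)
    have h7 : 0 < (n ^ 12)⁻¹ := by positivity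
    nlinarith
  obtain ⟨X, E, hX1, hX2, hE1, hE2, hXF, hXs, hEn, -, hEr, ⟨c1, c2, c3, c4, c5⟩, -, -⟩ :=
    g.exists_elim hA hn hη hα (allLow n \ {k}) hres
  set T := keep (allLow n) (allLow n) * E with hT
  have hTr : Rapid2 T := hEr.keep _ _
  have hT1 : ∀ k : ℤ, |(k : ℝ)| ≤ n ^ 5 → T.1 k = 0 := fun k hk => keep_allLow_mul_fst E hk
  have hT2 : ∀ k : ℤ, |(k : ℝ)| ≤ n ^ 5 → T.2 k = 0 := fun k hk => keep_allLow_mul_snd E hk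
  have hsplit1 : E.1 = Pi.single 0 (E.1 0) + T.1 := funext fun j => by
    by_cases hj : j ∈ allLow n
    · by_cases hj0 : j = 0
      · subst hj0; simp [T, keep, hj]
      · simp [T, keep, hj, hj0, hE1 j ⟨hj0, hj⟩]
    · have hj0 : j ≠ 0 := fun h => hj (by rw [h]; simp [allLow]; positivity)
      simp [T, keep, hj, hj0]
  have hsplit2 : E.2 = Pi.single k (E.2 k) + T.2 := funext fun j => by
    by_cases hj : j ∈ allLow n
    · by_cases hjk : j = k
      · subst hjk; simp [T, keep, hj]
      · simp [T, keep, hj, hjk, hE2 j ⟨hj, hjk⟩]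
    · have hjk : j ≠ k := fun h => hj (h ▸ hk)
      simp [T, keep, hj, hjk]
  have hone : ∀ (j : ℤ) (a : ℂ), nrm 1 (Pi.single j a) ≠ ∞ := fun j a => by
    rw [nrm_single]; simp
  have hcoef := norm_le_of_nrm2_le (isWeight_wt (N := n ^ 4) (by positivity) 100) (P := E)
    (c := 2 * (n ^ 40)⁻¹) (by positivity) (hEn.trans (le_of_eq (by
      rw [ENNReal.ofReal_mul (by positivity), ENNReal.ofReal_ofNat])))
  have h40 := inv_pow_le_of_scale hn (k := 40) (by norm_num)
  have h16 := inv_pow_le_of_scale hn (k := 16) (by norm_num)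
  norm_num at h40 h16
  set ν := ex (-(k * α / 2)) with hν
  have hν1 : ‖ν‖ = 1 := norm_ex _
  have hre0 : ‖ν * E.1 0‖ ≤ 1 / 10000 := by
    rw [norm_mul, hν1, one_mul]; linarith [(hcoef 0).1]
  have him : |(ν * lam).im| ≤ 1 / 10000 := by
    have := abs_im_le_of_resonance hs.le
    linarith
  have hνl : 1 / 2 ≤ ‖ν * lam‖ := by rw [norm_mul, hν1, one_mul]; exact hl1
  set G : PS := (fun l => ν * T.1 l, fun l => ν * T.2 (l + k)) with hG
  have hGn : ∀ N : ℝ, 0 < N → ∀ r : ℕ, nrm2 (wt N r) G ≤ wt N r k * nrm2 (wt N r) T := fun N hN r => by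
    have hw := isWeight_wt hN r
    rw [nrm2, nrm2, hG, nrm_const_mul, nrm_const_mul, mul_add, ← ofReal_norm, hν1,
      ENNReal.ofReal_one, one_mul, one_mul]
    exact add_le_add (le_mul_of_one_le_left zero_le (hw.one_le k)) (nrm_shift_le hw _ k)
  have hGr : Rapid2 G := fun r =>
    ne_top_of_le_ne_top (ENNReal.mul_ne_top (wt_ne_top _ _ _) (hTr r)) (hGn 1 one_pos r)
  refine ⟨fun x => B x * (1 + evm X x) * cmat (ex (k * x / 2)) 0, ν * (lam + E.1 0), ν * E.2 k, G,
    contDiff_matrix_mul c1 (contDiff_cmat ?_ contDiff_const), fun x => ?_, fun x => ?_,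
    c4.mul (hasDeg_ex (C := 0) (by fun_prop) (by simp)), hGr, ?_, fun x => ?_, ?_, ?_, ?_⟩
  · have : ContDiff ℝ (⊤ : ℕ∞) fun x : ℝ => ((k * x / 2 : ℝ) : ℂ) :=
      Complex.ofRealCLM.contDiff.comp ((contDiff_const.mul contDiff_id).div_const 2)
    unfold ex; fun_prop
  · beta_reduce
    rw [c2]
    congr 2
    rw [show k * (x + 2) / 2 = k * x / 2 + k by ring, ex_add_int]
  · rw [det_mul, det_cmat, norm_ex]
    have := c3 x
    simpa using this
  · have h1 := nrm2_high_le hn hT1 hT2 ((nrm2_keep_le _ _ _).trans hEn)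
    refine (hGn _ (by positivity) 100).trans (le_trans ?_ h1)
    gcongr
    refine (wt_le_of_abs_le (by positivity) 100 hk).trans ?_
    rw [← ENNReal.ofReal_ofNat, ← ENNReal.ofReal_pow (by positivity)]
    refine ENNReal.ofReal_le_ofReal ?_
    gcongr
    have : n ^ 5 / n ^ 6 ≤ 1 := by
      rw [div_le_one (by positivity)]
      exact pow_le_pow_right₀ (by linarith) (by norm_num)
    linarith
  · rw [← mul_assoc, c5, mul_assoc (_ * _), mul_assoc (_ * _), cmat_add_evm]
    congr 1
    have e1 : ev E.1 x = E.1 0 + ev T.1 x := by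
      conv_lhs => rw [hsplit1]
      rw [ev_add (hone _ _) (fst_ne_top hTr.one), ev_single]; simp [ex_zero]
    have e2 : ev E.2 x = E.2 k * ex (k * x) + ev T.2 x := by
      conv_lhs => rw [hsplit2]
      rw [ev_add (hone _ _) (snd_ne_top hTr.one), ev_single]
    have e3 : ev G.1 x = ν * ev T.1 x := ev_const_mul _ _
    have e4 : ev G.2 x = ν * (ex (-(k * x)) * ev T.2 x) := by
      rw [← ev_shift_index]; exact ev_const_mul (c := fun l => T.2 (l + k)) ν x
    have e5 : ex (k * (x + α) / 2) * ν = ex (k * x / 2) := by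
      rw [hν, ← ex_add]; congr 1; ring
    have e6 : ex (k * (x + α) / 2) * (ν * ex (-(k * x))) = ex (-(k * x / 2)) := by
      rw [hν, ← ex_add, ← ex_add]; congr 1; ring
    have e7 : ex (k * x) * ex (-(k * x / 2)) = ex (k * x / 2) := by
      rw [← ex_add]; congr 1; ring
    rw [cmat_mul, cmat_mul, e1, e2, e3, e4, conj_ex, map_zero]
    congr 1
    · linear_combination -(lam + E.1 0 + ev T.1 x) * e5
    · linear_combination (-E.2 k) * e5 - ev T.2 x * e6 + E.2 k * e7
  · rw [mul_add, Complex.add_im]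
    have h1 := abs_add_le (ν * lam).im (ν * E.1 0).im
    have h2 := Complex.abs_im_le_norm (ν * E.1 0)
    linarith
  · rw [norm_mul, hν1, one_mul]; linarith [(hcoef k).2]
  · rw [mul_add, Complex.add_re]
    have h1 := abs_sub_abs_le_abs_add (ν * lam).re (ν * E.1 0).re
    have h2 := Complex.abs_re_le_norm (ν * E.1 0)
    have h3 := Complex.norm_le_abs_re_add_abs_im (ν * lam)
    linarith

/-- One step of the iteration in the presence of a resonance. -/
lemma Good.exists_res {ρ : ℝ} (g : Good α A n B lam F m) (hA : ∀ x, (A x).det = 1)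
    (hρ : IsFiberedRotNum α A ρ) (hNR : ∀ k l : ℤ, 2 * ρ - k * α - l ≠ 0)
    (hn : 2 ^ 20 ≤ n) (hη : 1 ≤ n * η) (h0 : 0 < n') (hn' : n' ^ 2 = n ^ 3)
    (hα : ∀ k : ℤ, k ≠ 0 → 4 * η ^ 2 / (k : ℝ) ^ 2 ≤ ‖ex (k * α) - 1‖)
    {k : ℤ} (hk : |(k : ℝ)| ≤ n ^ 5) (hs : ‖conj lam * ex (k * α) - lam‖ < (n ^ 16)⁻¹) :
    ∃ (B' : ℝ → Matrix (Fin 2) (Fin 2) ℝ) (lam' : ℂ) (F' : PS),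
      Good α A n' B' lam' F' (m + k) := by
  have hn0 : 0 < n := by linarith
  obtain ⟨B', μ, β, G, hB1, hB2, hB3, hdeg, hGr, hGn, hAB, him, hβ, hre⟩ :=
    g.exists_rotated hA hn hη hα hk hs
  obtain ⟨hp4, hp40⟩ := scale_pow hn'
  set τ := (n ^ 60)⁻¹ / 20 with hτ
  have hτ0 : 0 < τ := by positivity
  have hτ1 : τ ≤ 1 / 1000 := by
    have := inv_pow_le_of_scale hn (k := 60) (by norm_num)
    norm_num at this
    linarith
  have hd : -τ ^ 2 ≤ μ.im ^ 2 - ‖β‖ ^ 2 := by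
    by_contra! hlt
    have hG1 : nrm2 1 G ≤ ENNReal.ofReal (τ ^ 2 / 16) :=
      (QPCocycle.nrm2_one_le (isWeight_wt (by positivity) _)).trans hGn
    refine not_hyperbolic hA hρ hNR hdeg (x₀ := μ.re) (y₀ := μ.im) (g := τ ^ 2 / 16) (β := β)
      hGr.continuous_fst hGr.continuous_snd
      (fun x => norm_ev_add_norm_ev_le (by positivity) hG1 x) (fun x => ?_) hre ?_ ?_
    · rw [hAB, mul_comm Complex.I, Complex.re_add_im]
    · nlinarith
    · refine le_of_sq_le_sq ?_ (norm_nonneg _)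
      have h1 := sq_abs μ.im
      have h2 := abs_nonneg μ.im
      have h3 : 0 ≤ τ ^ 2 := sq_nonneg τ
      have h4 : τ ^ 2 ≤ 1 := by nlinarith
      have h5 : |μ.im| * τ ^ 2 ≤ 1 / 1000 * τ ^ 2 := by gcongr
      have h6 : τ ^ 2 * τ ^ 2 ≤ 1 * τ ^ 2 := by gcongr
      nlinarith
  obtain ⟨u, hu1, hu2, hu3⟩ := exists_conj_constant hτ0 (by linarith) (by linarith : |μ.im| ≤ 1) hd
  have hpos : 0 < 1 - ‖u‖ ^ 2 := by nlinarith [norm_nonneg u]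
  set κ := (1 - ‖u‖ ^ 2)⁻¹ with hκ
  have hκ0 : 0 < κ := by positivity
  have hκ1 : κ * (1 - ‖u‖ ^ 2) = 1 := by rw [hκ]; field_simp
  have hinv : cmat (1 : ℂ) u * cmat (κ : ℂ) (-(κ * u)) = 1 := by
    rw [cmat_mul, ← cmat_one]
    have e : u * conj u = (‖u‖ : ℂ) ^ 2 := by rw [Complex.mul_conj, Complex.normSq_eq_norm_sq]; simp
    have e' : (κ : ℂ) * (1 - (‖u‖ : ℂ) ^ 2) = 1 := by exact_mod_cast hκ1
    congr 1
    · simp only [map_neg, map_mul, Complex.conj_ofReal]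
      linear_combination e' - κ * e
    · simp only [Complex.conj_ofReal]; ring
  set β' : ℂ := κ * (β + 2 * Complex.I * μ.im * u - conj β * u ^ 2) with hβ'
  have hβ'n : ‖β'‖ ≤ 5 * τ := by
    rw [hβ', norm_mul, Complex.norm_real, Real.norm_of_nonneg hκ0.le]
    calc _ ≤ κ * (5 * τ * (1 - ‖u‖ ^ 2)) := by gcongr
      _ = 5 * τ * (κ * (1 - ‖u‖ ^ 2)) := by ring
      _ = _ := by rw [hκ1, mul_one]
  set lam' : ℂ := κ * ((μ - u * conj β) + (β - u * conj μ) * conj u) with hlam'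
  have hmat : cmat (κ : ℂ) (-(κ * u)) * cmat μ β * cmat 1 u = cmat lam' β' := by
    rw [cmat_mul, cmat_mul]
    congr 1
    · rw [hlam']; ring
    · have := Complex.sub_conj μ
      rw [hβ', map_one]
      push_cast at this
      linear_combination (κ * u) * this
  set Q := cpair κ (-(κ * u))
  set R := cpair 1 u
  have hQr : Rapid2 Q := rapid2_cpair _ _
  have hRr : Rapid2 R := rapid2_cpair _ _
  have hw : IsWeight (wt (n ^ 6) 100) := isWeight_wt (by positivity) _
  refine ⟨fun x => B' x * cmat 1 u, lam', cpair 0 β' + pmul (pmul Q G) R,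
    contDiff_matrix_mul hB1 contDiff_const, fun x => by rw [hB2], fun x => ?_, ?_, ?_,
    (rapid2_cpair _ _).add ((hQr.pmul hGr).pmul hRr), ?_, fun x => ?_⟩
  · rw [det_mul, det_cmat]
    refine mul_pos (hB3 x) ?_
    simpa using hpos
  · have := hdeg.mul (hasDeg_cmat (a := fun _ => 1) (b := fun _ => u) continuous_const
      continuous_const fun x => by simpa using hu1)
    rwa [add_zero] at this
  · have := two_mul_pow_le_scale hn h0 hn'
    push_cast
    linarith [g.deg_le, abs_add_le (m : ℝ) k]
  · rw [hp4, hp40]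
    have hQn : nrm2 (wt (n ^ 6) 100) Q ≤ ENNReal.ofReal (4 / τ) := by
      rw [nrm2_cpair]
      refine ENNReal.ofReal_le_ofReal ?_
      rw [norm_neg, norm_mul, Complex.norm_real, Real.norm_of_nonneg hκ0.le]
      have : 4 / τ = 2 * (2 / τ) := by ring
      nlinarith
    have hRn : nrm2 (wt (n ^ 6) 100) R ≤ ENNReal.ofReal 2 := by
      rw [nrm2_cpair]
      refine ENNReal.ofReal_le_ofReal ?_
      rw [norm_one]; linarith
    calc nrm2 (wt (n ^ 6) 100) (cpair 0 β' + pmul (pmul Q G) R)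
        ≤ ENNReal.ofReal (5 * τ) +
          ENNReal.ofReal (4 / τ) * ENNReal.ofReal (τ ^ 2 / 16) * ENNReal.ofReal 2 := by
          refine nrm2_add_le.trans (add_le_add ?_ ?_)
          · rw [nrm2_cpair]
            refine ENNReal.ofReal_le_ofReal ?_
            rw [norm_zero, zero_add]; exact hβ'n
          · refine (nrm2_pmul_le hw).trans ?_
            gcongr
            refine (nrm2_pmul_le hw).trans ?_
            gcongr
      _ = ENNReal.ofReal (5 * τ + 4 / τ * (τ ^ 2 / 16) * 2) := by
          rw [← ENNReal.ofReal_mul (by positivity), ← ENNReal.ofReal_mul (by positivity),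
            ← ENNReal.ofReal_add (by positivity) (by positivity)]
      _ ≤ ENNReal.ofReal (n ^ 60)⁻¹ := by
          refine ENNReal.ofReal_le_ofReal ?_
          have e1 : 4 / τ * (τ ^ 2 / 16) * 2 = τ / 2 := by field_simp; norm_num
          have e2 : (n ^ 60)⁻¹ = 20 * τ := by rw [hτ]; ring
          rw [e1, e2]; linarith
  · have e1 : evm (cpair 0 β' + pmul (pmul Q G) R) x =
        cmat 0 β' + cmat κ (-(κ * u)) * evm G x * cmat 1 u := by
      rw [evm_add (rapid2_cpair _ _).one ((hQr.pmul hGr).pmul hRr).one, evm_cpair,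
        evm_pmul (hQr.pmul hGr).one hRr.one, evm_pmul hQr.one hGr.one, evm_cpair, evm_cpair]
    have e2 : cmat lam' 0 + (cmat 0 β' + cmat κ (-(κ * u)) * evm G x * cmat 1 u) =
        cmat κ (-(κ * u)) * cmat (μ + ev G.1 x) (β + ev G.2 x) * cmat 1 u := by
      rw [← add_assoc, cmat_add, add_zero, zero_add, ← hmat, ← add_mul, ← mul_add, evm, cmat_add]
    rw [← mul_assoc, hAB, e1, e2, mul_assoc (B' (x + α)) (cmat 1 u), ← mul_assoc (cmat 1 u),
      ← mul_assoc (cmat 1 u), hinv, one_mul, mul_assoc]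

end Resonant

section Scales

/-- The scales of the iteration: `n ↦ n ^ (3 / 2)`. -/
noncomputable def scale (n : ℝ) : ℕ → ℝ
  | 0 => n
  | j + 1 => scale n j * √(scale n j)

variable {n : ℝ}

lemma scale_ge (hn : 2 ^ 20 ≤ n) (j : ℕ) : 2 ^ 20 * 8 ^ j ≤ scale n j := by
  induction j with
  | zero => simpa [scale] using hn
  | succ j ih =>
    have h1 : (2 : ℝ) ^ 20 ≤ scale n j :=
      le_trans (le_mul_of_one_le_right (by positivity) (one_le_pow₀ (by norm_num))) ih
    have h2 : 8 ≤ √(scale n j) := Real.le_sqrt_of_sq_le (le_trans (by norm_num) h1)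
    calc (2 : ℝ) ^ 20 * 8 ^ (j + 1) = 2 ^ 20 * 8 ^ j * 8 := by ring
      _ ≤ scale n j * √(scale n j) := by gcongr

lemma le_scale (hn : 2 ^ 20 ≤ n) (j : ℕ) : 2 ^ 20 ≤ scale n j :=
  le_trans (le_mul_of_one_le_right (by positivity) (one_le_pow₀ (by norm_num))) (scale_ge hn j)

lemma scale_succ_sq (hn : 2 ^ 20 ≤ n) (j : ℕ) : scale n (j + 1) ^ 2 = scale n j ^ 3 := by
  have h : 0 ≤ scale n j := le_trans (by norm_num) (le_scale hn j)
  rw [scale, mul_pow, Real.sq_sqrt h]; ring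

lemma scale_mono (hn : 2 ^ 20 ≤ n) : Monotone (scale n) := by
  refine monotone_nat_of_le_succ fun j => ?_
  have h := le_scale hn j
  have h2 : 1 ≤ √(scale n j) := Real.le_sqrt_of_sq_le (by linarith)
  exact le_mul_of_one_le_right (by linarith) h2

lemma exists_scale_ge (hn : 2 ^ 20 ≤ n) (c : ℝ) : ∃ j, c ≤ scale n j := by
  obtain ⟨j, hj⟩ := pow_unbounded_of_one_lt c (by norm_num : (1 : ℝ) < 8)
  refine ⟨j, hj.le.trans (le_trans ?_ (scale_ge hn j))⟩
  exact le_mul_of_one_le_left (by positivity) (by norm_num)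

end Scales

section Iteration

variable {α ρ n η c : ℝ} {A B : ℝ → Matrix (Fin 2) (Fin 2) ℝ} {lam : ℂ} {F : PS} {m : ℤ}

/-- The arithmetic condition on the rotation number rules out resonances at large scales. -/
lemma Good.nonresonant (g : Good α A n B lam F m) (hA : ∀ x, (A x).det = 1)
    (hρ : IsFiberedRotNum α A ρ) (hn : 2 ^ 20 ≤ n)
    (hc : ∀ k l : ℤ, c / ((k : ℝ) ^ 2 + 1) ≤ |2 * ρ - k * α - l|) (hcn : 1 ≤ c * n)
    (k : ℤ) (hk : |(k : ℝ)| ≤ n ^ 5) : (n ^ 16)⁻¹ ≤ ‖conj lam * ex (k * α) - lam‖ := by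
  by_contra! hlt
  have hn0 : 0 < n := by linarith
  obtain ⟨hl1, hl2⟩ := g.norm_lam hA hn
  obtain ⟨θ, hθ⟩ := exists_eq_norm_mul_ex lam
  set r := ‖lam‖
  have h40 := inv_pow_le_of_scale hn (k := 40) (by norm_num)
  norm_num at h40
  obtain ⟨H, hHc, hHa, hHn⟩ := exists_lift_near g.rapid.continuous_fst g.rapid.continuous_snd
    (r := r) (θ := θ) (c := (n ^ 40)⁻¹) (by linarith) (by linarith)
    (fun x => norm_ev_add_norm_ev_le (by positivity) (g.nrm2_one_le hn) x)
  obtain ⟨l, hl⟩ := exists_abs_rot_sub_le hA hρ g.deg (D := fun x => cmat (r * ex θ + ev F.1 x) (ev F.2 x))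
    (fun x => by rw [g.eqn, cmat_add_evm, ← hθ]) hHc hHa hHn
  have e1 : conj lam * ex (k * α) - lam = r * ex θ * (ex (k * α - 2 * θ) - 1) := by
    rw [hθ, map_mul, Complex.conj_ofReal, conj_ex, mul_sub, mul_one, mul_assoc, mul_assoc, ← ex_add,
      ← ex_add]
    congr 3; ring
  rw [e1, norm_mul, norm_mul, norm_ex, Complex.norm_real, Real.norm_of_nonneg (by positivity),
    mul_one] at hlt
  obtain ⟨l', hl'⟩ : ∃ l' : ℤ, |k * α - 2 * θ - l'| < (n ^ 16)⁻¹ := by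
    by_contra! h
    have := four_mul_le_norm_ex_sub_one h
    have h0 : 0 < (n ^ 16)⁻¹ := by positivity
    nlinarith
  have h1 : |ρ - m * α / 2 - l - θ| ≤ 2 * (n ^ 40)⁻¹ := by
    refine hl.trans ?_
    rw [div_le_iff₀ (by linarith)]
    have h0 : 0 < (n ^ 40)⁻¹ := by positivity
    nlinarith
  have h2 := hc (m + k) (2 * l - l')
  have h3 : |2 * ρ - (m + k : ℤ) * α - (2 * l - l' : ℤ)| ≤ 4 * (n ^ 40)⁻¹ + (n ^ 16)⁻¹ := by
    have e : 2 * ρ - (m + k : ℤ) * α - (2 * l - l' : ℤ) =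
        2 * (ρ - m * α / 2 - l - θ) - (k * α - 2 * θ - l') := by push_cast; ring
    rw [e]
    refine (abs_sub _ _).trans ?_
    rw [abs_mul, abs_two]
    linarith
  have h4 : 4 * (n ^ 40)⁻¹ + (n ^ 16)⁻¹ ≤ 2 * (n ^ 16)⁻¹ := by
    have : (n ^ 40)⁻¹ = (n ^ 24)⁻¹ * (n ^ 16)⁻¹ := by rw [← mul_inv, ← pow_add]
    have h24 := inv_pow_le_of_scale hn (k := 24) (by norm_num)
    norm_num at h24
    have h0 : 0 < (n ^ 16)⁻¹ := by positivity
    nlinarith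
  have hc0 : 0 < c := by
    by_contra! h
    nlinarith
  have h5 : ((m + k : ℤ) : ℝ) ^ 2 + 1 ≤ 5 * n ^ 10 := by
    have h6 : |((m + k : ℤ) : ℝ)| ≤ 2 * n ^ 5 := by
      push_cast
      linarith [abs_add_le (m : ℝ) k, g.deg_le]
    have h7 : ((m + k : ℤ) : ℝ) ^ 2 ≤ (2 * n ^ 5) ^ 2 := by rw [← sq_abs]; gcongr
    have h8 : 1 ≤ n ^ 10 := one_le_pow₀ (by linarith)
    have h9 : (2 * n ^ 5) ^ 2 = 4 * n ^ 10 := by ring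
    linarith
  have h6 : c / (5 * n ^ 10) ≤ 2 * (n ^ 16)⁻¹ := by
    refine le_trans ?_ (h2.trans (h3.trans h4))
    gcongr
  rw [← div_eq_mul_inv, div_le_div_iff₀ (by positivity) (by positivity)] at h6
  have h7 : c * n ^ 16 = (c * n) * n ^ 5 * n ^ 10 := by ring
  have h8 : 2 ^ 20 ≤ n ^ 5 := hn.trans (le_self_pow₀ (by linarith) (by norm_num))
  have h9 : 0 < n ^ 10 := by positivity
  have h10 : 2 ^ 20 ≤ (c * n) * n ^ 5 := by nlinarith
  nlinarith

/-- The iteration can be carried out at all scales. -/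
lemma Good.exists_scale (g : Good α A n B lam F m) (hA : ∀ x, (A x).det = 1)
    (hρ : IsFiberedRotNum α A ρ) (hNR : ∀ k l : ℤ, 2 * ρ - k * α - l ≠ 0)
    (hn : 2 ^ 20 ≤ n) (hη0 : 0 < η) (hη : 1 ≤ n * η)
    (hα : ∀ k : ℤ, k ≠ 0 → 4 * η ^ 2 / (k : ℝ) ^ 2 ≤ ‖ex (k * α) - 1‖) (j : ℕ) :
    ∃ (B' : ℝ → Matrix (Fin 2) (Fin 2) ℝ) (lam' : ℂ) (F' : PS) (m' : ℤ),
      Good α A (scale n j) B' lam' F' m' := by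
  induction j with
  | zero => exact ⟨B, lam, F, m, g⟩
  | succ j ih =>
    obtain ⟨B', lam', F', m', g'⟩ := ih
    have hj := le_scale hn j
    have hj1 : 0 < scale n (j + 1) := by linarith [le_scale hn (j + 1)]
    have hηj : 1 ≤ scale n j * η :=
      hη.trans (by gcongr; exact scale_mono hn (Nat.zero_le j))
    by_cases hs : ∀ k : ℤ, |(k : ℝ)| ≤ scale n j ^ 5 →
        (scale n j ^ 16)⁻¹ ≤ ‖conj lam' * ex (k * α) - lam'‖
    · obtain ⟨X, lam'', F'', g'', -⟩ := g'.exists_nonres hA hj hηj hj1 (scale_succ_sq hn j) hα hs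
      exact ⟨_, _, _, _, g''⟩
    · push Not at hs
      obtain ⟨k, hk, hk'⟩ := hs
      obtain ⟨B'', lam'', F'', g''⟩ := g'.exists_res hA hρ hNR hj hηj hj1 (scale_succ_sq hn j) hα hk hk'
      exact ⟨_, _, _, _, g''⟩

/-- The sequence of conjugacies obtained by iterating the nonresonant step. -/
lemma Good.exists_seq (g : Good α A n B lam F m) (hA : ∀ x, (A x).det = 1)
    (hρ : IsFiberedRotNum α A ρ) (hn : 2 ^ 20 ≤ n) (hη0 : 0 < η) (hη : 1 ≤ n * η)
    (hα : ∀ k : ℤ, k ≠ 0 → 4 * η ^ 2 / (k : ℝ) ^ 2 ≤ ‖ex (k * α) - 1‖)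
    (hc0 : 0 < c) (hc : ∀ k l : ℤ, c / ((k : ℝ) ^ 2 + 1) ≤ |2 * ρ - k * α - l|) (hcn : 1 ≤ c * n) :
    ∃ (Bs : ℕ → ℝ → Matrix (Fin 2) (Fin 2) ℝ) (ls : ℕ → ℂ) (Fs Xs : ℕ → PS), Bs 0 = B ∧
      (∀ j, Good α A (scale n j) (Bs j) (ls j) (Fs j) m) ∧
      (∀ j x, Bs (j + 1) x = Bs j x * (1 + evm (Xs j) x)) ∧
      (∀ j, (∀ k : ℤ, scale n j ^ 5 < |(k : ℝ)| → (Xs j).1 k = 0) ∧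
        (∀ k : ℤ, scale n j ^ 5 < |(k : ℝ)| → (Xs j).2 k = 0)) ∧
      (∀ j, nrm2 1 (Xs j) ≤ 3 * (ENNReal.ofReal (scale n j ^ 16) * nrm2 1 (Fs j))) ∧
      (∀ j, nrm2 1 (Xs j) ≤ ENNReal.ofReal (scale n j ^ 20)⁻¹) ∧
      (∀ j, ‖ls (j + 1) - ls j‖ ≤ 2 * (scale n j ^ 40)⁻¹) ∧
      (∀ j, nrm2 1 (Fs (j + 1)) ≤ nrm2 1 (keep (allLow (scale n j)) (allLow (scale n j)) * Fs j) +
        12 * (ENNReal.ofReal (scale n j ^ 16) * nrm2 1 (Fs j)) * nrm2 1 (Fs j)) ∧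
      ∀ j, ∀ r : ℕ, 2 * (2 ^ r * nrm2 1 (Xs j)) ≤ 1 →
        nrm2 (wt (scale n (j + 1) ^ 4) r) (Fs (j + 1)) ≤ 3 * nrm2 (wt (scale n j ^ 4) r) (Fs j) := by
  have step : ∀ j (s : {s : (ℝ → Matrix (Fin 2) (Fin 2) ℝ) × ℂ × PS //
      Good α A (scale n j) s.1 s.2.1 s.2.2 m}), _ := fun j s =>
    have hj := le_scale hn j
    s.2.exists_nonres (n' := scale n (j + 1)) (η := η) hA hj
      (hη.trans (by gcongr; exact scale_mono hn (Nat.zero_le j)))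
      (by linarith [le_scale hn (j + 1)]) (scale_succ_sq hn j) hα
      (s.2.nonresonant hA hρ hj hc (hcn.trans (by gcongr; exact scale_mono hn (Nat.zero_le j))))
  choose X lam' F' hstep using step
  let σ : (j : ℕ) → {s : (ℝ → Matrix (Fin 2) (Fin 2) ℝ) × ℂ × PS //
      Good α A (scale n j) s.1 s.2.1 s.2.2 m} := fun j =>
    Nat.rec ⟨(B, lam, F), g⟩ (fun j s => ⟨(_, lam' j s, F' j s), (hstep j s).1⟩) j
  exact ⟨fun j => (σ j).1.1, fun j => (σ j).1.2.1, fun j => (σ j).1.2.2, fun j => X j (σ j), rfl,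
    fun j => (σ j).2, fun j x => rfl,
    fun j => ⟨(hstep j (σ j)).2.1, (hstep j (σ j)).2.2.1⟩, fun j => (hstep j (σ j)).2.2.2.1,
    fun j => (hstep j (σ j)).2.2.2.2.1, fun j => (hstep j (σ j)).2.2.2.2.2.1,
    fun j => (hstep j (σ j)).2.2.2.2.2.2.1, fun j => (hstep j (σ j)).2.2.2.2.2.2.2⟩

end Iteration

section Convergence

lemma exists_le_geometric {a : ℕ → ℝ≥0∞} {c : ℝ≥0∞} {J : ℕ} (ha : ∀ j, a j ≠ ∞) (hc : 1 ≤ c)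
    (h : ∀ j, J ≤ j → a (j + 1) ≤ c * a j) : ∃ C ≠ ∞, ∀ j, a j ≤ C * c ^ j := by
  refine ⟨∑ i ∈ Finset.range (J + 1), a i, ENNReal.sum_ne_top.2 fun i _ => ha i, fun j => ?_⟩
  induction j with
  | zero =>
    rw [pow_zero, mul_one]
    exact Finset.single_le_sum (f := a) (fun _ _ => zero_le) (by simp)
  | succ j ih =>
    rcases le_or_gt J j with hj | hj
    · calc a (j + 1) ≤ c * a j := h j hj
        _ ≤ c * ((∑ i ∈ Finset.range (J + 1), a i) * c ^ j) := by gcongr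
        _ = _ := by ring
    · refine le_trans ?_ (le_mul_of_one_le_right zero_le (one_le_pow₀ hc))
      exact Finset.single_le_sum (f := a) (fun _ _ => zero_le) (Finset.mem_range.2 (by omega))

variable {n : ℝ} {Fs Xs : ℕ → PS}

lemma ofReal_scale_ge (hn : 2 ^ 20 ≤ n) (j : ℕ) : 8 ^ j ≤ ENNReal.ofReal (scale n j) := by
  have : (8 : ℝ≥0∞) ^ j = ENNReal.ofReal (8 ^ j) := by
    rw [ENNReal.ofReal_pow (by norm_num), ENNReal.ofReal_ofNat]
  rw [this]
  exact ENNReal.ofReal_le_ofReal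
    ((le_mul_of_one_le_left (by positivity) (by norm_num)).trans (scale_ge hn j))

lemma eventually_small (hn : 2 ^ 20 ≤ n)
    (hX : ∀ j, nrm2 1 (Xs j) ≤ ENNReal.ofReal (scale n j ^ 20)⁻¹) (r : ℕ) :
    ∃ J, ∀ j, J ≤ j → 2 * (2 ^ r * nrm2 1 (Xs j)) ≤ 1 := by
  obtain ⟨J, hJ⟩ := exists_scale_ge hn (2 * 2 ^ r)
  refine ⟨J, fun j hj => ?_⟩
  have h1 : 2 * 2 ^ r ≤ scale n j := hJ.trans (scale_mono hn hj)
  have h2 := le_scale hn j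
  have h3 : scale n j ≤ scale n j ^ 20 := le_self_pow₀ (by linarith) (by norm_num)
  calc 2 * (2 ^ r * nrm2 1 (Xs j)) ≤ 2 * (2 ^ r * ENNReal.ofReal (scale n j ^ 20)⁻¹) := by
        gcongr; exact hX j
    _ = ENNReal.ofReal (2 * (2 ^ r * (scale n j ^ 20)⁻¹)) := by
        rw [ENNReal.ofReal_mul (by norm_num), ENNReal.ofReal_mul (by positivity),
          ENNReal.ofReal_pow (by norm_num), ENNReal.ofReal_ofNat]
    _ ≤ 1 := by
        rw [← ENNReal.ofReal_one]
        refine ENNReal.ofReal_le_ofReal ?_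
        rw [← mul_assoc, ← div_eq_mul_inv, div_le_one (by positivity)]
        linarith

/-- The remainders decay faster than any power of the scale. -/
lemma exists_decay (hn : 2 ^ 20 ≤ n) (hF : ∀ j, Rapid2 (Fs j))
    (hF40 : ∀ j, nrm2 1 (Fs j) ≤ ENNReal.ofReal (scale n j ^ 40)⁻¹)
    (hX : ∀ j, nrm2 1 (Xs j) ≤ ENNReal.ofReal (scale n j ^ 20)⁻¹)
    (hstep : ∀ j, nrm2 1 (Fs (j + 1)) ≤
      nrm2 1 (keep (allLow (scale n j)) (allLow (scale n j)) * Fs j) +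
        12 * (ENNReal.ofReal (scale n j ^ 16) * nrm2 1 (Fs j)) * nrm2 1 (Fs j))
    (hap : ∀ j, ∀ r : ℕ, 2 * (2 ^ r * nrm2 1 (Xs j)) ≤ 1 →
      nrm2 (wt (scale n (j + 1) ^ 4) r) (Fs (j + 1)) ≤ 3 * nrm2 (wt (scale n j ^ 4) r) (Fs j))
    (p : ℕ) : ∃ C ≠ ∞, ∀ j, nrm2 1 (Fs j) * ENNReal.ofReal (scale n j) ^ (40 + p) ≤ C := by
  have hs0 : ∀ j, 0 < scale n j := fun j => by linarith [le_scale hn j]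
  have hs1 : ∀ j, 1 ≤ scale n j := fun j => by linarith [le_scale hn j]
  induction p with
  | zero =>
    refine ⟨1, by simp, fun j => ?_⟩
    have := hs0 j
    refine (mul_le_mul_left (hF40 j) _).trans ?_
    rw [← ENNReal.ofReal_pow (hs0 j).le, ← ENNReal.ofReal_mul (by positivity), add_zero,
      inv_mul_cancel₀ (by positivity), ENNReal.ofReal_one]
  | succ p ih =>
    obtain ⟨C, hC, hCe⟩ := ih
    set r := 2 * (40 + p) + 3 with hr
    obtain ⟨J, hJ⟩ := eventually_small hn hX r
    obtain ⟨D, hD, hDe⟩ := exists_le_geometric (a := fun j => nrm2 (wt (scale n j ^ 4) r) (Fs j))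
      (c := 3) (J := J) (fun j => ne_top_of_le_ne_top (hF j r)
        (nrm2_mono fun k => wt_anti one_pos (one_le_pow₀ (hs1 j)) r k)) (by norm_num)
      fun j hj => hap j r (hJ j hj)
    have htail : ∀ j, nrm2 1 (keep (allLow (scale n j)) (allLow (scale n j)) * Fs j) *
        ENNReal.ofReal (scale n j) ^ (2 * (40 + p) + 2) ≤ D := fun j => by
      have h0 := hs0 j
      have h1 : nrm2 1 (keep (allLow (scale n j)) (allLow (scale n j)) * Fs j) ≤
          ENNReal.ofReal ((scale n j ^ 4 / scale n j ^ 5) ^ r) * nrm2 (wt (scale n j ^ 4) r) (Fs j) := by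
        refine (nrm2_le_of_high (fun k hk => keep_allLow_mul_fst _ hk)
          (fun k hk => keep_allLow_mul_snd _ hk) fun k hk =>
          one_le_mul_wt (N := scale n j ^ 4) (by positivity) (by positivity) r hk).trans ?_
        gcongr
        exact nrm2_keep_le _ _ _
      have h2 : scale n j ^ 4 / scale n j ^ 5 = (scale n j)⁻¹ := by field_simp
      rw [h2] at h1
      have hN0 : ENNReal.ofReal (scale n j) ≠ 0 := by simpa using h0
      have h3 : nrm2 1 (keep (allLow (scale n j)) (allLow (scale n j)) * Fs j) *
          ENNReal.ofReal (scale n j) ^ r ≤ D * ENNReal.ofReal (scale n j) := by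
        calc _ ≤ ENNReal.ofReal ((scale n j)⁻¹ ^ r) * nrm2 (wt (scale n j ^ 4) r) (Fs j) *
              ENNReal.ofReal (scale n j) ^ r := by gcongr
          _ = ENNReal.ofReal ((scale n j)⁻¹ ^ r * scale n j ^ r) *
              nrm2 (wt (scale n j ^ 4) r) (Fs j) := by
              rw [ENNReal.ofReal_mul (by positivity), ENNReal.ofReal_pow h0.le r]; ring
          _ = nrm2 (wt (scale n j ^ 4) r) (Fs j) := by
              rw [← mul_pow, inv_mul_cancel₀ h0.ne', one_pow, ENNReal.ofReal_one, one_mul]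
          _ ≤ D * 3 ^ j := hDe j
          _ ≤ D * 8 ^ j := by gcongr; norm_num
          _ ≤ _ := by gcongr; exact ofReal_scale_ge hn j
      rw [hr, pow_succ, ← mul_assoc] at h3
      exact (ENNReal.mul_le_mul_iff_left hN0 ENNReal.ofReal_ne_top).1 h3
    refine ⟨nrm2 1 (Fs 0) * ENNReal.ofReal (scale n 0) ^ (40 + (p + 1)) + (D + 12 * C ^ 2),
      ENNReal.add_ne_top.2 ⟨ENNReal.mul_ne_top (hF 0).one (ENNReal.pow_ne_top ENNReal.ofReal_ne_top),
      ENNReal.add_ne_top.2 ⟨hD, ENNReal.mul_ne_top (by simp) (ENNReal.pow_ne_top hC)⟩⟩, fun j => ?_⟩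
    cases j with
    | zero => exact le_self_add
    | succ j =>
      refine le_trans ?_ le_add_self
      have h0 := hs0 j
      have h1 := hs1 j
      set N := ENNReal.ofReal (scale n j)
      have hpow : ∀ a : ℕ, 3 * (40 + (p + 1)) ≤ 2 * a →
          ENNReal.ofReal (scale n (j + 1)) ^ (40 + (p + 1)) ≤ N ^ a := fun a ha => by
        rw [← ENNReal.ofReal_pow (hs0 (j + 1)).le, ← ENNReal.ofReal_pow h0.le]
        refine ENNReal.ofReal_le_ofReal (le_of_sq_le_sq ?_ (by positivity))
        rw [← pow_mul, mul_comm _ 2, pow_mul, scale_succ_sq hn, ← pow_mul, ← pow_mul, mul_comm a]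
        exact pow_le_pow_right₀ h1 ha
      calc nrm2 1 (Fs (j + 1)) * ENNReal.ofReal (scale n (j + 1)) ^ (40 + (p + 1))
          ≤ (nrm2 1 (keep (allLow (scale n j)) (allLow (scale n j)) * Fs j) +
            12 * (ENNReal.ofReal (scale n j ^ 16) * nrm2 1 (Fs j)) * nrm2 1 (Fs j)) *
            ENNReal.ofReal (scale n (j + 1)) ^ (40 + (p + 1)) := by gcongr; exact hstep j
        _ = nrm2 1 (keep (allLow (scale n j)) (allLow (scale n j)) * Fs j) *
            ENNReal.ofReal (scale n (j + 1)) ^ (40 + (p + 1)) +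
            12 * (N ^ 16 * nrm2 1 (Fs j)) * nrm2 1 (Fs j) *
            ENNReal.ofReal (scale n (j + 1)) ^ (40 + (p + 1)) := by
            rw [add_mul, ENNReal.ofReal_pow h0.le]
        _ ≤ nrm2 1 (keep (allLow (scale n j)) (allLow (scale n j)) * Fs j) *
            N ^ (2 * (40 + p) + 2) +
            12 * (N ^ 16 * nrm2 1 (Fs j)) * nrm2 1 (Fs j) * N ^ (2 * (24 + p) + 16) := by
            exact add_le_add (mul_le_mul_right (hpow _ (by omega)) _)
              (mul_le_mul_right (hpow _ (by omega)) _)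
        _ = nrm2 1 (keep (allLow (scale n j)) (allLow (scale n j)) * Fs j) *
            N ^ (2 * (40 + p) + 2) + 12 * (nrm2 1 (Fs j) * N ^ (40 + p)) ^ 2 := by ring
        _ ≤ D + 12 * C ^ 2 := by
            gcongr
            · exact htail j
            · exact hCe j

lemma le_mul_inv_two_pow {a C : ℝ≥0∞} {j : ℕ} (h : a * 2 ^ j ≤ C) : a ≤ C * 2⁻¹ ^ j := by
  calc a = a * 2 ^ j * 2⁻¹ ^ j := by
        rw [mul_assoc, ← mul_pow, ENNReal.mul_inv_cancel (by simp) (by simp), one_pow, mul_one]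
    _ ≤ _ := by gcongr

/-- The partial products of the conjugacies. -/
noncomputable def partialProd (Xs : ℕ → PS) : ℕ → PS
  | 0 => 0
  | j + 1 => partialProd Xs j + (Xs j + pmul (partialProd Xs j) (Xs j))

lemma rapid2_zero : Rapid2 0 := fun r => by rw [nrm2_zero]; simp

lemma Rapid2.partialProd (hX : ∀ j, Rapid2 (Xs j)) (j : ℕ) : Rapid2 (partialProd Xs j) := by
  induction j with
  | zero => exact rapid2_zero
  | succ j ih => exact ih.add ((hX j).add (ih.pmul (hX j)))

lemma one_add_evm_partialProd (hX : ∀ j, Rapid2 (Xs j)) (j : ℕ) (x : ℝ) :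
    1 + evm (partialProd Xs (j + 1)) x = (1 + evm (partialProd Xs j) x) * (1 + evm (Xs j) x) := by
  have ih := Rapid2.partialProd hX j
  rw [QPCocycle.partialProd, evm_add ih.one ((hX j).add (ih.pmul (hX j))).one,
    evm_add (hX j).one (ih.pmul (hX j)).one, evm_pmul ih.one (hX j).one]
  noncomm_ring

lemma nrm2_partialProd_step {w : ℤ → ℝ≥0∞} (hw : IsWeight w) (j : ℕ) :
    nrm2 w (partialProd Xs (j + 1) - partialProd Xs j) ≤
      nrm2 w (Xs j) * (1 + nrm2 w (partialProd Xs j)) := by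
  rw [QPCocycle.partialProd, add_sub_cancel_left, mul_add, mul_one, mul_comm]
  exact nrm2_add_le.trans (add_le_add le_rfl ((nrm2_pmul_le hw).trans (by rw [mul_comm])))

lemma one_add_nrm2_partialProd {w : ℤ → ℝ≥0∞} (hw : IsWeight w) {j : ℕ} (h : nrm2 w (Xs j) ≤ 1) :
    1 + nrm2 w (partialProd Xs (j + 1)) ≤ 2 * (1 + nrm2 w (partialProd Xs j)) := by
  have h1 : nrm2 w (partialProd Xs (j + 1)) ≤ nrm2 w (partialProd Xs j) +
      (nrm2 w (Xs j) + nrm2 w (partialProd Xs j) * nrm2 w (Xs j)) :=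
    nrm2_add_le.trans (add_le_add le_rfl
      (nrm2_add_le.trans (add_le_add le_rfl (nrm2_pmul_le hw))))
  calc 1 + nrm2 w (partialProd Xs (j + 1))
      ≤ 1 + (nrm2 w (partialProd Xs j) + (1 + nrm2 w (partialProd Xs j) * 1)) := by
        refine (add_le_add le_rfl h1).trans ?_
        gcongr
    _ = _ := by ring

/-- The partial products converge to a smooth limit close to the identity. -/
lemma exists_partialProd_limit (hX0 : ∀ j, nrm2 1 (Xs j) * 8 ^ j ≤ ENNReal.ofReal (1 / 8))
    (hX : ∀ r, ∃ C ≠ ∞, ∀ j, nrm2 (wt 1 r) (Xs j) * 8 ^ j ≤ C) :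
    ∃ G : PS, Rapid2 G ∧ nrm2 1 G ≤ ENNReal.ofReal (1 / 2) ∧
      ∀ j, nrm2 1 (G - partialProd Xs j) ≤ 2⁻¹ ^ j := by
  have hXr : ∀ j, Rapid2 (Xs j) := fun j r => by
    obtain ⟨C, hC, h⟩ := hX r
    exact ne_top_of_le_ne_top hC ((le_mul_of_one_le_right zero_le
      (one_le_pow₀ (by norm_num))).trans (h j))
  have key : ∀ (w : ℤ → ℝ≥0∞), IsWeight w → ∀ C K : ℝ≥0∞,
      (∀ j, nrm2 w (Xs j) * 8 ^ j ≤ C) → (∀ j, 1 + nrm2 w (partialProd Xs j) ≤ K * 2 ^ j) →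
      ∀ j, nrm2 w (partialProd Xs (j + 1) - partialProd Xs j) ≤ (C * K) * 2⁻¹ ^ j := by
    intro w hw C K hC hK j
    refine (nrm2_partialProd_step hw j).trans (le_mul_inv_two_pow ?_)
    calc nrm2 w (Xs j) * (1 + nrm2 w (partialProd Xs j)) * 2 ^ j
        ≤ nrm2 w (Xs j) * (K * 2 ^ j) * 2 ^ j := by gcongr; exact hK j
      _ = nrm2 w (Xs j) * 4 ^ j * K := by
          rw [show (4 : ℝ≥0∞) = 2 * 2 by norm_num, mul_pow]; ring
      _ ≤ nrm2 w (Xs j) * 8 ^ j * K := by gcongr; norm_num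
      _ ≤ C * K := by gcongr; exact hC j
  have hK0 : ∀ j, 1 + nrm2 1 (partialProd Xs j) ≤ 1 * 2 ^ j := fun j => by
    induction j with
    | zero => simp [QPCocycle.partialProd, nrm2_zero]
    | succ j ih =>
      refine (one_add_nrm2_partialProd isWeight_one ?_).trans ?_
      · refine (le_mul_of_one_le_right zero_le (one_le_pow₀ (by norm_num))).trans
          ((hX0 j).trans ?_)
        rw [← ENNReal.ofReal_one]
        exact ENNReal.ofReal_le_ofReal (by norm_num)
      · calc 2 * (1 + nrm2 1 (partialProd Xs j)) ≤ 2 * (1 * 2 ^ j) := by gcongr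
          _ = _ := by ring
  obtain ⟨G, hG⟩ := exists_limit isWeight_one (by simp) rfl (key 1 isWeight_one _ 1 hX0 hK0)
  have e4 : 2 * (ENNReal.ofReal (1 / 8) * 1) = ENNReal.ofReal (1 / 4) := by
    rw [mul_one, ← ENNReal.ofReal_ofNat, ← ENNReal.ofReal_mul (by norm_num)]; norm_num
  rw [e4] at hG
  refine ⟨G, fun r => ?_, ?_, fun j => (hG j).trans (mul_le_of_le_one_left zero_le ?_)⟩
  · obtain ⟨C, hC, hCe⟩ := hX r
    have hw := isWeight_wt one_pos r
    obtain ⟨J, hJ⟩ : ∃ J : ℕ, ∀ j, J ≤ j → nrm2 (wt 1 r) (Xs j) ≤ 1 := by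
      have := (tendsto_mul_inv_two_pow hC).eventually (ge_mem_nhds (by norm_num : (0 : ℝ≥0∞) < 1))
      obtain ⟨J, hJ⟩ := Filter.eventually_atTop.1 this
      refine ⟨J, fun j hj => (le_mul_inv_two_pow (le_trans ?_ (hCe j))).trans (hJ j hj)⟩
      gcongr; norm_num
    obtain ⟨K, hK, hKe⟩ := exists_le_geometric (a := fun j => 1 + nrm2 (wt 1 r) (partialProd Xs j))
      (c := 2) (J := J) (fun j => ENNReal.add_ne_top.2 ⟨by simp, Rapid2.partialProd hXr j r⟩)
      (by norm_num) fun j hj => one_add_nrm2_partialProd hw (hJ j hj)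
    have hCK : C * K ≠ ∞ := ENNReal.mul_ne_top hC hK
    obtain ⟨G', hG'⟩ := exists_limit hw hCK rfl (key _ hw C K hCe hKe)
    have hGG : nrm2 1 (G' - G) = 0 := by
      have hle : ∀ j, nrm2 1 (G' - G) ≤ (2 * (C * K) + ENNReal.ofReal (1 / 4)) * 2⁻¹ ^ j := fun j => by
        have : G' - G = (G' - partialProd Xs j) - (G - partialProd Xs j) := by abel
        rw [this, add_mul]
        exact nrm2_sub_le.trans (add_le_add ((nrm2_one_le hw).trans (hG' j)) (hG j))
      exact le_antisymm (ge_of_tendsto' (tendsto_mul_inv_two_pow (ENNReal.add_ne_top.2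
        ⟨ENNReal.mul_ne_top (by simp) hCK, ENNReal.ofReal_ne_top⟩)) hle) zero_le
    rw [← sub_eq_zero.1 (nrm2_eq_zero isWeight_one hGG)]
    have h0 := hG' 0
    rw [QPCocycle.partialProd, sub_zero, pow_zero, mul_one] at h0
    exact ne_top_of_le_ne_top (ENNReal.mul_ne_top (by simp) hCK) h0
  · have h0 := hG 0
    rw [QPCocycle.partialProd, sub_zero, pow_zero, mul_one] at h0
    exact h0.trans (ENNReal.ofReal_le_ofReal (by norm_num))
  · rw [← ENNReal.ofReal_one]
    exact ENNReal.ofReal_le_ofReal (by norm_num)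

end Convergence

section Conclusion

variable {α ρ n η c : ℝ} {A B : ℝ → Matrix (Fin 2) (Fin 2) ℝ} {lam : ℂ} {F : PS} {m : ℤ}

lemma continuous_cmat : Continuous fun p : ℂ × ℂ => cmat p.1 p.2 := by
  refine continuous_matrix fun i j => ?_
  fin_cases i <;> fin_cases j <;> simp only [cmat] <;> simp <;> fun_prop

lemma tendsto_ev {P : ℕ → PS} {G : PS} (hP : ∀ j, Rapid2 (P j)) (hG : Rapid2 G)
    (h : Filter.Tendsto (fun j => nrm2 1 (G - P j)) Filter.atTop (nhds 0)) (x : ℝ) :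
    Filter.Tendsto (fun j => evm (P j) x) Filter.atTop (nhds (evm G x)) := by
  have key : ∀ j, ‖ev G.1 x - ev (P j).1 x‖ₑ + ‖ev G.2 x - ev (P j).2 x‖ₑ ≤ nrm2 1 (G - P j) :=
    fun j => by
      rw [← ev_sub (fst_ne_top hG.one) (fst_ne_top (hP j).one),
        ← ev_sub (snd_ne_top hG.one) (snd_ne_top (hP j).one)]
      exact add_le_add (enorm_ev_le x) (enorm_ev_le x)
  have aux : ∀ {u : ℕ → ℂ} {v : ℂ}, (∀ j, ‖v - u j‖ₑ ≤ nrm2 1 (G - P j)) →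
      Filter.Tendsto u Filter.atTop (nhds v) := fun {u v} hu => by
    rw [tendsto_iff_edist_tendsto_0]
    refine tendsto_of_tendsto_of_tendsto_of_le_of_le tendsto_const_nhds h (fun _ => zero_le)
      fun j => ?_
    rw [edist_comm, edist_eq_enorm_sub]
    exact hu j
  have h1 := aux fun j => le_self_add.trans (key j)
  have h2 := aux fun j => le_add_self.trans (key j)
  have h3 := (continuous_cmat.tendsto (ev G.1 x, ev G.2 x)).comp (h1.prodMk_nhds h2)
  simpa only [evm, Function.comp_def] using h3

/-- A conjugacy to a constant of positive determinant can be normalized. -/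
lemma exists_rot_of_conj (hA : ∀ x, (A x).det = 1) (hB : ContDiff ℝ (⊤ : ℕ∞) B)
    (hBp : ∀ x, B (x + 2) = B x) (hBd : ∀ x, 0 < (B x).det)
    (hAB : ∀ x, A x * B x = B (x + α) * cmat lam 0) :
    ∃ B : ℝ → Matrix (Fin 2) (Fin 2) ℝ,
      ContDiff ℝ (⊤ : ℕ∞) B ∧ (∀ x, B (x + 2) = B x) ∧ (∀ x, (B x).det = 1) ∧
      ∃ φ₀ : ℝ, ∀ x, (B (x + α))⁻¹ * A x * B x = Rot φ₀ := by
  have hl : ‖lam‖ = 1 := by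
    have := norm_bounds_of_conj (c := 0) (a := 0) (b := 0) hA hB.continuous hBp hBd
      (by simp) (by simpa using hAB)
    linarith [this.1, this.2]
  have hdet : ∀ x, (B (x + α)).det = (B x).det := fun x => by
    have := congrArg Matrix.det (hAB x)
    rw [Matrix.det_mul, Matrix.det_mul, hA, det_cmat, hl] at this
    simpa using this.symm
  have hsm : ContDiff ℝ (⊤ : ℕ∞) fun x => (B x).det := by
    have h : ∀ i j, ContDiff ℝ (⊤ : ℕ∞) fun x => B x i j := fun i j =>
      contDiff_pi.1 (contDiff_pi.1 hB i) j
    simp only [Matrix.det_fin_two]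
    exact ((h 0 0).mul (h 1 1)).sub ((h 0 1).mul (h 1 0))
  have hs : ∀ x, Real.sqrt (B x).det ≠ 0 := fun x => (Real.sqrt_pos.2 (hBd x)).ne'
  refine ⟨fun x => (Real.sqrt (B x).det)⁻¹ • B x,
    ((hsm.sqrt fun x => (hBd x).ne').inv hs).smul hB, fun x => by simp only [hBp],
    fun x => ?_, lam.arg, fun x => ?_⟩
  · rw [Matrix.det_smul, Fintype.card_fin, inv_pow, Real.sq_sqrt (hBd x).le,
      inv_mul_cancel₀ (hBd x).ne']
  · have hu : IsUnit ((Real.sqrt (B (x + α)).det)⁻¹ • B (x + α)).det := by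
      rw [Matrix.det_smul]
      exact (mul_pos (pow_pos (inv_pos.2 (Real.sqrt_pos.2 (hBd _))) _) (hBd _)).ne'.isUnit
    have h1 : A x * ((Real.sqrt (B x).det)⁻¹ • B x) =
        ((Real.sqrt (B (x + α)).det)⁻¹ • B (x + α)) * cmat lam 0 := by
      rw [Matrix.mul_smul, hAB, hdet, Matrix.smul_mul]
    have h2 : Complex.exp (lam.arg * Complex.I) = lam := by
      have := Complex.norm_mul_exp_arg_mul_I lam
      rwa [hl, Complex.ofReal_one, one_mul] at this
    dsimp only
    rw [Matrix.mul_assoc, h1, ← Matrix.mul_assoc, Matrix.nonsing_inv_mul _ hu, one_mul, Rot_eq_cmat,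
      h2]

/-- An almost constant cocycle with nonresonant rotation number is reducible. -/
theorem Good.exists_reducible (g : Good α A n B lam F m) (hA : ∀ x, (A x).det = 1)
    (hρ : IsFiberedRotNum α A ρ) (hn : 2 ^ 20 ≤ n) (hη0 : 0 < η) (hη : 1 ≤ n * η)
    (hα : ∀ k : ℤ, k ≠ 0 → 4 * η ^ 2 / (k : ℝ) ^ 2 ≤ ‖ex (k * α) - 1‖)
    (hc0 : 0 < c) (hc : ∀ k l : ℤ, c / ((k : ℝ) ^ 2 + 1) ≤ |2 * ρ - k * α - l|) :
    ∃ B : ℝ → Matrix (Fin 2) (Fin 2) ℝ,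
      ContDiff ℝ (⊤ : ℕ∞) B ∧ (∀ x, B (x + 2) = B x) ∧ (∀ x, (B x).det = 1) ∧
      ∃ φ₀ : ℝ, ∀ x, (B (x + α))⁻¹ * A x * B x = Rot φ₀ := by
  obtain ⟨J, hJ⟩ := exists_scale_ge hn c⁻¹
  have hNR : ∀ k l : ℤ, 2 * ρ - k * α - l ≠ 0 := fun k l h => by
    have := hc k l
    rw [h, abs_zero] at this
    exact absurd this (not_le.2 (by positivity))
  obtain ⟨B₀, l₀, F₀, m₀, g₀⟩ := g.exists_scale hA hρ hNR hn hη0 hη hα J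
  have hnN : n ≤ scale n J := scale_mono hn (Nat.zero_le J)
  obtain ⟨N, hNe⟩ : ∃ N, N = scale n J := ⟨_, rfl⟩
  rw [← hNe] at g₀ hJ hnN
  have hN : 2 ^ 20 ≤ N := hn.trans hnN
  have hcn : 1 ≤ c * N := by
    calc 1 = c * c⁻¹ := (mul_inv_cancel₀ hc0.ne').symm
      _ ≤ _ := by gcongr
  obtain ⟨Bs, ls, Fs, Xs, hB0, hg, hBs, hlow, hXF, hX, hls, hstep, hap⟩ :=
    g₀.exists_seq hA hρ hN hη0 (hη.trans (by gcongr)) hα hc0 hc hcn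
  have hs1 : ∀ j, 1 ≤ scale N j := fun j => by linarith [le_scale hN j]
  have hs0 : ∀ j, 0 < scale N j := fun j => one_pos.trans_le (hs1 j)
  have hF40 : ∀ j, nrm2 1 (Fs j) ≤ ENNReal.ofReal (scale N j ^ 40)⁻¹ := fun j =>
    (hg j).nrm2_one_le (le_scale hN j)
  have hXr : ∀ j, Rapid2 (Xs j) := fun j =>
    rapid2_of_low (ne_top_of_le_ne_top ENNReal.ofReal_ne_top (hX j)) (hlow j).1 (hlow j).2
  have h8 : ∀ j, (8 : ℝ≥0∞) ^ j = ENNReal.ofReal (8 ^ j) := fun j => by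
    rw [ENNReal.ofReal_pow (by norm_num), ENNReal.ofReal_ofNat]
  have h8j : ∀ j, (8 : ℝ) ^ j ≤ scale N j := fun j =>
    (le_mul_of_one_le_left (by positivity) (by norm_num)).trans (scale_ge hN j)
  obtain ⟨G, hGr, hG2, hGl⟩ := exists_partialProd_limit (Xs := Xs) (fun j => by
    rw [h8]
    refine (mul_le_mul' (hX j) le_rfl).trans ?_
    rw [← ENNReal.ofReal_mul (by positivity)]
    refine ENNReal.ofReal_le_ofReal ?_
    have h1 : (8 : ℝ) ≤ scale N j := by linarith [le_scale hN j]
    have h2 : scale N j ^ 2 ≤ scale N j ^ 20 := pow_le_pow_right₀ (hs1 j) (by norm_num)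
    rw [inv_mul_le_iff₀ (by have := hs0 j; positivity)]
    nlinarith [h8j j]) (fun r => by
    obtain ⟨C, hC, hCe⟩ := exists_decay hN (fun j => (hg j).rapid) hF40 hX hstep hap (5 * r)
    refine ⟨2 ^ r * 3 * C, ENNReal.mul_ne_top (ENNReal.mul_ne_top (by simp) (by simp)) hC,
      fun j => ?_⟩
    have h1 : nrm2 (wt 1 r) (Xs j) ≤
        (2 ^ r * ENNReal.ofReal (scale N j) ^ (5 * r)) * nrm2 1 (Xs j) := by
      refine nrm2_le_of_low (hlow j).1 (hlow j).2 fun k hk => ?_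
      rw [Pi.one_apply, mul_one]
      refine (wt_le_of_abs_le one_pos r hk).trans ?_
      have : (2 : ℝ≥0∞) = ENNReal.ofReal 2 := by simp
      rw [this, ← ENNReal.ofReal_pow (by norm_num), ← ENNReal.ofReal_pow (hs0 j).le,
        ← ENNReal.ofReal_mul (by positivity)]
      refine ENNReal.ofReal_le_ofReal ?_
      rw [pow_mul, ← mul_pow]
      have := one_le_pow₀ (n := 5) (hs1 j)
      gcongr
      linarith
    have h1' : 1 ≤ ENNReal.ofReal (scale N j) := by
      rw [← ENNReal.ofReal_one]; exact ENNReal.ofReal_le_ofReal (hs1 j)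
    calc nrm2 (wt 1 r) (Xs j) * 8 ^ j
        ≤ ((2 ^ r * ENNReal.ofReal (scale N j) ^ (5 * r)) *
          (3 * (ENNReal.ofReal (scale N j ^ 16) * nrm2 1 (Fs j)))) * ENNReal.ofReal (scale N j) :=
          mul_le_mul' (h1.trans (mul_le_mul' le_rfl (hXF j))) (ofReal_scale_ge hN j)
      _ = 2 ^ r * 3 * (nrm2 1 (Fs j) * ENNReal.ofReal (scale N j) ^ (17 + 5 * r)) := by
          rw [ENNReal.ofReal_pow (hs0 j).le]; ring
      _ ≤ 2 ^ r * 3 * (nrm2 1 (Fs j) * ENNReal.ofReal (scale N j) ^ (40 + 5 * r)) :=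
          mul_le_mul' le_rfl (mul_le_mul' le_rfl (pow_le_pow_right₀ h1' (by omega)))
      _ ≤ _ := mul_le_mul' le_rfl (hCe j))
  have hprod : ∀ j x, Bs j x = B₀ x * (1 + evm (partialProd Xs j) x) := fun j x => by
    induction j with
    | zero =>
      have : evm (partialProd Xs 0) x = 0 := by
        ext i j; fin_cases i <;> fin_cases j <;> simp [partialProd, evm, ev, cmat]
      rw [hB0, this, add_zero, mul_one]
    | succ j ih => rw [hBs, ih, Matrix.mul_assoc, one_add_evm_partialProd hXr]
  have hgeo : Filter.Tendsto (fun j : ℕ => (2⁻¹ : ℝ≥0∞) ^ j) Filter.atTop (nhds 0) :=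
    ENNReal.tendsto_pow_atTop_nhds_zero_of_lt_one (by simp)
  have hPG : ∀ x, Filter.Tendsto (fun j => Bs j x) Filter.atTop
      (nhds (B₀ x * (1 + evm G x))) := fun x => by
    simp only [hprod]
    exact tendsto_const_nhds.mul (tendsto_const_nhds.add (tendsto_ev
      (fun j => Rapid2.partialProd hXr j) hGr
      (tendsto_of_tendsto_of_tendsto_of_le_of_le tendsto_const_nhds hgeo (fun _ => zero_le) hGl) x))
  have hsj : ∀ j k, 1 ≤ k → (scale N j ^ k)⁻¹ ≤ (1 / 2) ^ j := fun j k hk => by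
    rw [one_div, inv_pow]
    refine inv_anti₀ (by positivity) (le_trans ?_ (le_self_pow₀ (hs1 j) (by omega)))
    exact (pow_le_pow_left₀ (by norm_num) (by norm_num) j).trans (h8j j)
  have hF0 : ∀ x, Filter.Tendsto (fun j => evm (Fs j) x) Filter.atTop (nhds 0) := fun x => by
    have h0 : evm (0 : PS) x = 0 := by
      ext i j; fin_cases i <;> fin_cases j <;> simp [evm, ev, cmat]
    rw [← h0]
    refine tendsto_ev (fun j => (hg j).rapid) rapid2_zero ?_ x
    refine tendsto_of_tendsto_of_tendsto_of_le_of_le tendsto_const_nhds hgeo (fun _ => zero_le)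
      fun j => ?_
    dsimp only
    rw [zero_sub, nrm2_neg]
    refine (hF40 j).trans ((ENNReal.ofReal_le_ofReal (hsj j 40 (by norm_num))).trans ?_)
    rw [ENNReal.ofReal_pow (by norm_num), one_div, ENNReal.ofReal_inv_of_pos (by norm_num)]
    simp
  have hcau : CauchySeq ls := cauchySeq_of_le_geometric (1 / 2) 2 (by norm_num) fun j => by
    rw [dist_comm, dist_eq_norm]
    refine (hls j).trans ?_
    gcongr
    exact hsj j 40 (by norm_num)
  obtain ⟨l, hl⟩ := cauchySeq_tendsto_of_complete hcau
  refine exists_rot_of_conj (B := fun x => B₀ x * (1 + evm G x)) (lam := l) hA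
    (contDiff_matrix_mul g₀.smooth (contDiff_const.add hGr.contDiff_evm))
    (fun x => ?_) (fun x => ?_) fun x => ?_
  · have : evm G (x + 2) = evm G x := by
      rw [show x + 2 = x + 1 + 1 by ring, evm_add_one, evm_add_one]
    rw [g₀.per, this]
  · rw [Matrix.det_mul]
    exact mul_pos (g₀.det x) (det_one_add_evm_pos hG2 x)
  · have h1 : Filter.Tendsto (fun j => A x * Bs j x) Filter.atTop
        (nhds (A x * (B₀ x * (1 + evm G x)))) := tendsto_const_nhds.mul (hPG x)
    have h2 : Filter.Tendsto (fun j => Bs j (x + α) * (cmat (ls j) 0 + evm (Fs j) x)) Filter.atTop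
        (nhds (B₀ (x + α) * (1 + evm G (x + α)) * (cmat l 0 + 0))) :=
      (hPG _).mul (((continuous_cmat.tendsto (l, 0)).comp
        (hl.prodMk_nhds tendsto_const_nhds)).add (hF0 x))
    rw [add_zero] at h2
    refine tendsto_nhds_unique h1 (h2.congr fun j => ((hg j).eqn x).symm)

end Conclusion

section Families

variable {ι : Type*} {g h : ι → ℝ} {s : ℕ} {f k : ι → ℝ → ℂ}

/-- A family of smooth `1`-periodic functions whose derivatives up to order `s` are
`O(g)`, uniformly in the family. -/
structure OB (g : ι → ℝ) (s : ℕ) (f : ι → ℝ → ℂ) : Prop where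
  smooth : ∀ i, ContDiff ℝ (⊤ : ℕ∞) (f i)
  per : ∀ i x, f i (x + 1) = f i x
  nonneg : ∀ i, 0 ≤ g i
  bd : ∃ C, 0 ≤ C ∧ ∀ i, ∀ l ≤ s, ∀ x, ‖iteratedDeriv l (f i) x‖ ≤ C * g i

lemma OB.differentiable (hf : OB g s f) (i : ι) : Differentiable ℝ (f i) :=
  (hf.smooth i).differentiable (by simp)

lemma OB.continuous (hf : OB g s f) (i : ι) : Continuous (f i) := (hf.smooth i).continuous

lemma OB.mono {s' : ℕ} (hf : OB g s f) (hs : s' ≤ s) : OB g s' f := by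
  obtain ⟨C, hC, h⟩ := hf.bd
  exact ⟨hf.smooth, hf.per, hf.nonneg, C, hC, fun i l hl => h i l (hl.trans hs)⟩

lemma OB.of_le (hf : OB g s f) (hh : ∀ i, 0 ≤ h i) {K : ℝ} (hK : 0 ≤ K)
    (hgh : ∀ i, g i ≤ K * h i) : OB h s f := by
  obtain ⟨C, hC, hb⟩ := hf.bd
  refine ⟨hf.smooth, hf.per, hh, C * K, by positivity, fun i l hl x => (hb i l hl x).trans ?_⟩
  rw [mul_assoc]
  exact mul_le_mul_of_nonneg_left (hgh i) hC

lemma OB.congr {f' : ι → ℝ → ℂ} (hf : OB g s f) (h : ∀ i x, f' i x = f i x) : OB g s f' := by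
  have : f' = f := funext fun i => funext (h i)
  rwa [this]

lemma OB.sup (hf : OB g s f) : ∃ C, 0 ≤ C ∧ ∀ i x, ‖f i x‖ ≤ C * g i := by
  obtain ⟨C, hC, hb⟩ := hf.bd
  exact ⟨C, hC, fun i x => by simpa using hb i 0 (Nat.zero_le _) x⟩

lemma ob_zero {C : ℝ} (h1 : ∀ i, ContDiff ℝ (⊤ : ℕ∞) (f i)) (h2 : ∀ i x, f i (x + 1) = f i x)
    (h3 : ∀ i, 0 ≤ g i) (hC : 0 ≤ C) (h4 : ∀ i x, ‖f i x‖ ≤ C * g i) : OB g 0 f := by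
  refine ⟨h1, h2, h3, C, hC, fun i l hl x => ?_⟩
  obtain rfl : l = 0 := by omega
  simpa using h4 i x

lemma OB.deriv (hf : OB g (s + 1) f) : OB g s fun i => deriv (f i) := by
  obtain ⟨C, hC, hb⟩ := hf.bd
  refine ⟨fun i => ((contDiff_infty_iff_deriv (𝕜 := ℝ)).1 (hf.smooth i)).2, fun i x => ?_,
    hf.nonneg, C, hC, fun i l hl x => ?_⟩
  · rw [← deriv_comp_add_const]
    exact congrArg (fun u => _root_.deriv u x) (funext (hf.per i))
  · rw [← iteratedDeriv_succ']
    exact hb i (l + 1) (by omega) x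

lemma OB.succ (hf : OB g 0 f) (hd : OB g s fun i => _root_.deriv (f i)) : OB g (s + 1) f := by
  obtain ⟨C, hC, hb⟩ := hf.bd
  obtain ⟨D, hD, hb'⟩ := hd.bd
  refine ⟨hf.smooth, hf.per, hf.nonneg, C + D, by positivity, fun i l hl x => ?_⟩
  have := hf.nonneg i
  rcases l with _ | l
  · refine (hb i 0 le_rfl x).trans ?_
    gcongr
    linarith
  · rw [iteratedDeriv_succ']
    refine (hb' i l (by omega) x).trans ?_
    gcongr
    linarith

lemma OB.add (hf : OB g s f) (hk : OB g s k) : OB g s fun i x => f i x + k i x := by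
  induction s generalizing f k with
  | zero =>
    obtain ⟨C, hC, hb⟩ := hf.sup
    obtain ⟨D, hD, hb'⟩ := hk.sup
    refine ob_zero (C := C + D) (fun i => (hf.smooth i).add (hk.smooth i))
      (fun i x => by rw [hf.per, hk.per]) hf.nonneg (by positivity) fun i x => ?_
    rw [add_mul]
    exact (norm_add_le _ _).trans (add_le_add (hb i x) (hb' i x))
  | succ s ih =>
    obtain ⟨C, hC, hb⟩ := hf.sup
    obtain ⟨D, hD, hb'⟩ := hk.sup
    refine OB.succ (ob_zero (C := C + D) (fun i => (hf.smooth i).add (hk.smooth i))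
      (fun i x => by rw [hf.per, hk.per]) hf.nonneg (by positivity) fun i x => ?_)
      ((ih hf.deriv hk.deriv).congr fun i x => ?_)
    · rw [add_mul]
      exact (norm_add_le _ _).trans (add_le_add (hb i x) (hb' i x))
    · exact deriv_fun_add (hf.differentiable i x) (hk.differentiable i x)

lemma OB.mul (hf : OB g s f) (hk : OB h s k) :
    OB (fun i => g i * h i) s fun i x => f i x * k i x := by
  have key : ∀ {f k : ι → ℝ → ℂ} {s : ℕ}, OB g s f → OB h s k →
      OB (fun i => g i * h i) 0 fun i x => f i x * k i x := fun {f k s} hf hk => by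
    obtain ⟨C, hC, hb⟩ := hf.sup
    obtain ⟨D, hD, hb'⟩ := hk.sup
    refine ob_zero (C := C * D) (fun i => (hf.smooth i).mul (hk.smooth i))
      (fun i x => by rw [hf.per, hk.per]) (fun i => mul_nonneg (hf.nonneg i) (hk.nonneg i))
      (by positivity) fun i x => ?_
    rw [norm_mul, mul_mul_mul_comm]
    exact mul_le_mul (hb i x) (hb' i x) (norm_nonneg _) (mul_nonneg hC (hf.nonneg i))
  induction s generalizing f k with
  | zero => exact key hf hk
  | succ s ih =>
    refine OB.succ (key hf hk) (((ih hf.deriv (hk.mono (by omega))).add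
      (ih (hf.mono (by omega)) hk.deriv)).congr fun i x => ?_)
    exact deriv_fun_mul (hf.differentiable i x) (hk.differentiable i x)

lemma ob_const {c : ι → ℂ} (hg : ∀ i, 0 ≤ g i) {C : ℝ} (hC : 0 ≤ C) (hc : ∀ i, ‖c i‖ ≤ C * g i) :
    OB g s fun i _ => c i := by
  refine ⟨fun i => contDiff_const, fun i x => rfl, hg, C, hC, fun i l hl x => ?_⟩
  rw [iteratedDeriv_const]
  split_ifs
  · exact hc i
  · simpa using mul_nonneg hC (hg i)

lemma ob_const_one (c : ℂ) : OB (fun _ : ι => 1) s fun _ _ => c :=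
  ob_const (fun _ => zero_le_one) (norm_nonneg c) fun i => by simp

lemma OB.smul {c : ι → ℂ} {C : ℝ} (hf : OB g s f) (hc : ∀ i, ‖c i‖ ≤ C) :
    OB g s fun i x => c i * f i x := by
  have := (ob_const (s := s) (g := fun _ : ι => 1) (c := c) (C := max C 0) (fun _ => zero_le_one)
    (le_max_right _ _) fun i => by simp [hc i]).mul hf
  simpa using this

lemma OB.neg (hf : OB g s f) : OB g s fun i x => -f i x :=
  (hf.smul (c := fun _ => -1) (C := 1) (by simp)).congr fun _ _ => by simp

lemma OB.sub (hf : OB g s f) (hk : OB g s k) : OB g s fun i x => f i x - k i x :=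
  (hf.add hk.neg).congr fun i x => sub_eq_add_neg _ _

/-- Multiplication by a bounded family. -/
lemma OB.mul_one (hf : OB g s f) (hk : OB (fun _ => 1) s k) : OB g s fun i x => f i x * k i x := by
  simpa using hf.mul hk

lemma OB.one_mul (hf : OB (fun _ => 1) s f) (hk : OB g s k) : OB g s fun i x => f i x * k i x := by
  simpa using hf.mul hk

lemma OB.star (hf : OB g s f) : OB g s fun i x => conj (f i x) := by
  have key : ∀ {f : ι → ℝ → ℂ} {s : ℕ}, OB g s f → OB g 0 fun i x => conj (f i x) :=
    fun {f s} hf => by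
      obtain ⟨C, hC, hb⟩ := hf.sup
      exact ob_zero (fun i => Complex.conjCLE.contDiff.comp (hf.smooth i))
        (fun i x => by rw [hf.per]) hf.nonneg hC fun i x => by simpa using hb i x
  induction s generalizing f with
  | zero => exact key hf
  | succ s ih =>
    refine OB.succ (key hf) ((ih hf.deriv).congr fun i x => ?_)
    exact ((hf.differentiable i x).hasDerivAt.star).deriv

lemma OB.shift (hf : OB g s f) (τ : ι → ℝ) : OB g s fun i x => f i (x + τ i) := by
  obtain ⟨C, hC, hb⟩ := hf.bd
  refine ⟨fun i => (hf.smooth i).comp (contDiff_id.add contDiff_const), fun i x => ?_, hf.nonneg, C,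
    hC, fun i l hl x => ?_⟩
  · rw [add_right_comm, hf.per]
  · rw [iteratedDeriv_comp_add_const]
    exact hb i l hl _

lemma OB.sum {κ : Type*} {F : κ → ι → ℝ → ℂ} (t : Finset κ) (hg : ∀ i, 0 ≤ g i)
    (hF : ∀ j ∈ t, OB g s (F j)) : OB g s fun i x => ∑ j ∈ t, F j i x := by
  classical
  induction t using Finset.induction_on with
  | empty =>
    exact (ob_const (c := fun _ : ι => 0) (C := 0) hg le_rfl (by simp)).congr fun i x => by simp
  | insert a t ha ih =>
    refine ((hF a (by simp)).add (ih fun j hj => hF j (by simp [hj]))).congr fun i x => ?_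
    rw [Finset.sum_insert ha]

lemma OB.prod {κ : Type*} {F : κ → ι → ℝ → ℂ} (t : Finset κ)
    (hF : ∀ j ∈ t, OB (fun _ => 1) s (F j)) : OB (fun _ => 1) s fun i x => ∏ j ∈ t, F j i x := by
  classical
  induction t using Finset.induction_on with
  | empty => exact (ob_const_one 1).congr fun i x => by simp
  | insert a t ha ih =>
    refine ((hF a (by simp)).mul_one (ih fun j hj => hF j (by simp [hj]))).congr fun i x => ?_
    rw [Finset.prod_insert ha]

lemma OB.sub_shift {η α θ : ι → ℝ} (hf : OB g (s + 1) f) (hη : ∀ i, |α i - θ i| ≤ η i) :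
    OB (fun i => η i * g i) s fun i x => f i (x + α i) - f i (x + θ i) := by
  have hη0 : ∀ i, 0 ≤ η i := fun i => (abs_nonneg _).trans (hη i)
  have key : ∀ {f : ι → ℝ → ℂ} {s : ℕ}, OB g (s + 1) f →
      OB (fun i => η i * g i) 0 fun i x => f i (x + α i) - f i (x + θ i) := fun {f s} hf => by
    obtain ⟨C, hC, hb⟩ := hf.deriv.sup
    refine ob_zero (fun i => ((hf.shift α).smooth i).sub ((hf.shift θ).smooth i))
      (fun i x => by rw [(hf.shift α).per, (hf.shift θ).per])
      (fun i => mul_nonneg (hη0 i) (hf.nonneg i)) hC fun i x => ?_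
    have h1 := convex_univ.norm_image_sub_le_of_norm_deriv_le (f := f i) (C := C * g i)
      (fun y _ => hf.differentiable i y) (fun y _ => hb i y) (Set.mem_univ (x + θ i))
      (Set.mem_univ (x + α i))
    refine h1.trans ?_
    rw [add_sub_add_left_eq_sub, Real.norm_eq_abs, mul_comm (η i), ← mul_assoc]
    exact mul_le_mul_of_nonneg_left (hη i) (mul_nonneg hC (hf.nonneg i))
  induction s generalizing f with
  | zero => exact key hf
  | succ s ih =>
    refine OB.succ (key hf) ((ih hf.deriv).congr fun i x => ?_)
    rw [deriv_fun_sub ((hf.shift α).differentiable i x) ((hf.shift θ).differentiable i x),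
      deriv_comp_add_const, deriv_comp_add_const]

lemma OB.pow (hf : OB (fun _ => 1) s f) (m : ℕ) : OB (fun _ => 1) s fun i x => f i x ^ m := by
  refine (OB.prod (F := fun _ => f) (Finset.range m) fun _ _ => hf).congr fun i x => by simp

lemma OB.of_ode {m : ℕ} (hf : OB (fun _ => 1) 0 f) (hk : OB (fun _ => 1) s k)
    (hfk : ∀ i x, _root_.deriv (f i) x = k i x * f i x ^ m) : OB (fun _ => 1) (s + 1) f := by
  induction s with
  | zero => exact hf.succ ((hk.mul_one (hf.pow m)).congr hfk)
  | succ s ih => exact hf.succ ((hk.mul_one ((ih (hk.mono (by omega))).pow m)).congr hfk)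

lemma OB.inv (hf : OB (fun _ => 1) s f) {c : ℝ} (hc0 : 0 < c) (hc : ∀ i x, c ≤ ‖f i x‖) :
    OB (fun _ => 1) s fun i x => (f i x)⁻¹ := by
  have hne : ∀ i x, f i x ≠ 0 := fun i x => norm_pos_iff.1 (hc0.trans_le (hc i x))
  have h0 : OB (fun _ => 1) 0 fun i x => (f i x)⁻¹ := by
    refine ob_zero (C := c⁻¹) (fun i => (hf.smooth i).inv (hne i)) (fun i x => by rw [hf.per])
      (by simp) (by positivity) fun i x => ?_
    rw [norm_inv, _root_.mul_one]
    exact inv_anti₀ hc0 (hc i x)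
  cases s with
  | zero => exact h0
  | succ s =>
    refine OB.of_ode (m := 2) h0 hf.deriv.neg fun i x => ?_
    rw [((hf.differentiable i x).hasDerivAt.fun_inv (hne i x)).deriv, inv_pow, div_eq_mul_inv]

/-- The inverse square root of a family of positive functions. -/
lemma OB.rsqrt {r : ι → ℝ → ℝ} (hr : OB (fun _ => 1) s fun i x => (r i x : ℂ)) {c : ℝ}
    (hc0 : 0 < c) (hc : ∀ i x, c ≤ r i x) :
    OB (fun _ => 1) s fun i x => (((√(r i x))⁻¹ : ℝ) : ℂ) := by
  have hrs : ∀ i, ContDiff ℝ (⊤ : ℕ∞) (r i) := fun i => by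
    have := Complex.reCLM.contDiff.comp (hr.smooth i)
    simpa [Function.comp_def] using this
  have hrp : ∀ i x, r i (x + 1) = r i x := fun i x => by exact_mod_cast hr.per i x
  have hpos : ∀ i x, 0 < r i x := fun i x => hc0.trans_le (hc i x)
  have hsq : ∀ i x, 0 < √(r i x) := fun i x => Real.sqrt_pos.2 (hpos i x)
  have h0 : OB (fun _ => 1) 0 fun i x => (((√(r i x))⁻¹ : ℝ) : ℂ) := by
    refine ob_zero (C := (√c)⁻¹) (fun i => Complex.ofRealCLM.contDiff.comp
      (((hrs i).sqrt fun x => (hpos i x).ne').inv fun x => (hsq i x).ne'))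
      (fun i x => by rw [hrp]) (by simp) (by positivity) fun i x => ?_
    rw [Complex.norm_real, Real.norm_of_nonneg (inv_nonneg.2 (hsq i x).le), _root_.mul_one]
    exact inv_anti₀ (Real.sqrt_pos.2 hc0) (Real.sqrt_le_sqrt (hc i x))
  cases s with
  | zero => exact h0
  | succ s =>
    refine OB.of_ode (m := 3) h0 (hr.deriv.smul (c := fun _ => -(1 / 2)) (C := 1) (by norm_num))
      fun i x => ?_
    have hd := (((hrs i).differentiable (by simp)) x).hasDerivAt
    have h1 := (hd.sqrt (hpos i x).ne').fun_inv (hsq i x).ne'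
    rw [h1.ofReal_comp.deriv, hd.ofReal_comp.deriv]
    have h2 : (√(r i x) : ℂ) ≠ 0 := by exact_mod_cast (hsq i x).ne'
    push_cast
    field_simp

lemma OB.exp {G : ι → ℝ} (hf : OB G (s + 1) f) (hG : ∀ i, 1 ≤ G i)
    (hE : ∀ i x, ‖Complex.exp (f i x)‖ ≤ 1) :
    OB (fun i => G i ^ s) s fun i x => Complex.exp (f i x) := by
  have h0 : ∀ t : ℕ, OB (fun i => G i ^ t) 0 fun i x => Complex.exp (f i x) := fun t =>
    ob_zero (C := 1) (fun i => (hf.smooth i).cexp) (fun i x => by rw [hf.per])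
      (fun i => pow_nonneg (hf.nonneg i) t) zero_le_one fun i x =>
        (hE i x).trans (by rw [_root_.one_mul]; exact one_le_pow₀ (hG i))
  induction s with
  | zero => exact h0 0
  | succ s ih =>
    refine OB.succ (h0 _) ((((hf.deriv.mono (by omega)).mul (ih (hf.mono (by omega)))).of_le
      (K := 1) (fun i => pow_nonneg (hf.nonneg i) (s + 1)) zero_le_one
      fun i => by rw [pow_succ]; linarith).congr fun i x => ?_)
    rw [((hf.differentiable i x).hasDerivAt.cexp).deriv, mul_comm]

end Families

section FourierCoefficients

variable {f : ℝ → ℂ}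

/-- The Fourier coefficients of a `1`-periodic function. -/
noncomputable def fc (f : ℝ → ℂ) (k : ℤ) : ℂ := ∫ x in (0 : ℝ)..1, ex (-(k * x)) * f x

lemma norm_fc_le {C : ℝ} (h : ∀ x, ‖f x‖ ≤ C) (k : ℤ) : ‖fc f k‖ ≤ C := by
  have := intervalIntegral.norm_integral_le_of_norm_le_const (a := 0) (b := 1) (C := C)
    (f := fun x => ex (-(k * x)) * f x) fun x _ => by rw [norm_mul, norm_ex, one_mul]; exact h x
  simpa [fc] using this

lemma fc_deriv (hf : ContDiff ℝ (⊤ : ℕ∞) f) (hp : ∀ x, f (x + 1) = f x) :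
    fc (deriv f) = dseq (fc f) := by
  funext k
  have h1 : ∀ x : ℝ, HasDerivAt (fun x : ℝ => ex (-(k * x)))
      (-(2 * Real.pi * k * Complex.I) * ex (-(k * x))) x := fun x => by
    have h := hasDerivAt_ex_mul 1 (-k) x
    simp only [Int.cast_neg, one_mul, neg_mul, mul_one] at h
    convert h using 1
    ring
  have h2 : ∀ x : ℝ, HasDerivAt f (deriv f x) x := fun x =>
    ((hf.differentiable (by simp)) x).hasDerivAt
  have hc : Continuous (deriv f) := hf.continuous_deriv (by simp)
  have hec : Continuous fun x : ℝ => ex (-(k * x)) := continuous_ex.comp (by fun_prop)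
  have h3 := intervalIntegral.integral_mul_deriv_eq_deriv_mul (a := 0) (b := 1)
    (u := fun x : ℝ => ex (-(k * x))) (v := f) (fun x _ => h1 x) (fun x _ => h2 x)
    ((continuous_const.mul hec).intervalIntegrable _ _) (hc.intervalIntegrable _ _)
  have h4 : ex (-(k * 1)) * f 1 = ex (-(k * 0)) * f 0 := by
    have := hp 0
    rw [zero_add] at this
    rw [this, mul_zero, neg_zero, ex_zero, mul_one, ← Int.cast_neg, ex_int]
  rw [fc, h3, h4, sub_self, zero_sub, dseq, fc, ← intervalIntegral.integral_neg,
    ← intervalIntegral.integral_const_mul]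
  refine intervalIntegral.integral_congr fun x _ => ?_
  ring

lemma contDiff_deriv (hf : ContDiff ℝ (⊤ : ℕ∞) f) : ContDiff ℝ (⊤ : ℕ∞) (deriv f) :=
  ((contDiff_infty_iff_deriv (𝕜 := ℝ)).1 hf).2

lemma deriv_add_one (hp : ∀ x, f (x + 1) = f x) (x : ℝ) : deriv f (x + 1) = deriv f x := by
  rw [← deriv_comp_add_const]
  exact congrArg (fun u => deriv u x) (funext hp)

lemma norm_fc_mul_le (hf : ContDiff ℝ (⊤ : ℕ∞) f) (hp : ∀ x, f (x + 1) = f x) {C : ℝ} (l : ℕ)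
    (h : ∀ x, ‖iteratedDeriv l f x‖ ≤ C) (k : ℤ) : |(k : ℝ)| ^ l * ‖fc f k‖ ≤ C := by
  induction l generalizing f with
  | zero =>
    rw [pow_zero, one_mul]
    exact norm_fc_le (by simpa using h) k
  | succ l ih =>
    rw [iteratedDeriv_succ'] at h
    have h1 := ih (contDiff_deriv hf) (deriv_add_one hp) h
    refine le_trans ?_ h1
    rw [fc_deriv hf hp, dseq, norm_mul, pow_succ, mul_assoc]
    gcongr
    simp only [norm_mul, Complex.norm_I, mul_one, Complex.norm_real, Complex.norm_intCast,
      Complex.norm_two, Real.norm_of_nonneg Real.pi_pos.le]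
    have := Real.pi_gt_three
    nlinarith [abs_nonneg (k : ℝ)]

/-- The constant in the bound of Fourier coefficients by derivatives. -/
noncomputable def fourierConst (S : ℕ) : ℝ≥0∞ :=
  ENNReal.ofReal (2 ^ (S + 2)) * ∑' k : ℤ, ENNReal.ofReal (1 / (1 + |(k : ℝ)|) ^ 2)

lemma summable_inv_one_add_abs_sq : Summable fun k : ℤ => 1 / (1 + |(k : ℝ)|) ^ 2 := by
  have h := Real.summable_one_div_int_add_rpow 0 2 |>.2 (by norm_num)
  have h' : Summable fun k : ℤ => 1 / ((k : ℝ)) ^ 2 := by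
    refine h.congr fun k => ?_
    rw [add_zero]
    norm_num
  refine Summable.of_norm_bounded_eventually (g := fun k : ℤ => 1 / ((k : ℝ)) ^ 2) h' ?_
  filter_upwards [(Set.finite_singleton (0 : ℤ)).compl_mem_cofinite] with k hk
  have hk0 : (0 : ℝ) < |(k : ℝ)| := abs_pos.2 (by exact_mod_cast hk)
  rw [Real.norm_of_nonneg (by positivity), ← sq_abs (k : ℝ)]
  gcongr
  linarith

lemma fourierConst_ne_top (S : ℕ) : fourierConst S ≠ ∞ :=
  ENNReal.mul_ne_top ENNReal.ofReal_ne_top summable_inv_one_add_abs_sq.tsum_ofReal_ne_top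

lemma nrm_fc_le (hf : ContDiff ℝ (⊤ : ℕ∞) f) (hp : ∀ x, f (x + 1) = f x) {C : ℝ} (S : ℕ)
    (h : ∀ l ≤ S + 2, ∀ x, ‖iteratedDeriv l f x‖ ≤ C) :
    nrm (wt 1 S) (fc f) ≤ fourierConst S * ENNReal.ofReal C := by
  have hC : 0 ≤ C := (norm_nonneg _).trans (h 0 (Nat.zero_le _) 0)
  rw [nrm, fourierConst, mul_comm (ENNReal.ofReal (2 ^ (S + 2))), mul_assoc, ← ENNReal.tsum_mul_right]
  refine ENNReal.tsum_le_tsum fun k => ?_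
  rw [wt, ← ofReal_norm, ← ENNReal.ofReal_mul (by positivity), ← ENNReal.ofReal_mul (by positivity),
    ← ENNReal.ofReal_mul (by positivity)]
  refine ENNReal.ofReal_le_ofReal ?_
  rw [div_one, one_div, inv_mul_eq_div, le_div_iff₀ (by positivity)]
  rw [mul_right_comm, ← pow_add]
  rcases le_or_gt 1 |(k : ℝ)| with hk | hk
  · calc (1 + |(k : ℝ)|) ^ (S + 2) * ‖fc f k‖ ≤ (2 * |(k : ℝ)|) ^ (S + 2) * ‖fc f k‖ := by
          gcongr; linarith
      _ = 2 ^ (S + 2) * (|(k : ℝ)| ^ (S + 2) * ‖fc f k‖) := by rw [mul_pow]; ring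
      _ ≤ _ := by
          gcongr
          exact norm_fc_mul_le hf hp (S + 2) (h _ le_rfl) k
  · have := norm_fc_mul_le hf hp 0 (h 0 (Nat.zero_le _)) k
    rw [pow_zero, one_mul] at this
    gcongr
    linarith

lemma exists_bound_of_periodic {f : ℝ → ℂ} (hf : Continuous f) (hp : ∀ x, f (x + 1) = f x) :
    ∃ C, ∀ x, ‖f x‖ ≤ C := by
  obtain ⟨C, hC⟩ := (show Function.Periodic f 1 from hp).isBounded_of_continuous one_ne_zero hf
    |>.exists_norm_le
  exact ⟨C, fun x => hC _ ⟨x, rfl⟩⟩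

lemma rapid_fc (hf : ContDiff ℝ (⊤ : ℕ∞) f) (hp : ∀ x, f (x + 1) = f x) : Rapid (fc f) := by
  intro r
  have hb : ∀ l : ℕ, ∃ C, ∀ x, ‖iteratedDeriv l f x‖ ≤ C := fun l => by
    have hs : ∀ l, ContDiff ℝ (⊤ : ℕ∞) (iteratedDeriv l f) ∧
        ∀ x, iteratedDeriv l f (x + 1) = iteratedDeriv l f x := fun l => by
      induction l with
      | zero => simpa using ⟨hf, hp⟩
      | succ l ih =>
        rw [iteratedDeriv_succ]
        exact ⟨contDiff_deriv ih.1, deriv_add_one ih.2⟩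
    exact exists_bound_of_periodic (hs l).1.continuous (hs l).2
  choose C hC using hb
  refine ne_top_of_le_ne_top (ENNReal.mul_ne_top (fourierConst_ne_top r) ENNReal.ofReal_ne_top)
    (nrm_fc_le hf hp (C := ∑ l ∈ Finset.range (r + 3), C l) r fun l hl x => (hC l x).trans ?_)
  exact Finset.single_le_sum (f := C) (fun l _ => (norm_nonneg _).trans (hC l 0))
    (Finset.mem_range.2 (by omega))

lemma ev_fc (hf : ContDiff ℝ (⊤ : ℕ∞) f) (hp : ∀ x, f (x + 1) = f x) (x : ℝ) :
    ev (fc f) x = f x := by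
  have : Fact ((0 : ℝ) < 1) := ⟨one_pos⟩
  have hper : Function.Periodic f 1 := hp
  let u : C(AddCircle (1 : ℝ), ℂ) := ⟨hper.lift, continuous_coinduced_dom.2 hf.continuous⟩
  have hu : ∀ y : ℝ, u (y : AddCircle (1 : ℝ)) = f y := fun y => hper.lift_coe y
  have hfou : ∀ (k : ℤ) (y : ℝ), fourier k (y : AddCircle (1 : ℝ)) = ex (k * y) := fun k y => by
    rw [fourier_coe_apply, ex]; congr 1; push_cast; ring
  have hcoef : fourierCoeff u = fc f := by
    funext k
    rw [fourierCoeff_eq_intervalIntegral _ _ 0, fc]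
    simp only [zero_add, div_one, one_smul]
    refine intervalIntegral.integral_congr fun y _ => ?_
    rw [hu, hfou, smul_eq_mul, Int.cast_neg, neg_mul]
  have hsum : Summable (fourierCoeff u) := by
    rw [hcoef]
    exact Summable.of_norm (summable_norm_of_nrm (rapid_fc hf hp).one)
  have h := has_pointwise_sum_fourier_series_of_summable hsum (x : AddCircle (1 : ℝ))
  rw [hu, hcoef] at h
  rw [← h.tsum_eq, ev]
  refine tsum_congr fun k => ?_
  rw [hfou, smul_eq_mul]

end FourierCoefficients

section Coefficients

variable (A B : Matrix (Fin 2) (Fin 2) ℝ) (a b : ℂ)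

lemma ca_cmat : ca (cmat a b) = a := (cmat_inj (cmat_ca_cb (cmat a b))).1

lemma cb_cmat : cb (cmat a b) = b := (cmat_inj (cmat_ca_cb (cmat a b))).2

lemma mul_eq_cmat : A * B =
    cmat (ca A * ca B + cb A * conj (cb B)) (ca A * cb B + cb A * conj (ca B)) := by
  rw [← cmat_mul, cmat_ca_cb, cmat_ca_cb]

lemma ca_mul : ca (A * B) = ca A * ca B + cb A * conj (cb B) := by rw [mul_eq_cmat, ca_cmat]

lemma cb_mul : cb (A * B) = ca A * cb B + cb A * conj (ca B) := by rw [mul_eq_cmat, cb_cmat]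

lemma ca_adjugate : ca A.adjugate = conj (ca A) := by
  rw [Matrix.adjugate_fin_two]
  apply Complex.ext <;> simp [ca] <;> ring

lemma cb_adjugate : cb A.adjugate = -cb A := by
  rw [Matrix.adjugate_fin_two]
  apply Complex.ext <;> simp [cb] <;> ring

lemma det_eq : A.det = ‖ca A‖ ^ 2 - ‖cb A‖ ^ 2 := by rw [← det_cmat, cmat_ca_cb]

lemma trace_eq : A.trace = 2 * (ca A).re := by
  simp [Matrix.trace_fin_two, ca]; ring

variable {A B}

lemma norm_cb_lt (h : A.det = 1) : ‖cb A‖ < ‖ca A‖ := by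
  rw [det_eq] at h
  nlinarith [norm_nonneg (ca A), norm_nonneg (cb A)]

lemma continuous_ca : Continuous ca := by
  have : ca = fun A : Matrix (Fin 2) (Fin 2) ℝ =>
      (((A 0 0 + A 1 1) / 2 : ℝ) : ℂ) + (((A 1 0 - A 0 1) / 2 : ℝ) : ℂ) * Complex.I := by
    funext A; apply Complex.ext <;> simp [ca]
  rw [this]
  have h : ∀ i j, Continuous fun A : Matrix (Fin 2) (Fin 2) ℝ => A i j := fun i j =>
    continuous_id.matrix_elem i j
  have h1 := Complex.continuous_ofReal.comp (((h 0 0).add (h 1 1)).div_const 2)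
  have h2 := Complex.continuous_ofReal.comp (((h 1 0).sub (h 0 1)).div_const 2)
  exact h1.add (h2.mul continuous_const)

lemma continuous_cb : Continuous cb := by
  have : cb = fun A : Matrix (Fin 2) (Fin 2) ℝ =>
      (((A 0 0 - A 1 1) / 2 : ℝ) : ℂ) + (((A 1 0 + A 0 1) / 2 : ℝ) : ℂ) * Complex.I := by
    funext A; apply Complex.ext <;> simp [cb]
  rw [this]
  have h : ∀ i j, Continuous fun A : Matrix (Fin 2) (Fin 2) ℝ => A i j := fun i j =>
    continuous_id.matrix_elem i j
  have h1 := Complex.continuous_ofReal.comp (((h 0 0).sub (h 1 1)).div_const 2)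
  have h2 := Complex.continuous_ofReal.comp (((h 1 0).add (h 0 1)).div_const 2)
  exact h1.add (h2.mul continuous_const)

end Coefficients

section PeriodicArgument

variable {a b : ℝ → ℂ}

/-- The function `a` has a continuous periodic argument. -/
def PerArg (a : ℝ → ℂ) : Prop :=
  ∃ Ψ : ℝ → ℝ, Continuous Ψ ∧ (∀ x, Ψ (x + 1) = Ψ x) ∧ ∀ x, a x = ‖a x‖ * ex (Ψ x)

lemma PerArg.mul (ha : PerArg a) (hb : PerArg b) : PerArg fun x => a x * b x := by
  obtain ⟨Ψ, h1, h2, h3⟩ := ha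
  obtain ⟨Φ, h4, h5, h6⟩ := hb
  refine ⟨fun x => Ψ x + Φ x, h1.add h4, fun x => by simp only [h2, h5], fun x => ?_⟩
  dsimp only
  rw [norm_mul, ex_add]
  conv_lhs => rw [h3 x, h6 x]
  push_cast
  ring

lemma PerArg.star (ha : PerArg a) : PerArg fun x => conj (a x) := by
  obtain ⟨Ψ, h1, h2, h3⟩ := ha
  refine ⟨fun x => -Ψ x, h1.neg, fun x => by simp only [h2], fun x => ?_⟩
  dsimp only
  conv_lhs => rw [h3 x]
  rw [map_mul, Complex.conj_ofReal, conj_ex, RCLike.norm_conj]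

lemma PerArg.shift (ha : PerArg a) (τ : ℝ) : PerArg fun x => a (x + τ) := by
  obtain ⟨Ψ, h1, h2, h3⟩ := ha
  exact ⟨fun x => Ψ (x + τ), by fun_prop, fun x => by simp only [add_right_comm x 1 τ, h2], fun x => h3 _⟩

lemma PerArg.of_re_pos (ha : Continuous a) (hp : ∀ x, a (x + 1) = a x) (hre : ∀ x, 0 < (a x).re) :
    PerArg a := by
  refine ⟨fun x => (a x).arg / (2 * Real.pi), ?_, fun x => by simp only [hp], fun x => ?_⟩
  · refine Continuous.div_const ?_ _
    exact continuous_iff_continuousAt.2 fun x =>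
      (Complex.continuousAt_arg (Or.inl (hre x))).comp ha.continuousAt
  · conv_lhs => rw [← Complex.norm_mul_exp_arg_mul_I (a x)]
    rw [ex]
    congr 2
    push_cast
    have := Real.pi_ne_zero
    field_simp

lemma norm_div_mul_lt_one {a b c d : ℂ} (hb : ‖b‖ < ‖a‖) (hd : ‖d‖ < ‖c‖) :
    ‖b * d / (a * c)‖ < 1 := by
  have ha := (norm_nonneg _).trans_lt hb
  have hc := (norm_nonneg _).trans_lt hd
  rw [norm_div, norm_mul, norm_mul, div_lt_one (by positivity)]
  exact mul_lt_mul'' hb hd (norm_nonneg _) (norm_nonneg _)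

lemma re_one_add_pos {w : ℂ} (hw : ‖w‖ < 1) : 0 < (1 + w).re := by
  have := (abs_le.1 (Complex.abs_re_le_norm w)).1
  rw [Complex.add_re, Complex.one_re]
  linarith

/-- A smooth periodic map to `SL(2,ℝ)` homotopic to the identity. -/
structure Nice (B : ℝ → Matrix (Fin 2) (Fin 2) ℝ) : Prop where
  smooth : ContDiff ℝ (⊤ : ℕ∞) B
  per : ∀ x, B (x + 1) = B x
  det : ∀ x, (B x).det = 1
  deg : HasDeg B 0
  arg : PerArg fun x => ca (B x)

variable {B D : ℝ → Matrix (Fin 2) (Fin 2) ℝ}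

lemma perArg_ca_mul (hB : Continuous B) (hD : Continuous D) (hBp : ∀ x, B (x + 1) = B x)
    (hDp : ∀ x, D (x + 1) = D x) (hBd : ∀ x, (B x).det = 1) (hDd : ∀ x, (D x).det = 1)
    (h1 : PerArg fun x => ca (B x)) (h2 : PerArg fun x => ca (D x)) :
    PerArg fun x => ca (B x * D x) := by
  have hB0 : ∀ x, ca (B x) ≠ 0 := fun x =>
    norm_pos_iff.1 ((norm_nonneg _).trans_lt (norm_cb_lt (hBd x)))
  have hD0 : ∀ x, ca (D x) ≠ 0 := fun x =>
    norm_pos_iff.1 ((norm_nonneg _).trans_lt (norm_cb_lt (hDd x)))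
  have h3 : PerArg fun x => 1 + cb (B x) * conj (cb (D x)) / (ca (B x) * ca (D x)) := by
    refine PerArg.of_re_pos ?_ (fun x => by rw [hBp, hDp]) fun x => re_one_add_pos
      (norm_div_mul_lt_one (norm_cb_lt (hBd x)) (by rw [RCLike.norm_conj]; exact norm_cb_lt (hDd x)))
    refine continuous_const.add (Continuous.div ?_ ?_ fun x => mul_ne_zero (hB0 x) (hD0 x))
    · exact (continuous_cb.comp hB).mul (Complex.continuous_conj.comp (continuous_cb.comp hD))
    · exact (continuous_ca.comp hB).mul (continuous_ca.comp hD)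
  have h4 := (h1.mul h2).mul h3
  have h5 : (fun x => ca (B x * D x)) = fun x => ca (B x) * ca (D x) *
      (1 + cb (B x) * conj (cb (D x)) / (ca (B x) * ca (D x))) := by
    funext x
    rw [ca_mul, mul_add, mul_one, mul_div_cancel₀ _ (mul_ne_zero (hB0 x) (hD0 x))]
  rwa [h5]

lemma Nice.mul (hB : Nice B) (hD : Nice D) : Nice fun x => B x * D x where
  smooth := contDiff_matrix_mul hB.smooth hD.smooth
  per x := by rw [hB.per, hD.per]
  det x := by rw [Matrix.det_mul, hB.det, hD.det, one_mul]
  deg := by simpa using hB.deg.mul hD.deg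
  arg := perArg_ca_mul hB.smooth.continuous hD.smooth.continuous hB.per hD.per hB.det hD.det
    hB.arg hD.arg

lemma nice_cmat {c : ℝ → ℝ} {u : ℝ → ℂ} (hc : ContDiff ℝ (⊤ : ℕ∞) fun x => (c x : ℂ))
    (hu : ContDiff ℝ (⊤ : ℕ∞) u) (hcp : ∀ x, c (x + 1) = c x) (hup : ∀ x, u (x + 1) = u x)
    (hc0 : ∀ x, 0 < c x) (hcu : ∀ x, c x ^ 2 = 1 + ‖u x‖ ^ 2) :
    Nice fun x => cmat (c x) (u x) where
  smooth := contDiff_cmat hc hu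
  per x := by rw [hcp, hup]
  det x := by rw [det_cmat, Complex.norm_real, Real.norm_eq_abs, sq_abs, hcu]; ring
  deg := hasDeg_cmat hc.continuous hu.continuous fun x => by
    rw [Complex.ofReal_re]
    nlinarith [hcu x, hc0 x, norm_nonneg (u x)]
  arg := by
    simp only [ca_cmat]
    exact PerArg.of_re_pos hc.continuous (fun x => by rw [hcp]) fun x => by simpa using hc0 x

lemma nice_ex {s : ℝ → ℝ} (hs : ContDiff ℝ (⊤ : ℕ∞) fun x => ex (s x)) (hsc : Continuous s)
    (hsp : ∀ x, s (x + 1) = s x) : Nice fun x => cmat (ex (s x)) 0 where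
  smooth := contDiff_cmat hs contDiff_const
  per x := by rw [hsp]
  det x := by rw [det_cmat, norm_ex]; simp
  deg := by
    obtain ⟨C, hC⟩ := exists_bound_of_periodic (f := fun x => (s x : ℂ)) (by fun_prop)
      (fun x => by rw [hsp])
    exact hasDeg_ex hsc (C := C) fun x => by simpa using hC x
  arg := by
    simp only [ca_cmat]
    exact ⟨s, hsc, hsp, fun x => by simp [norm_ex]⟩

/-- The coefficient `ca` of a conjugated cocycle has a periodic argument. -/
lemma perArg_of_conj {A Q : ℝ → Matrix (Fin 2) (Fin 2) ℝ} {α : ℝ} (hA : Continuous A)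
    (hAp : ∀ x, A (x + 1) = A x) (hAd : ∀ x, (A x).det = 1) (hAa : PerArg fun x => ca (A x))
    (hB : Nice B) (hQ : ∀ x, A x * B x = B (x + α) * Q x) : PerArg fun x => ca (Q x) := by
  have h1 : ∀ x, Q x = (B (x + α)).adjugate * (A x * B x) := fun x => by
    rw [hQ, ← Matrix.mul_assoc, Matrix.adjugate_mul, hB.det, one_smul, one_mul]
  have hBs : Continuous fun x => (B (x + α)).adjugate :=
    (hB.smooth.continuous.comp (continuous_add_const α)).matrix_adjugate
  simp only [h1]
  refine perArg_ca_mul hBs (hA.mul hB.smooth.continuous) (fun x => ?_)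
    (fun x => by rw [hAp, hB.per]) (fun x => ?_) (fun x => by
      rw [Matrix.det_mul, hAd, hB.det, one_mul]) ?_
    (perArg_ca_mul hA hB.smooth.continuous hAp hB.per hAd hB.det hAa hB.arg)
  · rw [add_right_comm, hB.per]
  · rw [Matrix.det_adjugate, hB.det]; simp
  · simp only [ca_adjugate]
    exact (hB.arg.shift α).star

lemma perArg_of_isProjLift {A : ℝ → Matrix (Fin 2) (Fin 2) ℝ} {F : ℝ → ℝ → ℝ} (hA : Continuous A)
    (hAp : ∀ x, A (x + 1) = A x) (hAd : ∀ x, (A x).det = 1) (hF : IsProjLift A F) :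
    PerArg fun x => ca (A x) := by
  obtain ⟨hFc, hFp, -, hFa⟩ := hF
  have hA0 : ∀ x, ca (A x) ≠ 0 := fun x =>
    norm_pos_iff.1 ((norm_nonneg _).trans_lt (norm_cb_lt (hAd x)))
  have hw : ∀ x, 0 < (1 + conj (cb (A x) / ca (A x))).re := fun x => re_one_add_pos (by
    rw [RCLike.norm_conj, norm_div, div_lt_one (norm_pos_iff.2 (hA0 x))]
    exact norm_cb_lt (hAd x))
  have h1 : PerArg fun x => ca (A x) + cb (A x) := by
    refine ⟨fun x => F x 0, by fun_prop, fun x => hFp x 0, fun x => ?_⟩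
    obtain ⟨c, hc, h⟩ := actsAs_cmat.1 (show ActsAs (cmat (ca (A x)) (cb (A x))) 0 (F x 0) by
      rw [cmat_ca_cb]; exact hFa x 0)
    rw [ex_zero, map_one, mul_one, mul_one] at h
    dsimp only
    rw [h, norm_mul, norm_ex, mul_one, Complex.norm_real, Real.norm_of_nonneg hc.le]
  have h2 : PerArg fun x => 1 + conj (cb (A x) / ca (A x)) := by
    refine PerArg.of_re_pos (continuous_const.add (Complex.continuous_conj.comp
      ((continuous_cb.comp hA).div (continuous_ca.comp hA) hA0))) (fun x => by rw [hAp]) hw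
  obtain ⟨Ψ, h3, h4, h5⟩ := h1.mul h2
  refine ⟨Ψ, h3, h4, fun x => ?_⟩
  have h6 : (ca (A x) + cb (A x)) * (1 + conj (cb (A x) / ca (A x))) =
      ca (A x) * ((‖1 + cb (A x) / ca (A x)‖ ^ 2 : ℝ) : ℂ) := by
    have : (ca (A x) + cb (A x)) = ca (A x) * (1 + cb (A x) / ca (A x)) := by
      rw [mul_add, mul_one, mul_div_cancel₀ _ (hA0 x)]
    rw [this, mul_assoc, Complex.ofReal_pow, ← Complex.mul_conj', map_add, map_one]
  have h7 : 0 < ‖1 + cb (A x) / ca (A x)‖ := by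
    refine norm_pos_iff.2 fun h0 => (hw x).ne' ?_
    rw [← map_one conj, ← map_add, h0]
    simp
  have h8 := h5 x
  dsimp only at h8
  rw [h6, norm_mul, Complex.norm_real, Real.norm_of_nonneg (by positivity), Complex.ofReal_mul,
    mul_right_comm] at h8
  exact mul_right_cancel₀ (by exact_mod_cast (pow_pos h7 2).ne') h8

end PeriodicArgument

section MatrixFamilies

variable {ι : Type*} {g h : ι → ℝ} {s : ℕ} {P Q : ι → ℝ → Matrix (Fin 2) (Fin 2) ℝ}

/-- `ca` as a continuous linear map. -/
noncomputable def caL : Matrix (Fin 2) (Fin 2) ℝ →L[ℝ] ℂ where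
  toFun := ca
  map_add' A B := by apply Complex.ext <;> simp [ca] <;> ring
  map_smul' c A := by apply Complex.ext <;> simp [ca] <;> ring
  cont := continuous_ca

/-- `cb` as a continuous linear map. -/
noncomputable def cbL : Matrix (Fin 2) (Fin 2) ℝ →L[ℝ] ℂ where
  toFun := cb
  map_add' A B := by apply Complex.ext <;> simp [cb] <;> ring
  map_smul' c A := by apply Complex.ext <;> simp [cb] <;> ring
  cont := continuous_cb

lemma iteratedDeriv_clm_comp {E : Type*} [NormedAddCommGroup E] [NormedSpace ℝ E] (L : E →L[ℝ] ℂ)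
    {A : ℝ → E} (hA : ContDiff ℝ (⊤ : ℕ∞) A) (l : ℕ) (x : ℝ) :
    iteratedDeriv l (fun y => L (A y)) x = L (iteratedDeriv l A x) := by
  have h := L.iteratedFDeriv_comp_left (i := l) (hA.contDiffAt (x := x)) (by exact_mod_cast le_top)
  simp only [iteratedDeriv_eq_iteratedFDeriv]
  change iteratedFDeriv ℝ l (L ∘ A) x _ = _
  rw [h]
  rfl

/-- Both coefficients of a family of matrix functions are bounded by the gauge `g`. -/
structure OBm (g : ι → ℝ) (s : ℕ) (Q : ι → ℝ → Matrix (Fin 2) (Fin 2) ℝ) : Prop where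
  fst : OB g s fun i x => ca (Q i x)
  snd : OB g s fun i x => cb (Q i x)

lemma ob_linear {f : Matrix (Fin 2) (Fin 2) ℝ → ℂ} {M : ℝ}
    (hc : ∀ i, ContDiff ℝ (⊤ : ℕ∞) fun x => f (Q i x))
    (hd : ∀ i l x, iteratedDeriv l (fun y => f (Q i y)) x = f (iteratedDeriv l (Q i) x))
    (hf : ∀ A, ‖f A‖ ≤ 2 * ‖A‖) (h2 : ∀ i x, Q i (x + 1) = Q i x) (hM : 0 ≤ M)
    (h3 : ∀ i, ∀ l ≤ s, ∀ x, ‖iteratedDeriv l (Q i) x‖ ≤ M) :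
    OB (fun _ => 1) s fun i x => f (Q i x) where
  smooth := hc
  per i x := by rw [h2]
  nonneg _ := zero_le_one
  bd := ⟨2 * M, by positivity, fun i l hl x => by
    rw [hd, _root_.mul_one]
    exact (hf _).trans (mul_le_mul_of_nonneg_left (h3 i l hl x) zero_le_two)⟩

lemma norm_ca_le (A : Matrix (Fin 2) (Fin 2) ℝ) : ‖ca A‖ ≤ 2 * ‖A‖ := by
  have h : ∀ i j, |A i j| ≤ ‖A‖ := fun i j => Matrix.norm_entry_le_entrywise_sup_norm A
  have h1 := abs_le.1 (h 0 0)
  have h2 := abs_le.1 (h 0 1)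
  have h3 := abs_le.1 (h 1 0)
  have h4 := abs_le.1 (h 1 1)
  refine (Complex.norm_le_abs_re_add_abs_im _).trans ?_
  have h5 : |(ca A).re| ≤ ‖A‖ := abs_le.2 (by simp only [ca]; constructor <;> linarith)
  have h6 : |(ca A).im| ≤ ‖A‖ := abs_le.2 (by simp only [ca]; constructor <;> linarith)
  linarith

lemma norm_cb_le (A : Matrix (Fin 2) (Fin 2) ℝ) : ‖cb A‖ ≤ 2 * ‖A‖ := by
  have h : ∀ i j, |A i j| ≤ ‖A‖ := fun i j => Matrix.norm_entry_le_entrywise_sup_norm A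
  have h1 := abs_le.1 (h 0 0)
  have h2 := abs_le.1 (h 0 1)
  have h3 := abs_le.1 (h 1 0)
  have h4 := abs_le.1 (h 1 1)
  refine (Complex.norm_le_abs_re_add_abs_im _).trans ?_
  have h5 : |(cb A).re| ≤ ‖A‖ := abs_le.2 (by simp only [cb]; constructor <;> linarith)
  have h6 : |(cb A).im| ≤ ‖A‖ := abs_le.2 (by simp only [cb]; constructor <;> linarith)
  linarith

lemma obm_of_bound {M : ℝ} (h1 : ∀ i, ContDiff ℝ (⊤ : ℕ∞) (Q i)) (h2 : ∀ i x, Q i (x + 1) = Q i x)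
    (hM : 0 ≤ M) (h3 : ∀ i, ∀ l ≤ s, ∀ x, ‖iteratedDeriv l (Q i) x‖ ≤ M) :
    OBm (fun _ => 1) s Q where
  fst := ob_linear (fun i => caL.contDiff.comp (h1 i))
    (fun i l x => iteratedDeriv_clm_comp caL (h1 i) l x) norm_ca_le h2 hM h3
  snd := ob_linear (fun i => cbL.contDiff.comp (h1 i))
    (fun i l x => iteratedDeriv_clm_comp cbL (h1 i) l x) norm_cb_le h2 hM h3

lemma OBm.mono {s' : ℕ} (hQ : OBm g s Q) (hs : s' ≤ s) : OBm g s' Q :=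
  ⟨hQ.fst.mono hs, hQ.snd.mono hs⟩

lemma OBm.mul (hP : OBm (fun _ => 1) s P) (hQ : OBm g s Q) : OBm g s fun i x => P i x * Q i x where
  fst := ((hP.fst.one_mul hQ.fst).add (hP.snd.one_mul hQ.snd.star)).congr fun _ _ => ca_mul _ _
  snd := ((hP.fst.one_mul hQ.snd).add (hP.snd.one_mul hQ.fst.star)).congr fun _ _ => cb_mul _ _

lemma OBm.adjugate (hP : OBm g s P) : OBm g s fun i x => (P i x).adjugate where
  fst := hP.fst.star.congr fun _ _ => ca_adjugate _
  snd := hP.snd.neg.congr fun _ _ => cb_adjugate _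

lemma OBm.shift (hP : OBm g s P) (τ : ι → ℝ) : OBm g s fun i x => P i (x + τ i) :=
  ⟨hP.fst.shift τ, hP.snd.shift τ⟩

lemma obm_one : OBm (fun _ : ι => 1) s fun _ _ => 1 :=
  ⟨ob_const_one (ca 1), ob_const_one (cb 1)⟩

end MatrixFamilies

section FiberProd

variable {A B D : ℝ → Matrix (Fin 2) (Fin 2) ℝ} {θ : ℝ}

lemma fiberProd_zero (x : ℝ) : fiberProd θ A 0 x = 1 := by simp [fiberProd]

lemma fiberProd_succ (n : ℕ) (x : ℝ) :
    fiberProd θ A (n + 1) x = A (x + n * θ) * fiberProd θ A n x := by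
  simp [fiberProd, List.range_succ]

lemma fiberProd_shift_mul (n : ℕ) (x : ℝ) :
    fiberProd θ A n (x + θ) * A x = A (x + n * θ) * fiberProd θ A n x := by
  induction n with
  | zero => simp [fiberProd_zero]
  | succ n ih =>
    rw [fiberProd_succ, mul_assoc, ih, fiberProd_succ]
    congr 2
    push_cast
    ring

lemma det_fiberProd (hA : ∀ x, (A x).det = 1) (n : ℕ) (x : ℝ) : (fiberProd θ A n x).det = 1 := by
  induction n with
  | zero => simp [fiberProd_zero]
  | succ n ih => rw [fiberProd_succ, Matrix.det_mul, hA, ih, one_mul]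

lemma fiberProd_conj (h : ∀ x, A x * B x = B (x + θ) * D x) (n : ℕ) (x : ℝ) :
    fiberProd θ A n x * B x = B (x + n * θ) * fiberProd θ D n x := by
  induction n with
  | zero => simp [fiberProd_zero]
  | succ n ih =>
    rw [fiberProd_succ, mul_assoc, ih, ← mul_assoc, h, fiberProd_succ, mul_assoc]
    congr 2
    push_cast
    ring

lemma fiberProd_cmat (a : ℝ → ℂ) (n : ℕ) (x : ℝ) :
    fiberProd θ (fun y => cmat (a y) 0) n x = cmat (∏ j ∈ Finset.range n, a (x + j * θ)) 0 := by
  induction n with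
  | zero => simp [fiberProd_zero, cmat_one]
  | succ n ih => rw [fiberProd_succ, ih, cmat_mul, Finset.prod_range_succ, mul_comm]; simp

lemma OBm.fiberProd {ι : Type*} {s : ℕ} {A : ι → ℝ → Matrix (Fin 2) (Fin 2) ℝ}
    (hA : OBm (fun _ => 1) s A) (θ : ι → ℝ) (n : ℕ) :
    OBm (fun _ => 1) s fun i x => fiberProd (θ i) (A i) n x := by
  induction n with
  | zero => simpa only [fiberProd_zero] using obm_one
  | succ n ih => simpa only [fiberProd_succ] using (hA.shift fun i => n * θ i).mul ih

lemma add_nat_mul_periodic {E : Type*} {f : ℝ → E} (hf : ∀ x, f (x + 1) = f x) {q : ℕ} {p : ℤ}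
    (h : q * θ = p) (x : ℝ) : f (x + q * θ) = f x := by
  rw [h]
  simpa using (show Function.Periodic f 1 from hf).int_mul p x

end FiberProd

section Diagonalization

lemma cmat_mul_eigenbasis {a b : ℂ} {σ Y r : ℝ} (hσ : σ ^ 2 = 1) (ha : a.im = σ * Y)
    (hY : Y ^ 2 = r ^ 2 + ‖b‖ ^ 2) (D : ℝ) :
    cmat a b * cmat (((Y + r) * D : ℝ) : ℂ) (Complex.I * σ * b * D) =
      cmat (((Y + r) * D : ℝ) : ℂ) (Complex.I * σ * b * D) *
        cmat (a.re + Complex.I * σ * r) 0 := by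
  have h1 : a = a.re + Complex.I * σ * Y := by
    apply Complex.ext <;> simp [ha]
  have h2 : b * conj b = (Y : ℂ) ^ 2 - r ^ 2 := by
    rw [Complex.mul_conj']
    have : ((Y ^ 2 : ℝ) : ℂ) = ((r ^ 2 + ‖b‖ ^ 2 : ℝ) : ℂ) := by rw [hY]
    push_cast at this
    linear_combination -this
  have h3 : (σ : ℂ) ^ 2 = 1 := by exact_mod_cast hσ
  rw [cmat_mul, cmat_mul]
  generalize a.re = t at h1 ⊢
  subst h1
  congr 1
  · simp only [map_mul, Complex.conj_I, Complex.conj_ofReal, map_zero, mul_zero, add_zero]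
    push_cast
    linear_combination (-Complex.I * σ * D) * h2
  · simp only [map_mul, map_add, Complex.conj_I, Complex.conj_ofReal, mul_zero, zero_add]
    push_cast
    linear_combination (b * D * σ ^ 2 * (Y + r)) * Complex.I_sq - (b * D * (Y + r)) * h3

/-- A continuous real function without zeros has constant sign. -/
lemma exists_sign {y : ℝ → ℝ} (hy : Continuous y) (h0 : ∀ x, y x ≠ 0) :
    ∃ σ : ℝ, σ ^ 2 = 1 ∧ ∀ x, 0 < σ * y x := by
  rcases lt_or_gt_of_ne (h0 0) with h | h
  · refine ⟨-1, by norm_num, fun x => ?_⟩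
    by_contra hx
    obtain ⟨z, hz⟩ := mem_range_of_exists_le_of_exists_ge hy ⟨0, h.le⟩ ⟨x, by linarith⟩
    exact h0 z hz
  · refine ⟨1, by norm_num, fun x => ?_⟩
    by_contra hx
    obtain ⟨z, hz⟩ := mem_range_of_exists_le_of_exists_ge hy ⟨x, by linarith⟩ ⟨0, h.le⟩
    exact h0 z hz

variable {ι : Type*} {s : ℕ}

lemma OB.re {g : ι → ℝ} {f : ι → ℝ → ℂ} (hf : OB g s f) : OB g s fun i x => ((f i x).re : ℂ) := by
  refine ((hf.add hf.star).smul (c := fun _ => 1 / 2) (C := 1 / 2) fun i => by simp).congr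
    fun i x => ?_
  rw [Complex.add_conj]
  push_cast
  ring

lemma OB.im {g : ι → ℝ} {f : ι → ℝ → ℂ} (hf : OB g s f) : OB g s fun i x => ((f i x).im : ℂ) := by
  refine (hf.smul (c := fun _ => -Complex.I) (C := 1) fun i => by simp).re.congr fun i x => ?_
  simp

lemma OB.sqrt {r : ι → ℝ → ℝ} (hr : OB (fun _ => 1) s fun i x => (r i x : ℂ)) {c : ℝ}
    (hc0 : 0 < c) (hc : ∀ i x, c ≤ r i x) :
    OB (fun _ => 1) s fun i x => ((√(r i x) : ℝ) : ℂ) := by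
  refine (hr.one_mul (hr.rsqrt hc0 hc)).congr fun i x => ?_
  have := hc0.trans_le (hc i x)
  rw [← Complex.ofReal_mul]
  congr 1
  nth_rw 2 [← Real.mul_self_sqrt this.le]
  rw [mul_assoc, mul_inv_cancel₀ (Real.sqrt_pos.2 this).ne', _root_.mul_one]

lemma det_one_mul_left_cancel {P Q : Matrix (Fin 2) (Fin 2) ℝ} {B : Matrix (Fin 2) (Fin 2) ℝ}
    (hB : B.det = 1) (h : B * P = B * Q) : P = Q := by
  have := congrArg (fun X => B.adjugate * X) h
  simpa only [← mul_assoc, Matrix.adjugate_mul, hB, one_smul, one_mul] using this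

lemma eq_conj_cmat_of_fiberProd_diag {A B : ℝ → Matrix (Fin 2) (Fin 2) ℝ} {ζ : ℝ → ℂ} {θ : ℝ} {q : ℕ}
    {p : ℤ} (hq : q * θ = p) (hAp : ∀ x, A (x + 1) = A x) (hBp : ∀ x, B (x + 1) = B x)
    (hB : ∀ x, (B x).det = 1) (hζ : ∀ x, fiberProd θ A q x * B x = B x * cmat (ζ x) 0)
    (hζθ : ∀ x, ζ (x + θ) = ζ x) (hζ0 : ∀ x, (ζ x).im ≠ 0) :
    (∀ x, A x * B x = B (x + θ) * cmat (ca ((B (x + θ)).adjugate * (A x * B x))) 0) ∧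
    ∀ x, ∏ j ∈ Finset.range q, ca ((B (x + j * θ + θ)).adjugate *
      (A (x + j * θ) * B (x + j * θ))) = ζ x := by
  set D : ℝ → Matrix (Fin 2) (Fin 2) ℝ := fun x => (B (x + θ)).adjugate * (A x * B x) with hD
  have h1 : ∀ x, A x * B x = B (x + θ) * D x := fun x => by
    rw [hD, ← mul_assoc (B (x + θ)), Matrix.mul_adjugate, hB, one_smul, one_mul]
  have h2 : ∀ x, cmat (ζ x) 0 * D x = D x * cmat (ζ x) 0 := fun x => by
    refine det_one_mul_left_cancel (hB (x + θ)) ?_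
    calc B (x + θ) * (cmat (ζ x) 0 * D x) = fiberProd θ A q (x + θ) * (A x * B x) := by
          rw [← hζθ, ← mul_assoc, ← hζ, mul_assoc, ← h1]
      _ = A x * fiberProd θ A q x * B x := by
          rw [← mul_assoc, fiberProd_shift_mul, add_nat_mul_periodic hAp hq]
      _ = B (x + θ) * (D x * cmat (ζ x) 0) := by
          rw [mul_assoc, hζ, ← mul_assoc, h1, mul_assoc]
  clear_value D
  have h3 : ∀ x, cb (D x) = 0 := fun x => by
    have h := congrArg cb (h2 x)
    rw [cb_mul, cb_mul, ca_cmat, cb_cmat, zero_mul, mul_zero, zero_add, add_zero] at h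
    have h4 : cb (D x) * (ζ x - conj (ζ x)) = 0 := by linear_combination h
    refine (mul_eq_zero.1 h4).resolve_right fun h5 => hζ0 x ?_
    rw [Complex.sub_conj] at h5
    simpa using h5
  have h4 : ∀ x, D x = cmat (ca (D x)) 0 := fun x => by
    conv_lhs => rw [← cmat_ca_cb (D x), h3]
  simp only [← congrFun hD]
  refine ⟨fun x => by rw [← h4, ← h1], fun x => ?_⟩
  have h5 := fiberProd_conj h1 q x
  rw [add_nat_mul_periodic hBp hq, hζ, funext h4, fiberProd_cmat] at h5
  exact ((cmat_inj (det_one_mul_left_cancel (hB x) h5)).1).symm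

lemma norm_one_sub_sq_of_norm_one {z : ℂ} (hz : ‖z‖ = 1) : ‖1 - z ^ 2‖ = 2 * |z.im| := by
  have h : 1 - z ^ 2 = -(z * (z - conj z)) := by
    have := Complex.mul_conj' z
    rw [hz] at this
    push_cast at this
    linear_combination -this
  rw [h, norm_neg, norm_mul, hz, one_mul, Complex.sub_conj, norm_mul, Complex.norm_I,
    Complex.norm_real, Real.norm_eq_abs, abs_mul]
  simp

/-- A periodic cocycle over a rational rotation whose period map is uniformly elliptic is conjugate
to a diagonal one, with uniform bounds. -/
theorem exists_diagonalization {A : ι → ℝ → Matrix (Fin 2) (Fin 2) ℝ} {θ : ι → ℝ} {q : ℕ} {δ : ℝ}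
    (hA : OBm (fun _ => 1) s A) (hAp : ∀ i x, A i (x + 1) = A i x)
    (hAd : ∀ i x, (A i x).det = 1) (hδ : 0 < δ) (hq : ∀ i, ∃ p : ℤ, q * θ i = p)
    (htr : ∀ i x, |(fiberProd (θ i) (A i) q x).trace| ≤ 2 - δ) :
    ∃ (B : ι → ℝ → Matrix (Fin 2) (Fin 2) ℝ) (a : ι → ℝ → ℂ), (∀ i, Nice (B i)) ∧
      OBm (fun _ => 1) s B ∧ OB (fun _ => 1) s a ∧ (∀ i x, ‖a i x‖ = 1) ∧
      (∃ c : ℝ, 0 < c ∧ ∀ i x, c ≤ ‖1 - (∏ j ∈ Finset.range q, a i (x + j * θ i)) ^ 2‖) ∧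
      ∀ i x, A i x * B i x = B i (x + θ i) * cmat (a i x) 0 := by
  have hP := hA.fiberProd θ q
  have hPd : ∀ i x, (fiberProd (θ i) (A i) q x).det = 1 := fun i x => det_fiberProd (hAd i) q x
  have hPθ : ∀ i x, (fiberProd (θ i) (A i) q (x + θ i)).trace =
      (fiberProd (θ i) (A i) q x).trace := fun i x => by
    obtain ⟨p, hp⟩ := hq i
    have h1 := fiberProd_shift_mul (θ := θ i) (A := A i) q x
    rw [add_nat_mul_periodic (hAp i) hp] at h1
    have h2 : fiberProd (θ i) (A i) q (x + θ i) =
        A i x * fiberProd (θ i) (A i) q x * (A i x).adjugate := by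
      rw [← h1, mul_assoc, Matrix.mul_adjugate, hAd, one_smul, _root_.mul_one]
    rw [h2, Matrix.trace_mul_comm, ← mul_assoc, Matrix.adjugate_mul, hAd, one_smul,
      _root_.one_mul]
  generalize hPdef : (fun i x => fiberProd (θ i) (A i) q x) = P at hP
  have hPe : ∀ i x, fiberProd (θ i) (A i) q x = P i x := fun i x => congrFun (congrFun hPdef i) x
  simp only [hPe] at hPd hPθ htr
  set t : ι → ℝ → ℝ := fun i x => (ca (P i x)).re with ht
  have htO : OB (fun _ => 1) s fun i x => (t i x : ℂ) := hP.fst.re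
  have ht1 : ∀ i x, δ / 2 ≤ 1 - t i x ^ 2 := fun i x => by
    have h := htr i x
    rw [trace_eq] at h
    change |2 * t i x| ≤ _ at h
    have := abs_le.1 h
    nlinarith
  set r : ι → ℝ → ℝ := fun i x => √(1 - t i x ^ 2) with hr
  have hr2 : ∀ i x, r i x ^ 2 = 1 - t i x ^ 2 := fun i x => Real.sq_sqrt (by linarith [ht1 i x])
  have hr0 : ∀ i x, 0 < r i x := fun i x => Real.sqrt_pos.2 (by linarith [ht1 i x])
  have hrO : OB (fun _ => 1) s fun i x => (r i x : ℂ) := by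
    refine OB.sqrt (r := fun i x => 1 - t i x ^ 2) ?_ (half_pos hδ) ht1
    exact ((ob_const_one 1).sub (htO.pow 2)).congr fun i x => by push_cast; ring
  have hdet : ∀ i x, (ca (P i x)).im ^ 2 = r i x ^ 2 + ‖cb (P i x)‖ ^ 2 := fun i x => by
    have h := hPd i x
    rw [det_eq, ← Complex.normSq_eq_norm_sq (ca _), Complex.normSq_apply] at h
    rw [hr2]
    linear_combination h
  have him : ∀ i x, (ca (P i x)).im ≠ 0 := fun i x h0 => by
    have := hdet i x
    rw [h0] at this
    nlinarith [hr0 i x, norm_nonneg (cb (P i x))]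
  choose σ hσ hσ0 using fun i => exists_sign (Complex.continuous_im.comp (hP.fst.continuous i))
    (him i)
  set Y : ι → ℝ → ℝ := fun i x => σ i * (ca (P i x)).im with hY
  have hσ1 : ∀ i, |σ i| ≤ 1 := fun i => (sq_le_one_iff_abs_le_one _).1 (hσ i).le
  have hYO : OB (fun _ => 1) s fun i x => (Y i x : ℂ) :=
    (hP.fst.im.smul (c := fun i => (σ i : ℂ)) (C := 1) fun i => by
      rw [Complex.norm_real]; exact hσ1 i).congr fun i x => Complex.ofReal_mul _ _
  have hY0 : ∀ i x, 0 < Y i x := hσ0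
  have hY2 : ∀ i x, Y i x ^ 2 = r i x ^ 2 + ‖cb (P i x)‖ ^ 2 := fun i x => by
    rw [← hdet, hY, mul_pow, hσ, _root_.one_mul]
  have hYim : ∀ i x, (ca (P i x)).im = σ i * Y i x := fun i x => by
    rw [hY]
    linear_combination (-(ca (P i x)).im) * hσ i
  have hYr : ∀ i x, r i x ≤ Y i x := fun i x =>
    le_of_sq_le_sq (by rw [hY2]; nlinarith [norm_nonneg (cb (P i x))]) (hY0 i x).le
  set w : ι → ℝ → ℝ := fun i x => 2 * r i x * (Y i x + r i x) with hw
  have hwO : OB (fun _ => 1) s fun i x => (w i x : ℂ) :=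
    (((ob_const_one 2).one_mul hrO).one_mul (hYO.add hrO)).congr fun i x => by
      rw [hw]; push_cast; ring
  have hw0 : ∀ i x, 2 * δ ≤ w i x := fun i x => by
    have := ht1 i x
    rw [← hr2] at this
    have := mul_le_mul_of_nonneg_left (hYr i x) (hr0 i x).le
    rw [hw]
    nlinarith
  set D : ι → ℝ → ℝ := fun i x => (√(w i x))⁻¹ with hD
  have hDO : OB (fun _ => 1) s fun i x => (D i x : ℂ) := hwO.rsqrt (by positivity) hw0
  have hD0 : ∀ i x, 0 < D i x := fun i x => inv_pos.2 (Real.sqrt_pos.2 (by linarith [hw0 i x]))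
  have hD2 : ∀ i x, D i x ^ 2 * w i x = 1 := fun i x => by
    have : 0 < w i x := by linarith [hw0 i x]
    rw [hD, inv_pow, Real.sq_sqrt this.le, inv_mul_cancel₀ this.ne']
  set c : ι → ℝ → ℝ := fun i x => (Y i x + r i x) * D i x with hc
  have hcO : OB (fun _ => 1) s fun i x => (c i x : ℂ) :=
    ((hYO.add hrO).one_mul hDO).congr fun i x => by rw [hc]; push_cast; ring
  set u : ι → ℝ → ℂ := fun i x => Complex.I * σ i * cb (P i x) * D i x with hu
  have huO : OB (fun _ => 1) s u :=
    ((hP.snd.smul (c := fun i => Complex.I * σ i) (C := 1) fun i => by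
      rw [norm_mul, Complex.norm_I, _root_.one_mul, Complex.norm_real]
      exact hσ1 i).one_mul hDO).congr fun i x => rfl
  set B : ι → ℝ → Matrix (Fin 2) (Fin 2) ℝ := fun i x => cmat (c i x) (u i x) with hB
  have hBN : ∀ i, Nice (B i) := fun i => by
    refine nice_cmat (hcO.smooth i) (huO.smooth i) (fun x => ?_) (huO.per i)
      (fun x => mul_pos (add_pos (hY0 i x) (hr0 i x)) (hD0 i x)) fun x => ?_
    · exact_mod_cast hcO.per i x
    · have h1 : ‖u i x‖ ^ 2 = ‖cb (P i x)‖ ^ 2 * D i x ^ 2 := by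
        rw [hu, norm_mul, norm_mul, norm_mul, Complex.norm_I, Complex.norm_real, Complex.norm_real,
          Real.norm_eq_abs, Real.norm_eq_abs, _root_.one_mul, mul_pow, mul_pow, sq_abs, sq_abs, hσ,
          _root_.one_mul]
      rw [h1, ← hD2 i x]
      have := hY2 i x
      rw [hc, hw]
      linear_combination (D i x ^ 2) * this
  have hBO : OBm (fun _ => 1) s B :=
    ⟨hcO.congr fun i x => ca_cmat _ _, huO.congr fun i x => cb_cmat _ _⟩
  set ζ : ι → ℝ → ℂ := fun i x => t i x + Complex.I * σ i * r i x with hζ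
  have hζre : ∀ i x, (ζ i x).re = t i x := fun i x => by simp [hζ]
  have hζi : ∀ i x, (ζ i x).im = σ i * r i x := fun i x => by simp [hζ]
  have hζ1 : ∀ i x, ‖ζ i x‖ = 1 := fun i x => by
    rw [← pow_left_inj₀ (norm_nonneg _) zero_le_one two_ne_zero, ← Complex.normSq_eq_norm_sq,
      Complex.normSq_apply, hζre, hζi]
    linear_combination hr2 i x + (r i x ^ 2) * hσ i
  have hmain := fun i => eq_conj_cmat_of_fiberProd_diag (ζ := ζ i) (hq i).choose_spec (hAp i)
    (hBN i).per (hBN i).det (fun x => by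
      have := cmat_mul_eigenbasis (hσ i) (hYim i x) (hY2 i x) (D i x)
      rw [cmat_ca_cb] at this
      rw [hPe]
      exact this)
    (fun x => by
      have h1 : t i (x + θ i) = t i x := by
        have := hPθ i x
        rw [trace_eq, trace_eq] at this
        exact mul_left_cancel₀ two_ne_zero this
      simp only [hζ, hr, h1])
    (fun x => by
      rw [hζi]
      refine mul_ne_zero (fun h => ?_) (hr0 i x).ne'
      have := hσ i
      rw [h] at this
      norm_num at this)
  refine ⟨B, fun i x => ca ((B i (x + θ i)).adjugate * (A i x * B i x)), hBN, hBO,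
    ((hBO.shift θ).adjugate.mul (hA.mul hBO)).fst, fun i x => ?_, ⟨√(2 * δ), by positivity,
      fun i x => ?_⟩, fun i => (hmain i).1⟩
  · have h1 := congrArg Matrix.det ((hmain i).1 x)
    rw [Matrix.det_mul, Matrix.det_mul, hAd, (hBN i).det, (hBN i).det, det_cmat] at h1
    rw [← pow_left_inj₀ (norm_nonneg _) zero_le_one two_ne_zero]
    rw [norm_zero] at h1
    linarith
  · rw [(hmain i).2, norm_one_sub_sq_of_norm_one (hζ1 i x), hζi, abs_mul,
      show |σ i| = 1 from (pow_left_inj₀ (abs_nonneg _) zero_le_one two_ne_zero).1 (by rw [sq_abs, hσ, one_pow]),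
      _root_.one_mul, abs_of_pos (hr0 i x), Real.sqrt_le_left (by linarith [hr0 i x])]
    have := ht1 i x
    rw [← hr2] at this
    linarith

end Diagonalization

section Averaging

lemma cohomological_rational {w h : ℝ → ℂ} {θ : ℝ} {q : ℕ} {p : ℤ} (hq : q * θ = p)
    (hw : ∀ x, w x * conj (w x) = 1) (hwp : ∀ x, w (x + 1) = w x) (hhp : ∀ x, h (x + 1) = h x)
    {E : ℕ → ℝ → ℂ} (hE : ∀ n x, E n x = ∏ l ∈ Finset.range n, w (x + l * θ)) {S : ℝ → ℂ}
    (hS : ∀ x, S x = ∑ j ∈ Finset.range q, E q x * conj (E (j + 1) x) * h (x + j * θ)) (x : ℝ) :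
    S (x + θ) = w x * S x + (1 - E q x) * h x ∧ E q (x + θ) = E q x := by
  have h1 : ∀ n x, E (n + 1) x = E n x * w (x + n * θ) := fun n x => by
    rw [hE, hE, Finset.prod_range_succ]
  have h2 : ∀ n x, E (n + 1) x = w x * E n (x + θ) := fun n x => by
    rw [hE, hE, Finset.prod_range_succ', mul_comm]
    simp only [Nat.cast_zero, zero_mul, add_zero]
    congr 1
    refine Finset.prod_congr rfl fun l _ => ?_
    congr 1
    push_cast
    ring
  have hE1 : ∀ n x, E n x * conj (E n x) = 1 := fun n x => by
    induction n with
    | zero => simp [hE]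
    | succ n ih =>
      rw [h1, map_mul]
      linear_combination (w (x + n * θ) * conj (w (x + n * θ))) * ih + hw (x + n * θ)
  have hEq : E q (x + θ) = E q x := by
    have h3 := (h2 q x).symm.trans (h1 q x)
    rw [add_nat_mul_periodic hwp hq] at h3
    linear_combination conj (w x) * h3 - (E q (x + θ) - E q x) * hw x
  refine ⟨?_, hEq⟩
  have h4 : ∀ j, conj (E (j + 1) (x + θ)) = w x * conj (E (j + 2) x) := fun j => by
    rw [h2 (j + 1) x, map_mul]
    linear_combination (-conj (E (j + 1) (x + θ))) * hw x
  set T : ℕ → ℂ := fun j => E q x * conj (E (j + 1) x) * h (x + j * θ) with hT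
  have h5 : S (x + θ) = w x * ∑ j ∈ Finset.range q, T (j + 1) := by
    rw [hS, Finset.mul_sum]
    refine Finset.sum_congr rfl fun j _ => ?_
    rw [hEq, h4, hT]
    have : x + θ + j * θ = x + (j + 1 : ℕ) * θ := by push_cast; ring
    rw [this]
    ring
  have h6 : ∑ j ∈ Finset.range q, T (j + 1) = S x + T q - T 0 := by
    rw [hS, ← Finset.sum_range_succ, Finset.sum_range_succ']
    ring
  have h7 : T q = conj (w x) * h x := by
    simp only [hT]
    rw [add_nat_mul_periodic hhp hq, h1, add_nat_mul_periodic hwp hq, map_mul]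
    linear_combination conj (w x) * h x * hE1 q x
  have h8 : T 0 = E q x * conj (w x) * h x := by
    simp only [hT]
    rw [h1, hE 0]
    simp
  rw [h5, h6, h7, h8]
  linear_combination (h x - E q x * h x) * hw x

variable {ι : Type*} {s : ℕ} {η α θ : ι → ℝ} {f k : ι → ℝ → ℂ}

lemma OB.mul_gauge {m n : ℕ} (hf : OB (fun i => η i ^ m) s f) (hk : OB (fun i => η i ^ n) s k) :
    OB (fun i => η i ^ (m + n)) s fun i x => f i x * k i x := by
  simpa only [pow_add] using hf.mul hk

lemma OB.of_pow_le {m n : ℕ} (hf : OB (fun i => η i ^ m) s f) (hη0 : ∀ i, 0 ≤ η i)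
    (hη1 : ∀ i, η i ≤ 1) (h : n ≤ m) : OB (fun i => η i ^ n) s f :=
  hf.of_le (fun i => pow_nonneg (hη0 i) n) zero_le_one fun i => by
    rw [_root_.one_mul]; exact pow_le_pow_of_le_one (hη0 i) (hη1 i) h

/-- Parameters of a family of frequencies close to rational numbers of denominator `q`. -/
structure Freq (q : ℕ) (θ α η : ι → ℝ) : Prop where
  per : ∀ i, ∃ p : ℤ, q * θ i = p
  nonneg : ∀ i, 0 ≤ η i
  le_one : ∀ i, η i ≤ 1
  close : ∀ i, |α i - θ i| ≤ η i

/-- The family of cocycles `A` is conjugate to `Q`, which is diagonal up to order `η ^ n`. -/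
structure NearDiag (A : ι → ℝ → Matrix (Fin 2) (Fin 2) ℝ) (α η : ι → ℝ) (a : ι → ℝ → ℂ) (n s : ℕ)
    (Q B : ι → ℝ → Matrix (Fin 2) (Fin 2) ℝ) : Prop where
  eqn : ∀ i x, A i x * B i x = B i (x + α i) * Q i x
  nice : ∀ i, Nice (B i)
  fst : OB (fun i => η i ^ 1) s fun i x => ca (Q i x) - a i x
  snd : OB (fun i => η i ^ n) s fun i x => cb (Q i x)

variable {A Q B : ι → ℝ → Matrix (Fin 2) (Fin 2) ℝ} {q : ℕ} {a : ι → ℝ → ℂ}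

lemma OB.pow_zero (hf : OB (fun _ => 1) s f) : OB (fun i => η i ^ 0) s f := by
  simpa only [_root_.pow_zero] using hf

lemma nearDiag_one (hF : Freq q θ α η) (hB : ∀ i, Nice (B i)) (hBO : OBm (fun _ => 1) (s + 1) B)
    (ha : OB (fun _ => 1) s a) (h : ∀ i x, A i x * B i x = B i (x + θ i) * cmat (a i x) 0) :
    NearDiag A α η a 1 s (fun i x => (B i (x + α i)).adjugate * (B i (x + θ i) * cmat (a i x) 0))
      B where
  eqn i x := by
    rw [h, ← mul_assoc (B i (x + α i)), Matrix.mul_adjugate, (hB i).det, one_smul, _root_.one_mul]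
  nice := hB
  fst := by
    have h1 := hBO.fst.sub_shift hF.close
    have h2 := hBO.snd.sub_shift hF.close
    have h3 := (hBO.mono (Nat.le_succ s)).shift θ
    have h4 := (((h1.star.mul_one h3.fst).sub (h2.mul_one h3.snd.star)).mul_one ha)
    simp only [pow_one]
    refine OB.congr (by simpa only [_root_.mul_one] using h4) fun i x => ?_
    have hd := (hB i).det (x + θ i)
    rw [det_eq] at hd
    have hd' : ca (B i (x + θ i)) * conj (ca (B i (x + θ i))) -
        cb (B i (x + θ i)) * conj (cb (B i (x + θ i))) = 1 := by
      rw [Complex.mul_conj', Complex.mul_conj']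
      exact_mod_cast hd
    rw [ca_mul, ca_mul, cb_mul, ca_cmat, cb_cmat, ca_adjugate, cb_adjugate, map_sub]
    simp only [map_mul, map_zero, mul_zero, add_zero, zero_add, Complex.conj_conj]
    linear_combination (a i x) * hd'
  snd := by
    have h1 := hBO.fst.sub_shift hF.close
    have h2 := hBO.snd.sub_shift hF.close
    have h3 := (hBO.mono (Nat.le_succ s)).shift θ
    have h4 := (((h1.star.mul_one h3.snd).sub (h2.mul_one h3.fst.star)).mul_one ha.star)
    simp only [pow_one]
    refine OB.congr (by simpa only [_root_.mul_one] using h4) fun i x => ?_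
    rw [cb_mul, ca_mul, cb_mul, ca_cmat, cb_cmat, ca_adjugate, cb_adjugate, map_sub]
    simp only [map_mul, map_zero, mul_zero, add_zero, zero_add]
    ring

lemma exists_cohomological_solution {g : ι → ℝ} {h : ι → ℝ → ℂ} (hF : Freq q θ α η)
    (ha : OB (fun _ => 1) s a) (ha1 : ∀ i x, ‖a i x‖ = 1) {c : ℝ} (hc : 0 < c)
    (hc1 : ∀ i x, c ≤ ‖1 - (∏ j ∈ Finset.range q, a i (x + j * θ i)) ^ 2‖) (hh : OB g s h) :
    ∃ u : ι → ℝ → ℂ, OB g s u ∧ ∀ i x, u i (x + θ i) = a i x ^ 2 * u i x + h i x := by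
  set E : ι → ℕ → ℝ → ℂ := fun i n x => ∏ l ∈ Finset.range n, a i (x + l * θ i) ^ 2 with hE
  have hEO : ∀ n, OB (fun _ => 1) s fun i x => E i n x := fun n =>
    OB.prod _ fun l _ => (ha.pow 2).shift fun i => l * θ i
  set S : ι → ℝ → ℂ := fun i x => ∑ j ∈ Finset.range q,
    E i q x * conj (E i (j + 1) x) * h i (x + j * θ i) with hS
  have hSO : OB g s S := OB.sum _ hh.nonneg fun j _ =>
    ((hEO q).one_mul (hEO (j + 1)).star).one_mul (hh.shift fun i => j * θ i)
  have hEc : ∀ i x, c ≤ ‖1 - E i q x‖ := fun i x => by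
    simp only [hE]
    rw [Finset.prod_pow]
    exact hc1 i x
  refine ⟨fun i x => (1 - E i q x)⁻¹ * S i x,
    (((ob_const_one 1).sub (hEO q)).inv hc hEc).one_mul hSO, fun i x => ?_⟩
  obtain ⟨p, hp⟩ := hF.per i
  obtain ⟨h1, h2⟩ := cohomological_rational (w := fun x => a i x ^ 2) hp (fun x => by
    rw [Complex.mul_conj', norm_pow, ha1]; simp) (fun x => by simp only [ha.per]) (hh.per i)
    (E := E i) (fun n x => rfl) (S := S i) (fun x => rfl) x
  have h0 : 1 - E i q x ≠ 0 := norm_pos_iff.1 (hc.trans_le (hEc i x))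
  dsimp only at h1 ⊢
  rw [h2, h1]
  field_simp

/-- One averaging step improves the order of the off-diagonal coefficient by one. -/
lemma NearDiag.step {n : ℕ} (hF : Freq q θ α η) (ha : OB (fun _ => 1) (s + 1) a)
    (ha1 : ∀ i x, ‖a i x‖ = 1) {c₀ : ℝ} (hc : 0 < c₀)
    (hc1 : ∀ i x, c₀ ≤ ‖1 - (∏ j ∈ Finset.range q, a i (x + j * θ i)) ^ 2‖) (hn : 1 ≤ n)
    (hQ : NearDiag A α η a n (s + 1) Q B) : ∃ Q' B', NearDiag A α η a (n + 1) s Q' B' := by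
  have hb := hQ.snd
  obtain ⟨u, hu, hueq⟩ := exists_cohomological_solution hF ha ha1 hc hc1 (ha.one_mul hb)
  have hη0 := hF.nonneg
  have hη1 := hF.le_one
  set c : ι → ℝ → ℝ := fun i x => √(1 + ‖u i x‖ ^ 2) with hcdef
  have hc2 : ∀ i x, c i x ^ 2 = 1 + ‖u i x‖ ^ 2 := fun i x => Real.sq_sqrt (by positivity)
  have hcpos : ∀ i x, 0 < c i x := fun i x => Real.sqrt_pos.2 (by positivity)
  have hcO : OB (fun _ => 1) (s + 1) fun i x => (c i x : ℂ) := by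
    refine OB.sqrt (r := fun i x => 1 + ‖u i x‖ ^ 2) ?_ one_pos fun i x => by
      nlinarith [norm_nonneg (u i x)]
    have h1 := (hu.mul hu.star).of_le (h := fun _ => 1) (fun _ => zero_le_one) zero_le_one fun i => by
      rw [_root_.one_mul, ← pow_add]
      exact pow_le_one₀ (hη0 i) (hη1 i)
    exact ((ob_const_one 1).add h1).congr fun i x => by
      rw [Complex.mul_conj']; push_cast; ring
  set e : ι → ℝ → ℂ := fun i x => u i x * conj (u i x) * (1 + (c i x : ℂ))⁻¹ with hedef
  have hce : ∀ i x, (c i x : ℂ) = 1 + e i x := fun i x => by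
    have h1 : (1 + (c i x : ℂ)) ≠ 0 := by
      have := (add_pos one_pos (hcpos i x)).ne'
      exact_mod_cast this
    have h2 : ((c i x ^ 2 : ℝ) : ℂ) = ((1 + ‖u i x‖ ^ 2 : ℝ) : ℂ) := by rw [hc2]
    push_cast at h2
    simp only [hedef]
    rw [Complex.mul_conj']
    field_simp
    linear_combination h2
  have heO' : OB (fun i => η i ^ (n + n)) (s + 1) e :=
    (hu.mul_gauge hu.star).mul_one (((ob_const_one 1).add hcO).inv one_pos fun i x => by
      have : (1 : ℂ) + c i x = ((1 + c i x : ℝ) : ℂ) := by push_cast; rfl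
      rw [this, Complex.norm_real, Real.norm_eq_abs]
      exact le_trans (by linarith [hcpos i x]) (le_abs_self _))
  have hs := Nat.le_succ s
  have hu' := hu.mono hs
  have hup := hu'.shift α
  have he := heO'.mono hs
  have hep := he.shift α
  have hb' := hb.mono hs
  have hd := hQ.fst.mono hs
  have hur := hu.sub_shift hF.close
  have ha' := ha.mono hs
  have hQ0 : OB (fun i => η i ^ 0) s fun i x => ca (Q i x) :=
    (ha'.pow_zero.add (hd.of_pow_le hη0 hη1 (Nat.zero_le _))).congr fun i x => by ring
  have hnice : ∀ i, Nice fun x => cmat (c i x) (u i x) := fun i =>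
    nice_cmat (hcO.smooth i) (hu.smooth i) (fun x => by exact_mod_cast hcO.per i x) (hu.per i)
      (hcpos i) (hc2 i)
  refine ⟨fun i x => (cmat (c i (x + α i)) (u i (x + α i))).adjugate *
    (Q i x * cmat (c i x) (u i x)), fun i x => B i x * cmat (c i x) (u i x), ⟨fun i x => ?_,
      fun i => (hQ.nice i).mul (hnice i), ?_, ?_⟩⟩
  · rw [mul_assoc (B i (x + α i)), ← mul_assoc (cmat _ _) (adjugate _), Matrix.mul_adjugate,
      (hnice i).det, one_smul, _root_.one_mul, ← mul_assoc, hQ.eqn, mul_assoc]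
  · have t1 := (((he.add hep).add ((hep.mul_gauge he).of_pow_le hη0 hη1 (by omega))).mul_gauge
      hQ0).of_pow_le hη0 hη1 (n := 1) (by omega)
    have t2 := (hb'.mul_gauge hu'.star).of_pow_le hη0 hη1 (n := 1) (by omega)
    have t3 := ((hep.mul_gauge hb').mul_gauge hu'.star).of_pow_le hη0 hη1 (n := 1) (by omega)
    have t4 := (hup.mul_gauge (hQ0.mul_gauge hu').star).of_pow_le hη0 hη1 (n := 1) (by omega)
    have t5 := (hup.mul_gauge hb'.star).of_pow_le hη0 hη1 (n := 1) (by omega)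
    have t6 := ((hup.mul_gauge hb'.star).mul_gauge he).of_pow_le hη0 hη1 (n := 1) (by omega)
    refine ((((hd.add t1).add (t2.add t3)).sub (t4.add t5)).sub t6).congr fun i x => ?_
    rw [ca_mul, ca_mul, cb_mul, ca_adjugate, cb_adjugate, ca_cmat, cb_cmat, ca_cmat, cb_cmat]
    simp only [map_add, map_mul, Complex.conj_ofReal]
    rw [hce, hce]
    ring
  · have t1 := (hd.mul_gauge hu').of_pow_le hη0 hη1 (n := n + 1) (by omega)
    have t2 := (hd.star.mul_gauge hup).of_pow_le hη0 hη1 (n := n + 1) (by omega)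
    have t3 : OB (fun i => η i ^ (n + 1)) s fun i x =>
        conj (a i x) * (u i (x + α i) - u i (x + θ i)) := by
      refine (ha'.star.one_mul hur).of_le (fun i => pow_nonneg (hη0 i) _) zero_le_one fun i => ?_
      rw [_root_.one_mul, pow_succ, mul_comm]
    have t4 := ((hep.mul_gauge hQ0).mul_gauge hu').of_pow_le hη0 hη1 (n := n + 1) (by omega)
    have t5 := (((he.add hep).add ((hep.mul_gauge he).of_pow_le hη0 hη1 (by omega))).mul_gauge
      hb').of_pow_le hη0 hη1 (n := n + 1) (by omega)
    have t6 := ((hup.mul_gauge hQ0.star).mul_gauge he).of_pow_le hη0 hη1 (n := n + 1) (by omega)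
    have t7 := ((hup.mul_gauge hb'.star).mul_gauge hu').of_pow_le hη0 hη1 (n := n + 1) (by omega)
    refine ((((t1.sub t2).sub t3).add (t4.add t5)).sub (t6.add t7)).congr fun i x => ?_
    have h1 : a i x * conj (a i x) = 1 := by
      rw [Complex.mul_conj', ha1]; simp
    rw [cb_mul, ca_mul, cb_mul, ca_adjugate, cb_adjugate, ca_cmat, cb_cmat, ca_cmat, cb_cmat]
    simp only [map_add, map_mul, map_sub, Complex.conj_conj, Complex.conj_ofReal]
    rw [hce, hce, hueq]
    linear_combination (-(a i x * u i x + cb (Q i x))) * h1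

theorem NearDiag.iterate {n m : ℕ} (hF : Freq q θ α η) (ha : OB (fun _ => 1) (s + m) a)
    (ha1 : ∀ i x, ‖a i x‖ = 1) {c₀ : ℝ} (hc : 0 < c₀)
    (hc1 : ∀ i x, c₀ ≤ ‖1 - (∏ j ∈ Finset.range q, a i (x + j * θ i)) ^ 2‖) (hn : 1 ≤ n)
    (hQ : NearDiag A α η a n (s + m) Q B) : ∃ Q' B', NearDiag A α η a (n + m) s Q' B' := by
  induction m generalizing n Q B with
  | zero => exact ⟨Q, B, hQ⟩
  | succ m ih =>
    obtain ⟨Q₁, B₁, h⟩ := hQ.step (s := s + m) hF ha ha1 hc hc1 hn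
    obtain ⟨Q₂, B₂, h'⟩ := ih (ha.mono (by omega)) (by omega) h
    exact ⟨Q₂, B₂, by rwa [show n + (m + 1) = n + 1 + m by ring]⟩

end Averaging

section Argument

lemma two_pi_I_ne_zero : (2 * Real.pi * Complex.I : ℂ) ≠ 0 := by
  simp [Real.pi_ne_zero]

/-- A continuous argument of a smooth function of modulus one is smooth. -/
lemma hasDerivAt_arg {Ψ : ℝ → ℝ} {w : ℝ → ℂ} (hΨ : Continuous Ψ) (hw : ContDiff ℝ (⊤ : ℕ∞) w)
    (h : ∀ x, w x = ex (Ψ x)) (x : ℝ) :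
    HasDerivAt (fun y => (Ψ y : ℂ)) (deriv w x * conj (w x) * (2 * Real.pi * Complex.I)⁻¹) x := by
  have hn : ∀ x, w x * conj (w x) = 1 := fun x => by rw [Complex.mul_conj', h, norm_ex]; simp
  have hd : ∀ x, HasDerivAt w (deriv w x) x := fun x =>
    (hw.differentiable (by simp) x).hasDerivAt
  have hdc : ∀ x, HasDerivAt (fun y => conj (w y)) (conj (deriv w x)) x := fun x =>
    (Complex.conjCLE.toContinuousLinearMap.hasFDerivAt.comp_hasDerivAt x (hd x))
  have hre : ∀ x, deriv w x * conj (w x) + w x * conj (deriv w x) = 0 := fun x => by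
    have h1 := (hd x).mul (hdc x)
    have h2 : (w * fun y => conj (w y)) = fun _ => 1 := funext hn
    rw [h2] at h1
    exact h1.unique (hasDerivAt_const x 1)
  set G : ℝ → ℝ := fun x => (deriv w x * conj (w x)).im / (2 * Real.pi) with hG
  have hGc : Continuous G := by
    have h1 : Continuous (deriv w) := (contDiff_deriv hw).continuous
    exact (Complex.continuous_im.comp (h1.mul (Complex.continuous_conj.comp hw.continuous))).div_const _
  have hGe : ∀ x, deriv w x * conj (w x) = 2 * Real.pi * Complex.I * (G x : ℂ) := fun x => by
    have h1 : (deriv w x * conj (w x)).re = 0 := by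
      have h2 := hre x
      have h3 : w x * conj (deriv w x) = conj (deriv w x * conj (w x)) := by
        rw [map_mul, Complex.conj_conj, mul_comm]
      rw [h3, Complex.add_conj] at h2
      have h4 : 2 * (deriv w x * conj (w x)).re = 0 := by exact_mod_cast h2
      linarith
    have h5 : G x = (deriv w x * conj (w x)).im / (2 * Real.pi) := rfl
    rw [h5]
    generalize deriv w x * conj (w x) = z at h1
    have hpi := Real.pi_ne_zero
    have h6 : z = z.im * Complex.I := Complex.ext (by simp [h1]) (by simp)
    have h7 : ((2 * Real.pi : ℝ) : ℂ) * ((z.im / (2 * Real.pi) : ℝ) : ℂ) = z.im := by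
      rw [← Complex.ofReal_mul]
      congr 1
      field_simp
    conv_lhs => rw [h6, ← h7]
    push_cast
    ring
  set Φ : ℝ → ℝ := fun x => Ψ 0 + ∫ t in (0 : ℝ)..x, G t with hΦ
  have hΦd : ∀ x, HasDerivAt Φ (G x) x := fun x =>
    (intervalIntegral.integral_hasDerivAt_right (hGc.intervalIntegrable _ _)
      (hGc.stronglyMeasurableAtFilter _ _) hGc.continuousAt).const_add _
  have hΦd' : ∀ x, HasDerivAt (fun y => (Φ y : ℂ)) (G x : ℂ) x := fun x => (hΦd x).ofReal_comp
  have hΦex : ∀ x, HasDerivAt (fun y => ex (Φ y)) (ex (Φ x) * (2 * Real.pi * G x * Complex.I)) x :=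
    fun x => (((hΦd' x).const_mul (2 * Real.pi : ℂ)).mul_const Complex.I).cexp
  have hconst : ∀ x, ex (Φ x) * conj (w x) = 1 := fun x => by
    have h1 : ∀ x, HasDerivAt (fun y => ex (Φ y) * conj (w y)) 0 x := fun x => by
      refine ((hΦex x).mul (hdc x)).congr_deriv ?_
      have h2 : conj (deriv w x) = - (2 * Real.pi * Complex.I * G x) * conj (w x) := by
        rw [← hGe]
        linear_combination conj (w x) * hre x - conj (deriv w x) * hn x
      rw [h2]
      ring
    have h2 := is_const_of_deriv_eq_zero (fun x => (h1 x).differentiableAt) (fun x => (h1 x).deriv)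
      x 0
    rw [h2, h, hΦ]
    simp only [intervalIntegral.integral_same, add_zero]
    rw [Complex.mul_conj', norm_ex]
    simp
  have heq : ∀ x, Ψ x = Φ x := by
    have hΦc : Continuous Φ := continuous_iff_continuousAt.2 fun x => (hΦd x).continuousAt
    obtain ⟨l, hl⟩ := exists_int_const (f := fun x => Φ x - Ψ x) (hΦc.sub hΨ) fun x => by
      refine ex_eq_one ?_
      rw [sub_eq_add_neg, ex_add, ← conj_ex, ← h, hconst]
    have h0 := hl 0
    simp only [hΦ, intervalIntegral.integral_same, add_zero, sub_self] at h0
    intro x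
    have := hl x
    rw [← h0] at this
    linarith
  have h5 : (fun y => (Ψ y : ℂ)) = fun y => (Φ y : ℂ) := funext fun y => by rw [heq]
  rw [h5, hGe]
  convert hΦd' x using 1
  have := two_pi_I_ne_zero
  field_simp

end Argument

section Cohomological

/-- The Fourier coefficients of the solution of the cohomological equation. -/
noncomputable def gdiv (α : ℝ) (c : ℤ → ℂ) (k : ℤ) : ℂ :=
  if k = 0 then 0 else c k / (ex (k * α) - 1)

lemma nrm_gdiv_le {η α : ℝ} (hη : 0 < η)
    (hα : ∀ k : ℤ, k ≠ 0 → 4 * η ^ 2 / (k : ℝ) ^ 2 ≤ ‖ex (k * α) - 1‖) (c : ℤ → ℂ) (l : ℕ) :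
    nrm (wt 1 l) (gdiv α c) ≤ ENNReal.ofReal ((η ^ 2)⁻¹) * nrm (wt 1 (l + 1)) (dseq c) := by
  refine nrm_le_mul fun k => ?_
  by_cases hk : k = 0
  · simp [gdiv, hk]
  have hk' : (0 : ℝ) < |(k : ℝ)| := by positivity
  have h1 := hα k hk
  rw [← sq_abs (k : ℝ)] at h1
  have h2 : (0 : ℝ) < ‖ex (k * α) - 1‖ := lt_of_lt_of_le (by positivity) h1
  have h3 : (‖ex (k * α) - 1‖)⁻¹ ≤ |(k : ℝ)| ^ 2 / (4 * η ^ 2) := by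
    rw [← inv_div]
    exact inv_anti₀ (by positivity) h1
  have h4 : |(k : ℝ)| ^ 2 / (4 * η ^ 2) ≤ (η ^ 2)⁻¹ * ((1 + |(k : ℝ)|) * (2 * Real.pi * |(k : ℝ)|)) := by
    rw [div_eq_mul_inv, mul_inv]
    have : |(k : ℝ)| ^ 2 * 4⁻¹ ≤ (1 + |(k : ℝ)|) * (2 * Real.pi * |(k : ℝ)|) := by
      nlinarith [Real.pi_gt_three, mul_pos hk' hk']
    calc _ = (η ^ 2)⁻¹ * (|(k : ℝ)| ^ 2 * 4⁻¹) := by ring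
      _ ≤ _ := by gcongr
  have h5 : ‖gdiv α c k‖ = ‖c k‖ * (‖ex (k * α) - 1‖)⁻¹ := by
    rw [gdiv, if_neg hk, norm_div, div_eq_mul_inv]
  have h6 : ‖dseq c k‖ = 2 * Real.pi * |(k : ℝ)| * ‖c k‖ := by
    rw [dseq]
    simp [abs_of_pos Real.pi_pos]
  rw [wt, wt, ← ofReal_norm, ← ofReal_norm, ← ENNReal.ofReal_mul (by positivity),
    ← ENNReal.ofReal_mul (by positivity), ← ENNReal.ofReal_mul (by positivity), h5, h6]
  refine ENNReal.ofReal_le_ofReal ?_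
  rw [div_one]
  calc (1 + |(k : ℝ)|) ^ l * (‖c k‖ * (‖ex (k * α) - 1‖)⁻¹)
      ≤ (1 + |(k : ℝ)|) ^ l * (‖c k‖ *
        ((η ^ 2)⁻¹ * ((1 + |(k : ℝ)|) * (2 * Real.pi * |(k : ℝ)|)))) := by
        gcongr
        exact h3.trans h4
    _ = _ := by ring

lemma rapid_gdiv {η α : ℝ} (hη : 0 < η)
    (hα : ∀ k : ℤ, k ≠ 0 → 4 * η ^ 2 / (k : ℝ) ^ 2 ≤ ‖ex (k * α) - 1‖) {c : ℤ → ℂ} (hc : Rapid c) :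
    Rapid (gdiv α c) := fun r =>
  ne_top_of_le_ne_top (ENNReal.mul_ne_top ENNReal.ofReal_ne_top (hc.dseq (r + 1)))
    (nrm_gdiv_le hη hα c r)

lemma ev_gdiv {η α : ℝ} (hη : 0 < η)
    (hα : ∀ k : ℤ, k ≠ 0 → 4 * η ^ 2 / (k : ℝ) ^ 2 ≤ ‖ex (k * α) - 1‖) {c : ℤ → ℂ} (hc : Rapid c)
    (x : ℝ) : ev (gdiv α c) (x + α) - ev (gdiv α c) x = ev c x - c 0 := by
  have hg := (rapid_gdiv hη hα hc).one
  have h1 : ev (fun k => c k - (if k = 0 then c 0 else 0)) x = ev c x - c 0 := by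
    have h2 : ev (fun k => if k = 0 then c 0 else 0) x = c 0 := by
      rw [ev, tsum_eq_single 0 fun k hk => by simp [hk]]
      simp [ex_zero]
    have h3 : nrm 1 (fun k => if k = 0 then c 0 else 0) ≠ ∞ := by
      rw [nrm, tsum_eq_single 0 fun k hk => by simp [hk]]
      simp
    conv_rhs => rw [← h2]
    exact ev_sub hc.one h3 x
  rw [← h1, ← ev_shift]
  rw [ev, ev, ← ((summable_ev (c := fun k => ex (k * α) * gdiv α c k) ?_ x).tsum_sub
    (summable_ev hg x))]
  · refine tsum_congr fun k => ?_
    rw [gdiv]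
    split_ifs with hk
    · simp [hk]
    · have h2 : ex (k * α) - 1 ≠ 0 := norm_pos_iff.1 <|
        lt_of_lt_of_le (by positivity) (hα k hk)
      simp only [hk, if_false, sub_zero]
      field_simp
  · refine ne_top_of_le_ne_top hg (nrm_mono fun k => ?_)
    rw [enorm_mul, ← ofReal_norm (ex _), norm_ex]
    simp

/-- The cohomological equation over a family of Diophantine rotations. -/
lemma exists_cohomological {ι : Type*} {s : ℕ} {η α : ι → ℝ} {Φ : ι → ℝ → ℝ}
    (hη : ∀ i, 0 < η i)
    (hα : ∀ i, ∀ k : ℤ, k ≠ 0 → 4 * η i ^ 2 / (k : ℝ) ^ 2 ≤ ‖ex (k * α i) - 1‖)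
    (hΦ : ∀ i, ContDiff ℝ (⊤ : ℕ∞) fun x => (Φ i x : ℂ)) (hp : ∀ i x, Φ i (x + 1) = Φ i x)
    (hd : OB (fun _ => 1) (s + 3) fun i => deriv fun x => (Φ i x : ℂ)) :
    ∃ (ψ : ι → ℝ → ℝ) (c₀ : ι → ℝ), OB (fun i => (η i ^ 2)⁻¹) s (fun i x => (ψ i x : ℂ)) ∧
      ∀ i x, ψ i (x + α i) - ψ i x = Φ i x - c₀ i := by
  have hp' : ∀ i x, (Φ i (x + 1) : ℂ) = Φ i x := fun i x => by rw [hp]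
  have hr : ∀ i, Rapid (fc fun x => (Φ i x : ℂ)) := fun i => rapid_fc (hΦ i) (hp' i)
  set g : ι → ℤ → ℂ := fun i => gdiv (α i) (fc fun x => (Φ i x : ℂ)) with hg
  have hgr : ∀ i, Rapid (g i) := fun i => rapid_gdiv (hη i) (hα i) (hr i)
  obtain ⟨C, hC, hb⟩ := hd.bd
  have hO : OB (fun i => (η i ^ 2)⁻¹) s fun i x => ev (g i) x := by
    refine ⟨fun i => (hgr i).contDiff_ev, fun i x => ev_add_one _ _,
      fun i => by have := hη i; positivity,
      ∑ l ∈ Finset.range (s + 1),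
        (ENNReal.ofReal (2 * Real.pi) ^ l * (fourierConst (l + 1) * ENNReal.ofReal C)).toReal,
      Finset.sum_nonneg fun _ _ => ENNReal.toReal_nonneg, fun i l hl x => ?_⟩
    have hη' := hη i
    have h1 : nrm (wt 1 (l + 1)) (dseq (fc fun x => (Φ i x : ℂ))) ≤
        fourierConst (l + 1) * ENNReal.ofReal C := by
      rw [← fc_deriv (hΦ i) (hp' i)]
      refine nrm_fc_le (contDiff_deriv (hΦ i)) (deriv_add_one (hp' i)) (l + 1) fun m hm y => ?_
      simpa using hb i m (by omega) y
    have h2 := ((hgr i).enorm_iteratedDeriv_le l x).trans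
      (mul_le_mul_right ((nrm_gdiv_le (hη i) (hα i) _ l).trans (mul_le_mul_right h1 _)) _)
    rw [mul_left_comm] at h2
    have hfin : ENNReal.ofReal (2 * Real.pi) ^ l * (fourierConst (l + 1) * ENNReal.ofReal C) ≠ ∞ :=
      ENNReal.mul_ne_top (ENNReal.pow_ne_top ENNReal.ofReal_ne_top)
        (ENNReal.mul_ne_top (fourierConst_ne_top _) ENNReal.ofReal_ne_top)
    have h3 := ENNReal.toReal_mono (ENNReal.mul_ne_top ENNReal.ofReal_ne_top hfin) h2
    rw [ENNReal.toReal_mul, ENNReal.toReal_ofReal (by positivity), toReal_enorm, mul_comm] at h3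
    refine h3.trans (mul_le_mul_of_nonneg_right ?_ (by positivity))
    exact Finset.single_le_sum (f := fun l => (ENNReal.ofReal (2 * Real.pi) ^ l *
      (fourierConst (l + 1) * ENNReal.ofReal C)).toReal) (fun _ _ => ENNReal.toReal_nonneg)
      (Finset.mem_range.2 (by omega))
  refine ⟨fun i x => (ev (g i) x).re, fun i => (fc (fun x => (Φ i x : ℂ)) 0).re, hO.re,
    fun i x => ?_⟩
  have h := congrArg Complex.re (ev_gdiv (hη i) (hα i) (hr i) x)
  rw [ev_fc (hΦ i) (hp' i)] at h
  simpa using h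

end Cohomological

section Straighten

variable {ι : Type*}

lemma ex_eq_exp_mul (t : ℝ) : ex t = Complex.exp ((2 * Real.pi * Complex.I) * t) := by
  rw [ex]; congr 1; ring

lemma cmat_straighten {z b : ℂ} {m Ψ u v c : ℝ} (hz : z = m * ex Ψ) (h : v - u = Ψ - c) :
    cmat z b * cmat (ex u) 0 = cmat (ex v) 0 *
      cmat (ex c + ex c * (m - 1)) (ex (-(v + u)) * b) := by
  obtain rfl : Ψ = v - u + c := by linarith
  rw [cmat_mul, cmat_mul, hz]
  have h1 : ex (v - u + c) = ex v * ex (-u) * ex c := by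
    rw [sub_eq_add_neg, ex_add, ex_add]
  have h2 : ex (-(v + u)) = ex (-v) * ex (-u) := by
    rw [neg_add, ex_add]
  have h3 : ex v * ex (-v) = 1 := by rw [← ex_add]; simp [ex_zero]
  have h4 : ex u * ex (-u) = 1 := by rw [← ex_add]; simp [ex_zero]
  congr 1
  · rw [h1]
    simp only [map_zero, mul_zero, zero_mul, add_zero]
    linear_combination (m * ex v * ex c) * h4
  · rw [h2, conj_ex]
    simp only [mul_zero, zero_mul, add_zero, zero_add]
    linear_combination (-(ex (-u) * b)) * h3

/-- A family which is diagonal up to a high order is conjugate to perturbations of constant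
rotations. -/
theorem NearDiag.straighten {α η : ι → ℝ} {A Q B : ι → ℝ → Matrix (Fin 2) (Fin 2) ℝ}
    {a : ι → ℝ → ℂ} (hη0 : ∀ i, 0 < η i) (hη1 : ∀ i, η i ≤ 1)
    (hα : ∀ i, ∀ k : ℤ, k ≠ 0 → 4 * η i ^ 2 / (k : ℝ) ^ 2 ≤ ‖ex (k * α i) - 1‖)
    (hA : ∀ i, Continuous (A i)) (hAp : ∀ i x, A i (x + 1) = A i x)
    (hAd : ∀ i x, (A i x).det = 1) (hAa : ∀ i, PerArg fun x => ca (A i x))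
    (ha : OB (fun _ => 1) 107 a) (hQ : NearDiag A α η a 245 107 Q B) :
    ∃ C : ℝ, 0 < C ∧ ∀ i, C * η i ≤ 1 →
      ∃ (B' : ℝ → Matrix (Fin 2) (Fin 2) ℝ) (lam : ℂ) (F : PS),
        Good (α i) (A i) (η i)⁻¹ B' lam F 0 := by
  have hη0' : ∀ i, 0 ≤ η i := fun i => (hη0 i).le
  have hQd : ∀ i x, (Q i x).det = 1 := fun i x => by
    have h := congrArg Matrix.det (hQ.eqn i x)
    rw [Matrix.det_mul, Matrix.det_mul, hAd, (hQ.nice i).det, (hQ.nice i).det, one_mul, one_mul] at h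
    exact h.symm
  have hb := hQ.snd
  have hb1 : OB (fun _ => 1) 107 fun i x => cb (Q i x) := by
    simpa using hb.of_pow_le hη0' hη1 (n := 0) (by norm_num)
  have hc : OB (fun _ => 1) 107 fun i x => ca (Q i x) := by
    have h : OB (fun _ => 1) 107 fun i x => ca (Q i x) - a i x := by
      simpa using hQ.fst.of_pow_le hη0' hη1 (n := 0) (by norm_num)
    exact (h.add ha).congr fun i x => by ring
  set r : ι → ℝ → ℝ := fun i x => 1 + ‖cb (Q i x)‖ ^ 2 with hr
  have hr1 : ∀ i x, 1 ≤ r i x := fun i x => by simp only [hr]; nlinarith [norm_nonneg (cb (Q i x))]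
  have hrO : OB (fun _ => 1) 107 fun i x => (r i x : ℂ) := by
    refine ((ob_const_one 1).add (hb1.mul_one hb1.star)).congr fun i x => ?_
    rw [Complex.mul_conj']
    simp [hr]
  set m : ι → ℝ → ℝ := fun i x => √(r i x) with hm
  have hmO : OB (fun _ => 1) 107 fun i x => (m i x : ℂ) := hrO.sqrt one_pos hr1
  have hmiO : OB (fun _ => 1) 107 fun i x => (((m i x)⁻¹ : ℝ) : ℂ) := hrO.rsqrt one_pos hr1
  have hm2 : ∀ i x, m i x ^ 2 = 1 + ‖cb (Q i x)‖ ^ 2 := fun i x =>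
    Real.sq_sqrt (zero_le_one.trans (hr1 i x))
  have hm1 : ∀ i x, 1 ≤ m i x := fun i x => Real.one_le_sqrt.2 (hr1 i x)
  have hmca : ∀ i x, ‖ca (Q i x)‖ = m i x := fun i x => by
    have h := hQd i x
    rw [det_eq] at h
    rw [← abs_of_nonneg (norm_nonneg (ca (Q i x))), ← abs_of_nonneg (zero_le_one.trans (hm1 i x)),
      ← sq_eq_sq_iff_abs_eq_abs, hm2]
    linarith
  have hw : OB (fun _ => 1) 107 fun i x => ca (Q i x) * (((m i x)⁻¹ : ℝ) : ℂ) := hc.mul_one hmiO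
  have hPA : ∀ i, PerArg fun x => ca (Q i x) := fun i =>
    perArg_of_conj (hA i) (hAp i) (hAd i) (hAa i) (hQ.nice i) (hQ.eqn i)
  choose Ψ hΨc hΨp hΨ using hPA
  replace hΨ : ∀ i x, ca (Q i x) = ‖ca (Q i x)‖ * ex (Ψ i x) := hΨ
  have hwΨ : ∀ i x, ca (Q i x) * (((m i x)⁻¹ : ℝ) : ℂ) = ex (Ψ i x) := fun i x => by
    have h1 : (m i x : ℂ) ≠ 0 := by
      exact_mod_cast (zero_lt_one.trans_le (hm1 i x)).ne'
    rw [hΨ i x, hmca]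
    push_cast
    field_simp
  have hder : ∀ i x, HasDerivAt (fun y => (Ψ i y : ℂ)) _ x := fun i x =>
    hasDerivAt_arg (hΨc i) (hw.smooth i) (hwΨ i) x
  have hdO : OB (fun _ => 1) 106 fun i => deriv fun x => (Ψ i x : ℂ) := by
    refine ((hw.deriv.mul_one (hw.mono (by norm_num)).star).mul_one
      (ob_const_one (2 * Real.pi * Complex.I)⁻¹)).congr fun i x => ?_
    exact (hder i x).deriv
  have hΨs : ∀ i, ContDiff ℝ (⊤ : ℕ∞) fun x => (Ψ i x : ℂ) := fun i =>
    (contDiff_infty_iff_deriv (𝕜 := ℝ)).2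
      ⟨fun x => (hder i x).differentiableAt, hdO.smooth i⟩
  obtain ⟨ψ, c₀, hψ, hψe⟩ := exists_cohomological (s := 103) hη0 hα hΨs hΨp hdO
  have hG1 : ∀ i, 1 ≤ (η i ^ 2)⁻¹ := fun i =>
    (one_le_inv₀ (pow_pos (hη0 i) 2)).2 (pow_le_one₀ (hη0' i) (hη1 i))
  have hE : OB (fun i => ((η i ^ 2)⁻¹) ^ 102) 102 fun i x => ex (-(ψ i (x + α i) + ψ i x)) := by
    have h1 := ((hψ.shift α).add hψ).neg.smul (c := fun _ => 2 * Real.pi * Complex.I)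
      (C := ‖(2 * Real.pi * Complex.I : ℂ)‖) fun _ => le_rfl
    have he : ∀ i x, ex (-(ψ i (x + α i) + ψ i x)) =
        Complex.exp (2 * Real.pi * Complex.I * -((ψ i (x + α i) : ℂ) + ψ i x)) := fun i x => by
      rw [ex_eq_exp_mul]; push_cast; rfl
    refine (h1.exp hG1 fun i x => ?_).congr he
    rw [← he, norm_ex]
  have hf2 : OB (fun i => η i ^ 41) 102 fun i x => ex (-(ψ i (x + α i) + ψ i x)) * cb (Q i x) := by
    refine (hE.mul (hb.mono (by norm_num))).of_le (fun i => pow_nonneg (hη0' i) _) zero_le_one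
      fun i => le_of_eq ?_
    have := (hη0 i).ne'
    field_simp
  have hf1 : OB (fun i => η i ^ 41) 102 fun i x => ex (c₀ i) * ((m i x : ℂ) - 1) := by
    have h1 := ((ob_const_one 1).add hmO).inv one_pos fun i x => by
      have : (1 : ℂ) + (m i x : ℂ) = ((1 + m i x : ℝ) : ℂ) := by push_cast; rfl
      rw [this, Complex.norm_real, Real.norm_eq_abs]
      exact le_trans (by linarith [hm1 i x]) (le_abs_self _)
    have h2 := (((hb.mul_gauge hb.star).of_pow_le hη0' hη1 (n := 41) (by norm_num)).mul_one h1).smul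
      (c := fun i => ex (c₀ i)) (C := 1) fun i => (norm_ex _).le
    refine (h2.mono (by norm_num)).congr fun i x => ?_
    have h3 : (1 : ℂ) + (m i x : ℂ) ≠ 0 := by
      exact_mod_cast (by linarith [hm1 i x] : (1 + m i x : ℝ) ≠ 0)
    have h4 : (m i x : ℂ) ^ 2 = 1 + (‖cb (Q i x)‖ : ℂ) ^ 2 := by exact_mod_cast hm2 i x
    rw [Complex.mul_conj']
    field_simp
    linear_combination ex (c₀ i) * h4
  obtain ⟨C₁, hC₁, hb1'⟩ := hf1.bd
  obtain ⟨C₂, hC₂, hb2'⟩ := hf2.bd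
  refine ⟨(fourierConst 100).toReal * (C₁ + C₂) + 1, by positivity, fun i hi => ?_⟩
  have hηi := hη0 i
  have hψc : Continuous (ψ i) := by
    simpa [Function.comp_def] using Complex.continuous_re.comp (hψ.continuous i)
  have hψp : ∀ x, ψ i (x + 1) = ψ i x := fun x => by exact_mod_cast hψ.per i x
  have hψn : Nice fun x => cmat (ex (ψ i x)) 0 := by
    refine nice_ex ?_ hψc hψp
    have : (fun x => ex (ψ i x)) = fun x => Complex.exp ((2 * Real.pi * Complex.I) * (ψ i x : ℂ)) :=
      funext fun x => ex_eq_exp_mul _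
    rw [this]
    exact (contDiff_const.mul (hψ.smooth i)).cexp
  have hN := (hQ.nice i).mul hψn
  have hn1 : 1 ≤ (η i)⁻¹ := (one_le_inv₀ hηi).2 (hη1 i)
  refine ⟨fun x => B i x * cmat (ex (ψ i x)) 0, ex (c₀ i),
    (fc fun x => ex (c₀ i) * ((m i x : ℂ) - 1),
      fc fun x => ex (-(ψ i (x + α i) + ψ i x)) * cb (Q i x)),
    hN.smooth, fun x => ?_, fun x => ?_, hN.deg, ?_, fun r => ?_, ?_, fun x => ?_⟩
  · have := hN.per (x + 1)
    rw [add_assoc, one_add_one_eq_two] at this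
    exact this.trans (hN.per x)
  · rw [hN.det]; exact one_pos
  · simpa using by positivity
  · exact ENNReal.add_ne_top.2 ⟨rapid_fc (hf1.smooth i) (hf1.per i) r,
      rapid_fc (hf2.smooth i) (hf2.per i) r⟩
  · have h1 := nrm_fc_le (hf1.smooth i) (hf1.per i) 100 (hb1' i)
    have h2 := nrm_fc_le (hf2.smooth i) (hf2.per i) 100 (hb2' i)
    have hw : ∀ c : ℤ → ℂ, nrm (wt ((η i)⁻¹ ^ 4) 100) c ≤ nrm (wt 1 100) c := fun c =>
      nrm_mono fun k => mul_le_mul_left (wt_anti one_pos (one_le_pow₀ hn1) _ _) _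
    refine (add_le_add ((hw _).trans h1) ((hw _).trans h2)).trans ?_
    rw [← mul_add, ← ENNReal.ofReal_add (by positivity) (by positivity),
      ← ENNReal.ofReal_toReal (fourierConst_ne_top 100), ← ENNReal.ofReal_mul ENNReal.toReal_nonneg]
    refine ENNReal.ofReal_le_ofReal ?_
    rw [inv_pow, inv_inv]
    have h3 : (fourierConst 100).toReal * (C₁ + C₂) * η i ≤ 1 := by nlinarith
    calc _ = ((fourierConst 100).toReal * (C₁ + C₂) * η i) * η i ^ 40 := by ring
      _ ≤ 1 * η i ^ 40 := by gcongr
      _ = _ := one_mul _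
  · have h1 := ev_fc (hf1.smooth i) (hf1.per i) x
    have h2 := ev_fc (hf2.smooth i) (hf2.per i) x
    rw [cmat_add_evm]
    simp only [h1, h2]
    rw [← Matrix.mul_assoc, hQ.eqn, Matrix.mul_assoc, Matrix.mul_assoc]
    congr 1
    rw [← cmat_straighten (z := ca (Q i x)) (m := m i x) (by rw [← hmca]; exact hΨ i x) (hψe i x),
      cmat_ca_cb]

end Straighten

section Elliptic

lemma dirVec_add_half (y : ℝ) (j : ℤ) : dirVec (y + j / 2) = (-1 : ℝ) ^ j • dirVec y := by
  have h : 2 * Real.pi * (y + j / 2) = 2 * Real.pi * y + j * Real.pi := by ring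
  ext k
  fin_cases k
  · simp [dirVec, h, Real.cos_add_int_mul_pi]
  · simp [dirVec, h, Real.sin_add_int_mul_pi]

/-- An elliptic matrix does not fix a direction. -/
lemma ActsAs.ne_add_half {P : Matrix (Fin 2) (Fin 2) ℝ} {y y' : ℝ} (h : ActsAs P y y')
    (hd : P.det = 1) (ht : |P.trace| < 2) (j : ℤ) : y' ≠ y + j / 2 := by
  rintro rfl
  obtain ⟨c, -, hc⟩ := h
  rw [dirVec_add_half, smul_smul] at hc
  obtain ⟨μ, hμ⟩ : ∃ μ, μ = c * (-1 : ℝ) ^ j := ⟨_, rfl⟩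
  rw [← hμ] at hc
  have h0 := congrFun hc 0
  have h1 := congrFun hc 1
  simp only [dirVec, Matrix.mulVec, dotProduct, Fin.sum_univ_two, Matrix.cons_val_zero,
    Matrix.cons_val_one, Pi.smul_apply, smul_eq_mul] at h0 h1
  have h2 := Real.sin_sq_add_cos_sq (2 * Real.pi * y)
  generalize Real.cos (2 * Real.pi * y) = u at *
  generalize Real.sin (2 * Real.pi * y) = v at *
  rw [Matrix.det_fin_two] at hd
  rw [Matrix.trace_fin_two] at ht
  have hu : (μ ^ 2 - (P 0 0 + P 1 1) * μ + 1) * u = 0 := by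
    linear_combination (P 1 1 - μ) * h0 - P 0 1 * h1 - u * hd
  have hv : (μ ^ 2 - (P 0 0 + P 1 1) * μ + 1) * v = 0 := by
    linear_combination (P 0 0 - μ) * h1 - P 1 0 * h0 - v * hd
  have hp : μ ^ 2 - (P 0 0 + P 1 1) * μ + 1 = 0 := by
    linear_combination u * hu + v * hv - (μ ^ 2 - (P 0 0 + P 1 1) * μ + 1) * h2
  have ht' := abs_lt.1 ht
  nlinarith [sq_nonneg (2 * μ - (P 0 0 + P 1 1))]

variable {A : ℝ → Matrix (Fin 2) (Fin 2) ℝ} {F : ℝ → ℝ → ℝ} {α ρ : ℝ}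

lemma _root_.IsProjLift.actsAs_liftIter (hF : IsProjLift A F) (n : ℕ) (x y : ℝ) :
    ActsAs (fiberProd α A n x) y (liftIter α F n x y) := by
  induction n with
  | zero => exact ⟨1, one_pos, by simp [fiberProd_zero, liftIter]⟩
  | succ n ih =>
    rw [fiberProd_succ, liftIter_succ]
    exact ActsAs.mul (hF.2.2.2 _ _) ih

lemma _root_.IsProjLift.continuous_liftIter (hF : IsProjLift A F) (n : ℕ) :
    Continuous fun p : ℝ × ℝ => liftIter α F n p.1 p.2 := by
  induction n with
  | zero => exact continuous_snd
  | succ n ih =>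
    simp only [liftIter_succ]
    exact hF.1.comp ((continuous_fst.add continuous_const).prodMk ih)

lemma _root_.IsProjLift.liftIter_add_one (hF : IsProjLift A F) (n : ℕ) (x y : ℝ) :
    liftIter α F n (x + 1) y = liftIter α F n x y := by
  induction n with
  | zero => rfl
  | succ n ih => rw [liftIter_succ, liftIter_succ, ih, add_right_comm, hF.2.1]

lemma liftIter_add (α : ℝ) (F : ℝ → ℝ → ℝ) (m n : ℕ) (x y : ℝ) :
    liftIter α F (m + n) x y = liftIter α F n (x + m * α) (liftIter α F m x y) := by
  induction n with
  | zero => rfl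
  | succ n ih =>
    rw [← add_assoc, liftIter_succ, liftIter_succ, ih]
    congr 1
    push_cast
    ring

/-- The rotation number of an iterate is attained as a displacement. -/
lemma _root_.IsProjLift.exists_displacement_eq (hF : IsProjLift A F) {q : ℕ} (hq : 0 < q)
    (hρ : Filter.Tendsto (fun n : ℕ => liftIter α F n 0 0 / (n : ℝ)) Filter.atTop (nhds ρ)) :
    ∃ x y, liftIter α F q x y - y = q * ρ := by
  set d : ℝ × ℝ → ℝ := fun p => liftIter α F q p.1 p.2 - p.2 with hd
  have hdc : Continuous d := (hF.continuous_liftIter q).sub continuous_snd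
  have hred : ∀ p : ℝ × ℝ, d (Int.fract p.1, Int.fract p.2) = d p := fun p => by
    have h1 : Function.Periodic (fun x => liftIter α F q x (Int.fract p.2)) 1 := fun x =>
      hF.liftIter_add_one q x _
    have h2 := h1.sub_zsmul_eq (x := p.1) ⌊p.1⌋
    have h3 := hF.liftIter_add_int (α := α) q p.1 (Int.fract p.2) ⌊p.2⌋
    rw [Int.fract_add_floor] at h3
    simp only [zsmul_eq_mul, mul_one, Int.self_sub_floor] at h2
    simp only [hd, h2, h3]
    have := Int.fract_add_floor p.2
    linarith
  have hK : IsCompact (Set.Icc (0 : ℝ) 1 ×ˢ Set.Icc (0 : ℝ) 1) := isCompact_Icc.prod isCompact_Icc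
  have hKn : (Set.Icc (0 : ℝ) 1 ×ˢ Set.Icc (0 : ℝ) 1).Nonempty := ⟨(0, 0), by simp⟩
  have hmem : ∀ p : ℝ × ℝ, (Int.fract p.1, Int.fract p.2) ∈ Set.Icc (0 : ℝ) 1 ×ˢ Set.Icc (0 : ℝ) 1 :=
    fun p => ⟨⟨Int.fract_nonneg _, (Int.fract_lt_one _).le⟩,
      ⟨Int.fract_nonneg _, (Int.fract_lt_one _).le⟩⟩
  obtain ⟨p₀, -, hp₀⟩ := hK.exists_isMinOn hKn hdc.continuousOn
  obtain ⟨p₁, -, hp₁⟩ := hK.exists_isMaxOn hKn hdc.continuousOn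
  have hmin : ∀ p, d p₀ ≤ d p := fun p => (hp₀ (hmem p)).trans_eq (hred p)
  have hmax : ∀ p, d p ≤ d p₁ := fun p => (hred p).symm.trans_le (hp₁ (hmem p))
  have hn : ∀ n : ℕ, n * d p₀ ≤ liftIter α F (q * n) 0 0 ∧
      liftIter α F (q * n) 0 0 ≤ n * d p₁ := fun n => by
    induction n with
    | zero => simp [liftIter]
    | succ n ih =>
      rw [mul_add, mul_one, liftIter_add]
      have h1 := hmin (0 + ((q * n : ℕ) : ℝ) * α, liftIter α F (q * n) 0 0)
      have h2 := hmax (0 + ((q * n : ℕ) : ℝ) * α, liftIter α F (q * n) 0 0)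
      simp only [hd] at h1 h2 ih ⊢
      push_cast at h1 h2 ⊢
      constructor <;> linarith [ih.1, ih.2]
  have hlim : Filter.Tendsto (fun n : ℕ => liftIter α F (q * n) 0 0 / (n : ℝ)) Filter.atTop
      (nhds (q * ρ)) := by
    have h1 := (hρ.comp (Filter.tendsto_id.const_mul_atTop' hq)).const_mul (q : ℝ)
    refine h1.congr fun n => ?_
    have : (q : ℝ) ≠ 0 := by exact_mod_cast hq.ne'
    simp only [Function.comp, id]
    push_cast
    rcases eq_or_ne (n : ℝ) 0 with h | h
    · simp [h]
    · field_simp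
  have h0 : d p₀ ≤ q * ρ := by
    refine ge_of_tendsto hlim ?_
    filter_upwards [Filter.eventually_gt_atTop 0] with n h
    rw [le_div_iff₀ (by exact_mod_cast h), mul_comm]
    exact (hn n).1
  have h1 : q * ρ ≤ d p₁ := by
    refine le_of_tendsto hlim ?_
    filter_upwards [Filter.eventually_gt_atTop 0] with n h
    rw [div_le_iff₀ (by exact_mod_cast h), mul_comm (d p₁)]
    exact (hn n).2
  obtain ⟨p, hp⟩ := mem_range_of_exists_le_of_exists_ge hdc ⟨p₀, h0⟩ ⟨p₁, h1⟩
  exact ⟨p.1, p.2, hp⟩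

lemma two_mul_rot_ne_int (hA : ∀ x, (A x).det = 1) (hρ : IsFiberedRotNum α A ρ) {q : ℕ} (hq : 0 < q)
    (htr : ∀ x, |(fiberProd α A q x).trace| < 2) (l : ℤ) : 2 * ρ ≠ l := by
  intro h
  obtain ⟨F, hF, hlim⟩ := hρ
  obtain ⟨x, y, hxy⟩ := hF.exists_displacement_eq hq hlim
  refine (hF.actsAs_liftIter (α := α) q x y).ne_add_half (det_fiberProd hA q x) (htr x) (q * l) ?_
  push_cast
  rw [← h]
  linarith

end Elliptic

section FiberProd

variable {ι : Type*} {s : ℕ} {A : ι → ℝ → Matrix (Fin 2) (Fin 2) ℝ} {θ α η : ι → ℝ}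

lemma ca_add (P R : Matrix (Fin 2) (Fin 2) ℝ) : ca (P + R) = ca P + ca R := map_add caL P R

lemma cb_add (P R : Matrix (Fin 2) (Fin 2) ℝ) : cb (P + R) = cb P + cb R := map_add cbL P R

lemma ca_sub (P R : Matrix (Fin 2) (Fin 2) ℝ) : ca (P - R) = ca P - ca R := map_sub caL P R

lemma cb_sub (P R : Matrix (Fin 2) (Fin 2) ℝ) : cb (P - R) = cb P - cb R := map_sub cbL P R

lemma obm_fiberProd_sub (hA : OBm (fun _ => 1) (s + 1) A) (hη : ∀ i, |α i - θ i| ≤ η i) (n : ℕ) :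
    OBm η s fun i x => fiberProd (α i) (A i) n x - fiberProd (θ i) (A i) n x := by
  have hη0 : ∀ i, 0 ≤ η i := fun i => (abs_nonneg _).trans (hη i)
  induction n with
  | zero =>
    simp only [fiberProd_zero, sub_self]
    have h1 : ca 0 = 0 := map_zero caL
    have h2 : cb 0 = 0 := map_zero cbL
    exact ⟨ob_const hη0 le_rfl fun i => by simp [h1], ob_const hη0 le_rfl fun i => by simp [h2]⟩
  | succ n ih =>
    have hn : ∀ i, |(n : ℝ) * α i - n * θ i| ≤ n * η i := fun i => by
      rw [← mul_sub, abs_mul, Nat.abs_cast]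
      exact mul_le_mul_of_nonneg_left (hη i) n.cast_nonneg
    have hle : ∀ i, n * η i * 1 ≤ (n : ℝ) * η i := fun i => by rw [mul_one]
    have h1 : OBm η s fun i x => A i (x + n * α i) - A i (x + n * θ i) :=
      ⟨((hA.fst.sub_shift hn).of_le hη0 n.cast_nonneg hle).congr fun i x => ca_sub _ _,
        ((hA.snd.sub_shift hn).of_le hη0 n.cast_nonneg hle).congr fun i x => cb_sub _ _⟩
    have h0 := hA.mono (Nat.le_succ s)
    have h2 := (h0.shift fun i => n * α i).mul ih
    have h3 := h0.fiberProd θ n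
    have h4 : OBm η s fun i x => (A i (x + n * α i) - A i (x + n * θ i)) *
        fiberProd (θ i) (A i) n x :=
      ⟨((h1.fst.mul_one h3.fst).add (h1.snd.mul_one h3.snd.star)).congr fun _ _ => ca_mul _ _,
        ((h1.fst.mul_one h3.snd).add (h1.snd.mul_one h3.fst.star)).congr fun _ _ => cb_mul _ _⟩
    have he : ∀ i x, fiberProd (α i) (A i) (n + 1) x - fiberProd (θ i) (A i) (n + 1) x =
        A i (x + n * α i) * (fiberProd (α i) (A i) n x - fiberProd (θ i) (A i) n x) +
        (A i (x + n * α i) - A i (x + n * θ i)) * fiberProd (θ i) (A i) n x := fun i x => by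
      rw [fiberProd_succ, fiberProd_succ]
      noncomm_ring
    simp only [he]
    exact ⟨(h2.fst.add h4.fst).congr fun i x => ca_add _ _,
      (h2.snd.add h4.snd).congr fun i x => cb_add _ _⟩

lemma exists_trace_sub_le (hA : OBm (fun _ => 1) 1 A) (hη : ∀ i, |α i - θ i| ≤ η i) (n : ℕ) :
    ∃ C, 0 ≤ C ∧ ∀ i x,
      |(fiberProd (α i) (A i) n x).trace - (fiberProd (θ i) (A i) n x).trace| ≤ C * η i := by
  obtain ⟨C, hC, h⟩ := (obm_fiberProd_sub hA hη n).fst.sup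
  refine ⟨2 * C, by positivity, fun i x => ?_⟩
  rw [trace_eq, trace_eq, ← mul_sub, ← Complex.sub_re, ← ca_sub, abs_mul, abs_two, mul_assoc]
  exact mul_le_mul_of_nonneg_left ((Complex.abs_re_le_norm _).trans (h i x)) zero_le_two

end FiberProd

section Uniform

/-- The cocycles satisfying uniform bounds, together with a frequency near a rational number. -/
structure Datum (q : ℕ) (δ M : ℝ) where
  p : ℤ
  A : ℝ → Matrix (Fin 2) (Fin 2) ℝ
  η : ℝ
  α : ℝ
  smooth : ContDiff ℝ (⊤ : ℕ∞) A
  per : ∀ x, A (x + 1) = A x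
  det : ∀ x, (A x).det = 1
  bound : ∀ l ≤ 352, ∀ x, ‖iteratedDeriv l A x‖ ≤ M
  trace : ∀ x, |(fiberProd ((p : ℝ) / (q : ℝ)) A q x).trace| ≤ 2 - δ
  pos : 0 < η
  le_one : η ≤ 1
  mem : α ∈ Dpq p q η
  arg : PerArg fun x => ca (A x)

variable {q : ℕ} {δ M : ℝ}

lemma Datum.close (d : Datum q δ M) : |d.α - (d.p : ℝ) / (q : ℝ)| ≤ d.η := by
  have h := d.mem.1
  rw [abs_le]
  constructor <;> linarith [h.1, h.2]

lemma Datum.exists_good (hq : 0 < q) (hδ : 0 < δ) (hM : 0 < M) :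
    ∃ C : ℝ, 0 < C ∧ ∀ d : Datum q δ M, C * d.η ≤ 1 →
      (∃ (B : ℝ → Matrix (Fin 2) (Fin 2) ℝ) (lam : ℂ) (F : PS), Good d.α d.A d.η⁻¹ B lam F 0) ∧
      ∀ x, |(fiberProd d.α d.A q x).trace| < 2 := by
  have hq' : (q : ℝ) ≠ 0 := by exact_mod_cast hq.ne'
  have hA : OBm (fun _ => 1) 352 fun d : Datum q δ M => d.A :=
    obm_of_bound (fun d => d.smooth) (fun d => d.per) hM.le fun d => d.bound
  have hθ : ∀ d : Datum q δ M, ∃ p : ℤ, (q : ℝ) * ((d.p : ℝ) / q) = p := fun d =>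
    ⟨d.p, by field_simp⟩
  have hF : Freq q (fun d : Datum q δ M => (d.p : ℝ) / (q : ℝ)) (fun d => d.α) fun d => d.η :=
    ⟨hθ, fun d => d.pos.le, fun d => d.le_one, fun d => d.close⟩
  obtain ⟨B, a, hB, hBO, haO, ha1, ⟨c, hc, hc1⟩, heq⟩ := exists_diagonalization hA
    (fun d => d.per) (fun d => d.det) hδ hθ fun d => d.trace
  obtain ⟨Q, B', hQ⟩ := (nearDiag_one hF hB (s := 107 + 244) hBO (haO.mono (by norm_num))
    heq).iterate hF (haO.mono (by norm_num)) ha1 hc hc1 le_rfl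
  obtain ⟨C₁, hC₁, h₁⟩ := hQ.straighten (fun d => d.pos) (fun d => d.le_one)
    (fun d => norm_ex_sub_one_ge_of_mem_DCone d.mem.2) (fun d => d.smooth.continuous)
    (fun d => d.per) (fun d => d.det) (fun d => d.arg) (haO.mono (by norm_num))
  obtain ⟨C₂, hC₂, h₂⟩ := exists_trace_sub_le (hA.mono (by norm_num))
    (fun d : Datum q δ M => d.close) q
  refine ⟨C₁ + 2 * C₂ / δ, by positivity, fun d hd => ⟨h₁ d ?_, fun x => ?_⟩⟩
  · refine le_trans (mul_le_mul_of_nonneg_right ?_ d.pos.le) hd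
    linarith [show 0 ≤ 2 * C₂ / δ by positivity]
  · have h3 : 2 * C₂ / δ * d.η ≤ 1 :=
      le_trans (mul_le_mul_of_nonneg_right (by linarith) d.pos.le) hd
    have h4 : 2 * (C₂ * d.η) ≤ δ := by
      have : 2 * C₂ / δ * d.η = 2 * (C₂ * d.η) / δ := by ring
      rwa [this, div_le_one hδ] at h3
    have h5 := abs_le.1 (h₂ d x)
    have h6 := abs_le.1 (d.trace x)
    rw [abs_lt]
    constructor <;> linarith [h5.1, h5.2, h6.1, h6.2]

/-- A number which is not an integer stays away from the integers. -/
lemma exists_pos_le_abs_sub_int {t : ℝ} (h : ∀ l : ℤ, t ≠ l) :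
    ∃ c : ℝ, 0 < c ∧ ∀ l : ℤ, c ≤ |t - l| :=
  ⟨|t - round t|, abs_pos.2 (sub_ne_zero.2 (h _)), fun l => round_le t l⟩

end Uniform

end QPCocycle

/-- The Cheap Trick.  There is an integer `s₀ ≥ 1` such that:  for every `q`, `δ > 0`
and bound `M` on `‖A‖_{C^{s₀}}` there exists `η₀ > 0` (depending only on these data)
such that, for every rational `p/q` and every smooth `A : 𝕋 → SL(2,ℝ)` homotopic to
the identity with `max_x |tr(A(x+(q−1)p/q)⋯A(x))| ≤ 2 − δ` and `‖A‖_{C^{s₀}} ≤ M`,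
for every `0 < η ≤ η₀` and every `α ∈ D_{p/q}(η)` whose fibered rotation number
`ρ(α,A)` lies in `DS_α \ {0}`, there exists `B ∈ C^∞(ℝ/2ℤ, SL(2,ℝ))` conjugating
`(α, A)` to a constant cocycle in `SO(2,ℝ)`. -/
theorem stmt_3 : ∃ s₀ : ℕ, 0 < s₀ ∧
    ∀ (q : ℕ), 0 < q → ∀ (δ M : ℝ), 0 < δ → 0 < M →
    ∃ η₀ > (0 : ℝ), ∀ (p : ℤ) (A : ℝ → Matrix (Fin 2) (Fin 2) ℝ),
      ContDiff ℝ (⊤ : ℕ∞) A → (∀ x, A (x + 1) = A x) → (∀ x, (A x).det = 1) →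
      HomotopicToId A →
      (∀ l ≤ s₀, ∀ x, ‖iteratedDeriv l A x‖ ≤ M) →
      (∀ x, |(fiberProd ((p : ℝ) / (q : ℝ)) A q x).trace| ≤ 2 - δ) →
      ∀ η : ℝ, 0 < η → η ≤ η₀ → ∀ α ∈ Dpq p q η,
        ∀ ρ : ℝ, IsFiberedRotNum α A ρ →
          (∃ κ > (0 : ℝ), ∀ k : ℤ, k ≠ 0 → ∀ l : ℤ,
            κ / (k : ℝ) ^ 2 ≤ |2 * ρ - (k : ℝ) * α - (l : ℝ)|) →
          (∀ n : ℤ, ρ ≠ (n : ℝ)) →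
          ∃ B : ℝ → Matrix (Fin 2) (Fin 2) ℝ,
            ContDiff ℝ (⊤ : ℕ∞) B ∧ (∀ x, B (x + 2) = B x) ∧ (∀ x, (B x).det = 1) ∧
            ∃ φ₀ : ℝ, ∀ x, (B (x + α))⁻¹ * A x * B x = Rot φ₀ := by
  refine ⟨352, by norm_num, fun q hq δ M hδ hM => ?_⟩
  obtain ⟨C, hC, h⟩ := QPCocycle.Datum.exists_good hq hδ hM
  refine ⟨min (1 / 2 ^ 20) (1 / C), by positivity,
    fun p A hA hAp hAd _ hb htr η hη0 hη α hα ρ hρ hκ _ => ?_⟩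
  have hη1 : η ≤ 1 / 2 ^ 20 := hη.trans (min_le_left _ _)
  have hηC : C * η ≤ 1 := by
    have := hη.trans (min_le_right _ _)
    rwa [le_div_iff₀ hC, mul_comm] at this
  have harg : QPCocycle.PerArg fun x => QPCocycle.ca (A x) := by
    obtain ⟨F, hF, -⟩ := hρ
    exact QPCocycle.perArg_of_isProjLift hA.continuous hAp hAd hF
  obtain ⟨⟨B, lam, F, hg⟩, ht⟩ := h ⟨p, A, η, α, hA, hAp, hAd, hb, htr, hη0,
    hη1.trans (by norm_num), hα, harg⟩ hηC
  obtain ⟨c, hc, hcl⟩ := QPCocycle.exists_pos_le_abs_sub_int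
    (QPCocycle.two_mul_rot_ne_int hAd hρ hq ht)
  obtain ⟨κ, hκ0, hκ⟩ := hκ
  refine hg.exists_reducible hAd hρ (η := η) (c := min c κ) ?_ hη0 ?_
    (QPCocycle.norm_ex_sub_one_ge_of_mem_DCone hα.2) (lt_min hc hκ0) fun k l => ?_
  · rw [le_inv_comm₀ (by positivity) hη0]
    simpa using hη1
  · rw [inv_mul_cancel₀ hη0.ne']
  · rcases eq_or_ne k 0 with rfl | hk
    · simpa using (min_le_left c κ).trans (hcl l)
    · refine le_trans ?_ (hκ k hk l)
      have hk' : (0 : ℝ) < (k : ℝ) ^ 2 := by positivity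
      exact div_le_div₀ hκ0.le (min_le_right _ _) hk' (by linarith)
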